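/- arXiv:2512.21873 — 4 statements merged into one kernel-verified Lean document; each statement's English description precedes it below -/
import Mathlib

section
/- Let n ≥ 3, 0 < s < 1, u ∈ L^∞(ℝⁿ), and f ∈ L^∞(ℝⁿ), and suppose that −Δu + (−Δ)^s u = f holds in the distributional sense, i.e. ∫ u(x) (−Δφ(x) + (−Δ)^s φ(x)) dx = ∫ f(x) φ(x) dx for every Schwartz function φ. Then: (1) if 2s ≤ 1, u ∈ C^{0,α}(ℝⁿ) for every α < 2s, with ‖u‖_{C^{0,α}} ≤ C(‖f‖_{L^∞} + ‖u‖_{L^∞}); (2) if 2s > 1, u ∈ C^{1,α}(ℝⁿ) for every α < 2s − 1, with ‖u‖_{C^{1,α}} ≤ C(‖f‖_{L^∞} + ‖u‖_{L^∞}); in both cases the constant C depends only on n, α, s. -/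
open MeasureTheory Metric Set
open scoped RealInnerProductSpace
noncomputable section

/-- The Laplacian `Δu(x) = ∑ᵢ ∂²u/∂xᵢ²(x)`. -/
def lap (n : ℕ) (u : EuclideanSpace ℝ (Fin n) → ℝ) (x : EuclideanSpace ℝ (Fin n)) : ℝ :=
  ∑ i : Fin n,
    iteratedFDeriv ℝ 2 u x ![EuclideanSpace.single i 1, EuclideanSpace.single i 1]

/-- The standard normalization constant `c_{n,s}` of the fractional Laplacian. -/
def fracLapConst (n : ℕ) (s : ℝ) : ℝ :=
  (2 : ℝ) ^ (2 * s) * s * Real.Gamma ((n : ℝ) / 2 + s)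
    / (Real.pi ^ ((n : ℝ) / 2) * Real.Gamma (1 - s))

/-- The fractional Laplacian
`(-Δ)^s u(x) = (c_{n,s}/2) ∫ (2u(x) - u(x+z) - u(x-z))/|z|^{n+2s} dz`. -/
def fracLap (n : ℕ) (s : ℝ) (u : EuclideanSpace ℝ (Fin n) → ℝ)
    (x : EuclideanSpace ℝ (Fin n)) : ℝ :=
  (fracLapConst n s / 2) *
    ∫ z : EuclideanSpace ℝ (Fin n),
      (2 * u x - u (x + z) - u (x - z)) / ‖z‖ ^ ((n : ℝ) + 2 * s)

set_option linter.unusedSectionVars false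

section Aux

variable {E : Type*} [NormedAddCommGroup E] [InnerProductSpace ℝ E] [FiniteDimensional ℝ E]
  [MeasurableSpace E] [BorelSpace E]

lemma aux_le_rpow {a β : ℝ} (ha : 0 ≤ a) (ha1 : a ≤ 1) (hβ1 : β ≤ 1) : a ≤ a ^ β := by
  rcases ha.eq_or_lt with h | h
  · rw [← h]; exact Real.rpow_nonneg le_rfl _
  · calc a = a ^ (1 : ℝ) := (Real.rpow_one a).symm
      _ ≤ a ^ β := Real.rpow_le_rpow_of_exponent_ge h ha1 hβ1

/-- `L¹` modulus of continuity of a compactly supported `C¹` function. -/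
lemma aux_modulus {F : Type*} [NormedAddCommGroup F] [NormedSpace ℝ F] (η : E → F)
    (hη : ContDiff ℝ 1 η) (hc : HasCompactSupport η) {β : ℝ} (hβ : 0 < β) (hβ1 : β ≤ 1) :
    ∃ C : ℝ, 0 ≤ C ∧ ∀ a : E, ∫ z, ‖η (z + a) - η z‖ ≤ C * ‖a‖ ^ β := by
  obtain ⟨K, hK⟩ := ContDiff.lipschitzWith_of_hasCompactSupport hc hη one_ne_zero
  obtain ⟨R, hR⟩ := hc.isCompact.isBounded.subset_closedBall (0 : E)
  have hz : ∀ z : E, R < ‖z‖ → η z = 0 := by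
    intro z hz
    by_contra h
    have := hR (subset_tsupport _ h)
    simp at this
    linarith
  have hi : Integrable (fun z => ‖η z‖) := (hη.continuous.norm).integrable_of_hasCompactSupport hc.norm
  have hI0 : 0 ≤ ∫ z, ‖η z‖ := integral_nonneg fun _ => norm_nonneg _
  set V := (volume : Measure E).real (closedBall 0 (R + 1)) with hV
  have hV0 : 0 ≤ V := measureReal_nonneg
  refine ⟨K * V + 2 * ∫ z, ‖η z‖, by positivity, fun a => ?_⟩
  have hia : Integrable (fun z => ‖η (z + a)‖) := hi.comp_add_right a
  have hic : Integrable (fun z => ‖η (z + a) - η z‖) := by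
    refine (hia.add hi).mono' ?_ ?_
    · exact (((hη.continuous.comp (continuous_id.add continuous_const)).sub
        hη.continuous).norm).aestronglyMeasurable
    · refine Filter.Eventually.of_forall fun z => ?_
      simpa using norm_sub_le _ _
  rcases le_total ‖a‖ 1 with h | h
  · have h1 : ∀ z, ‖η (z + a) - η z‖ ≤ (closedBall (0:E) (R + 1)).indicator (fun _ => K * ‖a‖) z := by
      intro z
      by_cases hzz : z ∈ closedBall (0:E) (R + 1)
      · rw [indicator_of_mem hzz]
        have := hK.norm_sub_le (z + a) z
        simpa using this
      · rw [indicator_of_notMem hzz]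
        have hzz' : R + 1 < ‖z‖ := by simpa using hzz
        have h2 : ‖z‖ ≤ ‖z + a‖ + ‖a‖ := by
          have := norm_sub_le (z + a) a
          simpa using this
        rw [hz z (by linarith), hz (z + a) (by linarith)]
        simp
    calc ∫ z, ‖η (z + a) - η z‖ ≤ ∫ z, (closedBall (0:E) (R + 1)).indicator (fun _ => K * ‖a‖) z := by
          refine integral_mono hic ?_ h1
          refine (integrable_indicator_iff measurableSet_closedBall).2 ?_
          exact integrableOn_const measure_closedBall_lt_top.ne
      _ = V * (K * ‖a‖) := by
          rw [integral_indicator measurableSet_closedBall, setIntegral_const, smul_eq_mul]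
      _ ≤ (K * V + 2 * ∫ z, ‖η z‖) * ‖a‖ := by
          nlinarith [norm_nonneg a, mul_nonneg hI0 (norm_nonneg a)]
      _ ≤ _ := by
          gcongr
          exact aux_le_rpow (norm_nonneg a) h hβ1
  · calc ∫ z, ‖η (z + a) - η z‖ ≤ ∫ z, (‖η (z + a)‖ + ‖η z‖) :=
          integral_mono hic (hia.add hi) fun z => norm_sub_le _ _
      _ = 2 * ∫ z, ‖η z‖ := by
          rw [integral_add hia hi, integral_add_right_eq_self (fun z => ‖η z‖) a]; ring
      _ ≤ (K * V + 2 * ∫ z, ‖η z‖) * 1 := by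
          have : 0 ≤ (K:ℝ) * V := by positivity
          linarith
      _ ≤ _ := by
          gcongr
          exact Real.one_le_rpow h hβ.le

lemma aux_taylor {v : E → ℝ} {g : E → E →L[ℝ] ℝ} (hv : ∀ x, HasFDerivAt v (g x) x) {A β : ℝ}
    (hβ : 0 < β) (hA : ∀ x y, ‖g x - g y‖ ≤ A * ‖x - y‖ ^ β) (hA0 : 0 ≤ A) (x z : E) :
    |v (x + z) - v x - g x z| ≤ A * ‖z‖ ^ (1 + β) := by
  have := (convex_closedBall x ‖z‖).norm_image_sub_le_of_norm_hasFDerivWithin_le' (𝕜 := ℝ)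
    (f := v) (f' := g) (φ := g x) (C := A * ‖z‖ ^ β) (x := x) (y := x + z)
    (fun y _ => (hv y).hasFDerivWithinAt) (fun y hy => ?_) (by simp) (by simp)
  · have h2 : ‖z‖ ^ (1 + β) = ‖z‖ ^ β * ‖z‖ := by
      rcases (norm_nonneg z).eq_or_lt with h | h
      · rw [← h, Real.zero_rpow (by linarith)]; simp
      · rw [Real.rpow_add h, Real.rpow_one, mul_comm]
    rw [h2, ← mul_assoc]
    simpa using this
  · refine (hA y x).trans ?_
    gcongr
    simpa [dist_eq_norm] using hy

lemma aux_second_diff {v : E → ℝ} {g : E → E →L[ℝ] ℝ} (hv : ∀ x, HasFDerivAt v (g x) x) {A β : ℝ}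
    (hβ : 0 < β) (hA : ∀ x y, ‖g x - g y‖ ≤ A * ‖x - y‖ ^ β) (hA0 : 0 ≤ A) (x z : E) :
    |2 * v x - v (x + z) - v (x - z)| ≤ 2 * A * ‖z‖ ^ (1 + β) := by
  have h1 := aux_taylor hv hβ hA hA0 x z
  have h2 := aux_taylor hv hβ hA hA0 x (-z)
  rw [norm_neg, map_neg, ← sub_eq_add_neg] at h2
  rw [abs_le] at *
  constructor <;> linarith [h1.1, h1.2, h2.1, h2.2]

lemma aux_kernel [Nontrivial E] {s : ℝ} (hs : s ∈ Ioo (0:ℝ) 1) :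
    Integrable (fun z : E => min 1 (‖z‖ ^ (1 + s)) / ‖z‖ ^ ((Module.finrank ℝ E : ℝ) + 2 * s)) := by
  have hd : 0 < Module.finrank ℝ E := Module.finrank_pos
  refine (integrable_fun_norm_addHaar (E := E) volume
    (f := fun r : ℝ => min 1 (r ^ (1 + s)) / r ^ ((Module.finrank ℝ E : ℝ) + 2 * s))).2 ?_
  set d := Module.finrank ℝ E
  have key : ∀ r : ℝ, 0 < r → r ^ (d - 1) • (min 1 (r ^ (1 + s)) / r ^ ((d : ℝ) + 2 * s))
      = min 1 (r ^ (1 + s)) * r ^ (-1 - 2 * s) := by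
    intro r hr
    have : r ^ (d - 1) = r ^ ((d : ℝ) - 1) := by
      rw [← Real.rpow_natCast, Nat.cast_sub hd]; simp
    have h2 : r ^ (-1 - 2 * s) = r ^ ((d : ℝ) - 1) / r ^ ((d : ℝ) + 2 * s) := by
      rw [← Real.rpow_sub hr]; congr 1; ring
    rw [smul_eq_mul, this, h2]
    ring
  have hm : Measurable (fun r : ℝ => r ^ (d - 1) • (min 1 (r ^ (1 + s)) / r ^ ((d : ℝ) + 2 * s))) := by
    fun_prop
  rw [← Ioc_union_Ioi_eq_Ioi (zero_le_one (α := ℝ)), integrableOn_union]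
  constructor
  · have h1 : IntegrableOn (fun r : ℝ => r ^ (-s)) (Ioc 0 1) := by
      rw [← intervalIntegrable_iff_integrableOn_Ioc_of_le zero_le_one]
      exact intervalIntegral.intervalIntegrable_rpow' (by linarith [hs.2])
    refine h1.mono' hm.aestronglyMeasurable ?_
    refine (ae_restrict_iff' measurableSet_Ioc).2 (Filter.Eventually.of_forall fun r hr => ?_)
    rw [key r hr.1, Real.norm_of_nonneg (mul_nonneg (le_min zero_le_one (Real.rpow_nonneg hr.1.le _)) (Real.rpow_nonneg hr.1.le _))]
    calc _ ≤ r ^ (1 + s) * r ^ (-1 - 2 * s) := by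
          gcongr
          · exact Real.rpow_nonneg hr.1.le _
          · exact min_le_right _ _
      _ = _ := by rw [← Real.rpow_add hr.1]; ring_nf
  · have h1 : IntegrableOn (fun r : ℝ => r ^ (-1 - 2 * s)) (Ioi 1) :=
      integrableOn_Ioi_rpow_of_lt (by linarith [hs.1]) zero_lt_one
    refine h1.mono' hm.aestronglyMeasurable ?_
    refine (ae_restrict_iff' measurableSet_Ioi).2 (Filter.Eventually.of_forall fun r hr => ?_)
    have hr0 : (0:ℝ) < r := lt_trans zero_lt_one hr
    rw [key r hr0, Real.norm_of_nonneg (mul_nonneg (le_min zero_le_one (Real.rpow_nonneg hr0.le _)) (Real.rpow_nonneg hr0.le _))]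
    exact mul_le_of_le_one_left (Real.rpow_nonneg hr0.le _) (min_le_left _ _)

lemma aux_bump : ∃ ρ ψ : E → ℝ, ContDiff ℝ 3 ρ ∧ ContDiff ℝ 3 ψ ∧ HasCompactSupport ρ ∧
    HasCompactSupport ψ ∧ ∫ z, ρ z = 1 ∧ ∀ z e, fderiv ℝ ψ z e = -(ρ z * inner ℝ z e) := by
  set q := expNegInvGlue with hq
  have hqc : ContDiff ℝ 3 q := by exact_mod_cast expNegInvGlue.contDiff (n := 3)
  set Q : ℝ → ℝ := fun r => ∫ t in (0:ℝ)..r, q t with hQ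
  have hQd : ∀ r, HasDerivAt Q (q r) r := fun r =>
    (hqc.continuous.integral_hasStrictDerivAt 0 r).hasDerivAt
  have hQc : ContDiff ℝ 3 Q := by
    have : ContDiff ℝ (2 + 1) Q := by
      rw [contDiff_succ_iff_deriv]
      refine ⟨fun r => (hQd r).differentiableAt, by simp, ?_⟩
      rw [show deriv Q = q from funext fun r => (hQd r).deriv]
      exact hqc.of_le (by norm_num)
    convert this using 1
    norm_num
  have hQ0 : ∀ r ≤ 0, Q r = 0 := by
    intro r hr
    rw [hQ]
    simp only
    rw [intervalIntegral.integral_symm, intervalIntegral.integral_of_le hr, setIntegral_congr_fun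
      measurableSet_Ioc (g := fun _ => (0:ℝ))]
    · simp
    · intro t ht
      exact expNegInvGlue.zero_of_nonpos ht.2
  have hP : ContDiff ℝ 3 (fun z : E => 1 - ‖z‖ ^ 2) := contDiff_const.sub (contDiff_norm_sq ℝ)
  have hsupp : ∀ S : ℝ → ℝ, (∀ r ≤ 0, S r = 0) → HasCompactSupport (fun z : E => S (1 - ‖z‖ ^ 2)) := by
    intro S hS
    refine HasCompactSupport.of_support_subset_isCompact (isCompact_closedBall (0:E) 1) ?_
    intro z hz
    by_contra h
    have h' : 1 < ‖z‖ := by simpa using h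
    exact hz (hS _ (by nlinarith))
  have h1 := hsupp q fun r hr => expNegInvGlue.zero_of_nonpos hr
  have h1c : ContDiff ℝ 3 (fun z : E => q (1 - ‖z‖ ^ 2)) := hqc.comp hP
  have hpos : 0 < ∫ z : E, q (1 - ‖z‖ ^ 2) := by
    refine h1c.continuous.integral_pos_of_hasCompactSupport_nonneg_nonzero (x := 0) h1
      (fun z => expNegInvGlue.nonneg _) ?_
    exact (expNegInvGlue.pos_of_pos (by simp)).ne'
  set c := (∫ z : E, q (1 - ‖z‖ ^ 2))⁻¹ with hc
  refine ⟨fun z => c * q (1 - ‖z‖ ^ 2), fun z => (c / 2) * Q (1 - ‖z‖ ^ 2), contDiff_const.mul h1c,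
    contDiff_const.mul (hQc.comp hP), h1.mul_left, (hsupp Q hQ0).mul_left, ?_, ?_⟩
  · rw [integral_const_mul, hc, inv_mul_cancel₀ hpos.ne']
  · intro z e
    have h2 : HasFDerivAt (fun z : E => 1 - ‖z‖ ^ 2) (-(2 • (innerSL ℝ z))) z := by
      have := (hasStrictFDerivAt_norm_sq z).hasFDerivAt.const_sub 1
      exact this
    have h3 := ((hQd (1 - ‖z‖ ^ 2)).comp_hasFDerivAt z h2).const_mul (c / 2)
    rw [HasFDerivAt.fderiv (f := fun z => (c / 2) * Q (1 - ‖z‖ ^ 2)) h3]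
    simp
    ring

lemma aux_ibp {ρ w : E → ℝ} (hρ : ContDiff ℝ 1 ρ) (hc : HasCompactSupport ρ) (hw : ContDiff ℝ 1 w)
    (e : E) : ∫ z, ρ z * fderiv ℝ w z e = -∫ z, fderiv ℝ ρ z e * w z := by
  have h1 : Continuous fun z => fderiv ℝ ρ z e :=
    (hρ.continuous_fderiv one_ne_zero).clm_apply continuous_const
  have h2 : Continuous fun z => fderiv ℝ w z e :=
    (hw.continuous_fderiv one_ne_zero).clm_apply continuous_const
  refine integral_mul_fderiv_eq_neg_fderiv_mul_of_integrable ?_ ?_ ?_ ?_ ?_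
  · exact (h1.mul hw.continuous).integrable_of_hasCompactSupport (hc.fderiv_apply ℝ e).mul_right
  · exact (hρ.continuous.mul h2).integrable_of_hasCompactSupport hc.mul_right
  · exact (hρ.continuous.mul hw.continuous).integrable_of_hasCompactSupport hc.mul_right
  · exact fun x _ => hρ.differentiable one_ne_zero x
  · exact fun x _ => hw.differentiable one_ne_zero x

lemma aux_symm {v : E → ℝ} (hv : ContDiff ℝ 2 v) (x a b : E) :
    fderiv ℝ (fderiv ℝ v) x a b = fderiv ℝ (fderiv ℝ v) x b a :=
  (hv.contDiffAt.isSymmSndFDerivAt (by simp)) a b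

lemma aux_fderiv_apply {v : E → ℝ} (hv : ContDiff ℝ 2 v) (x a b : E) :
    fderiv ℝ (fun z => fderiv ℝ v z a) x b = fderiv ℝ (fderiv ℝ v) x b a := by
  have h : HasFDerivAt (fderiv ℝ v) (fderiv ℝ (fderiv ℝ v) x) x :=
    ((hv.fderiv_right (m := 1) (by norm_num)).differentiable one_ne_zero x).hasFDerivAt
  rw [(h.clm_apply (hasFDerivAt_const a x)).fderiv]
  simp

lemma aux_ibp_symm {ψ w : E → ℝ} (hψ : ContDiff ℝ 2 ψ) (hc : HasCompactSupport ψ)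
    (hw : ContDiff ℝ 1 w) (a b : E) :
    ∫ z, fderiv ℝ ψ z a * fderiv ℝ w z b = ∫ z, fderiv ℝ ψ z b * fderiv ℝ w z a := by
  have h : ∀ a, ContDiff ℝ 1 fun z => fderiv ℝ ψ z a := fun a =>
    (hψ.fderiv_right (m := 1) (by norm_num)).clm_apply contDiff_const
  rw [aux_ibp (h a) (hc.fderiv_apply ℝ a) hw, aux_ibp (h b) (hc.fderiv_apply ℝ b) hw]
  simp_rw [aux_fderiv_apply hψ]
  congr 2
  ext z
  rw [aux_symm hψ]

lemma aux_G {ρ v : E → ℝ} (hρ : Continuous ρ) (hc : HasCompactSupport ρ) (hv : ContDiff ℝ 2 v)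
    {L : ℝ} (hL : ∀ x, ‖fderiv ℝ (fderiv ℝ v) x‖ ≤ L) (x e : E) (t : ℝ) :
    HasDerivAt (fun t : ℝ => ∫ z, ρ z * fderiv ℝ v (x - t • z) e)
      (∫ z, -(ρ z * fderiv ℝ (fderiv ℝ v) (x - t • z) z e)) t := by
  have hv1 : ContDiff ℝ 1 (fderiv ℝ v) := hv.fderiv_right (m := 1) (by norm_num)
  have hv2 : Continuous (fderiv ℝ (fderiv ℝ v)) := hv1.continuous_fderiv one_ne_zero
  have hd : ∀ x, HasFDerivAt (fderiv ℝ v) (fderiv ℝ (fderiv ℝ v) x) x := fun x =>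
    (hv1.differentiable one_ne_zero x).hasFDerivAt
  have hcont : ∀ t : ℝ, Continuous fun z => ρ z * fderiv ℝ v (x - t • z) e := fun t => by
    have : Continuous fun z => fderiv ℝ v (x - t • z) := hv1.continuous.comp (by fun_prop)
    exact hρ.mul (this.clm_apply continuous_const)
  have hcont' : Continuous fun z => -(ρ z * fderiv ℝ (fderiv ℝ v) (x - t • z) z e) := by
    have : Continuous fun z => fderiv ℝ (fderiv ℝ v) (x - t • z) := hv2.comp (by fun_prop)
    exact (hρ.mul ((this.clm_apply continuous_id).clm_apply continuous_const)).neg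
  refine (hasDerivAt_integral_of_dominated_loc_of_deriv_le (s := univ)
    (bound := fun z => |ρ z| * (L * ‖z‖ * ‖e‖))
    (F' := fun t z => -(ρ z * fderiv ℝ (fderiv ℝ v) (x - t • z) z e))
    Filter.univ_mem ?_ ?_ ?_ ?_ ?_ ?_).2
  · exact Filter.Eventually.of_forall fun t => (hcont t).aestronglyMeasurable
  · exact (hcont t).integrable_of_hasCompactSupport hc.mul_right
  · exact hcont'.aestronglyMeasurable
  · refine Filter.Eventually.of_forall fun z t _ => ?_
    rw [norm_neg, norm_mul, Real.norm_eq_abs]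
    gcongr
    refine (ContinuousLinearMap.le_opNorm _ _).trans ?_
    gcongr
    refine (ContinuousLinearMap.le_opNorm _ _).trans ?_
    gcongr
    exact hL _
  · refine Continuous.integrable_of_hasCompactSupport (by fun_prop) ?_
    exact (hc.norm).mul_right
  · refine Filter.Eventually.of_forall fun z t _ => ?_
    have h1 : HasDerivAt (fun t : ℝ => x - t • z) (-z) t := by
      simpa using ((hasDerivAt_id t).smul_const z).const_sub x
    have h2 := (hd (x - t • z)).comp_hasDerivAt t h1
    have h3 := (h2.clm_apply (hasDerivAt_const t e)).const_mul (ρ z)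
    have h4 : -(ρ z * fderiv ℝ (fderiv ℝ v) (x - t • z) z e)
        = ρ z * ((fderiv ℝ (fderiv ℝ v) (x - t • z) (-z)) e
          + ((fderiv ℝ v ∘ fun t => x - t • z) t) 0) := by simp
    rw [h4]
    exact h3

lemma aux_G' {ι : Type*} [Fintype ι] (b : OrthonormalBasis ι ℝ E) {ρ ψ v : E → ℝ}
    (hψ : ContDiff ℝ 2 ψ) (hc : HasCompactSupport ψ)
    (hρψ : ∀ z e, fderiv ℝ ψ z e = -(ρ z * inner ℝ z e)) (hv : ContDiff ℝ 2 v)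
    (x e : E) {t : ℝ} (ht : 0 < t) :
    ∫ z, -(ρ z * fderiv ℝ (fderiv ℝ v) (x - t • z) z e)
      = ∫ z, fderiv ℝ ψ z e * ∑ i, fderiv ℝ (fderiv ℝ v) (x - t • z) (b i) (b i) := by
  have hv1 : ContDiff ℝ 1 (fderiv ℝ v) := hv.fderiv_right (m := 1) (by norm_num)
  have hv2 : Continuous (fderiv ℝ (fderiv ℝ v)) := hv1.continuous_fderiv one_ne_zero
  have hψ1 : ∀ a, Continuous fun z => fderiv ℝ ψ z a := fun a =>
    (hψ.continuous_fderiv two_ne_zero).clm_apply continuous_const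
  have hcont : ∀ a c : E, Continuous fun z => fderiv ℝ (fderiv ℝ v) (x - t • z) a c := fun a c => by
    have : Continuous fun z => fderiv ℝ (fderiv ℝ v) (x - t • z) := hv2.comp (by fun_prop)
    exact (this.clm_apply continuous_const).clm_apply continuous_const
  have hInt : ∀ a c d : E,
      Integrable fun z => fderiv ℝ ψ z d * fderiv ℝ (fderiv ℝ v) (x - t • z) a c := fun a c d =>
    ((hψ1 d).mul (hcont a c)).integrable_of_hasCompactSupport (hc.fderiv_apply ℝ d).mul_right
  have h1 : ∀ z, -(ρ z * fderiv ℝ (fderiv ℝ v) (x - t • z) z e)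
      = ∑ i, fderiv ℝ ψ z (b i) * fderiv ℝ (fderiv ℝ v) (x - t • z) (b i) e := by
    intro z
    have : fderiv ℝ (fderiv ℝ v) (x - t • z) z e
        = ∑ i, inner ℝ (b i) z * fderiv ℝ (fderiv ℝ v) (x - t • z) (b i) e := by
      generalize x - t • z = p
      conv_lhs => rw [← b.sum_repr' z]
      simp [map_sum]
    rw [this, Finset.mul_sum, ← Finset.sum_neg_distrib]
    refine Finset.sum_congr rfl fun i _ => ?_
    rw [hρψ, real_inner_comm]; ring
  simp_rw [h1, Finset.mul_sum]
  rw [integral_finsetSum _ fun i _ => hInt _ _ _, integral_finsetSum _ fun i _ => hInt _ _ _]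
  refine Finset.sum_congr rfl fun i _ => ?_
  have hw : ContDiff ℝ 1 fun z : E => fderiv ℝ v (x - t • z) (b i) := by
    refine ContDiff.clm_apply (hv1.comp ?_) contDiff_const
    fun_prop
  have hwd : ∀ z c, fderiv ℝ (fun z : E => fderiv ℝ v (x - t • z) (b i)) z c
      = -t * fderiv ℝ (fderiv ℝ v) (x - t • z) c (b i) := by
    intro z c
    have h1 : HasFDerivAt (fun z : E => x - t • z) (-(t • ContinuousLinearMap.id ℝ E)) z :=
      ((hasFDerivAt_id z).const_smul t).const_sub x
    have h2 := ((hv1.differentiable one_ne_zero (x - t • z)).hasFDerivAt).comp z h1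
    have h3 := h2.clm_apply (hasFDerivAt_const (b i) z)
    rw [HasFDerivAt.fderiv (f := fun z : E => fderiv ℝ v (x - t • z) (b i)) h3]
    simp
  have := aux_ibp_symm hψ hc hw (b i) e
  simp_rw [hwd] at this
  have h4 : ∀ a c d : E, ∫ z, fderiv ℝ ψ z a * (-t * fderiv ℝ (fderiv ℝ v) (x - t • z) c d)
     = -t * ∫ z, fderiv ℝ ψ z a * fderiv ℝ (fderiv ℝ v) (x - t • z) c d := by
    intro a c d
    rw [← integral_const_mul]
    congr 1; ext z; ring
  rw [h4, h4] at this
  have h5 := mul_left_cancel₀ (neg_ne_zero.2 ht.ne') this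
  rw [← h5]
  congr 1; ext z
  rw [aux_symm hv]

lemma aux_cmp {H H' B B' : ℝ → ℝ} {T : ℝ} (hT : 0 < T) (hH : ContinuousOn H (Icc 0 T))
    (hH' : ∀ t ∈ Ioo 0 T, HasDerivAt H (H' t) t) (hB : ContinuousOn B (Icc 0 T))
    (hB' : ∀ t ∈ Ioo 0 T, HasDerivAt B (B' t) t) (h : ∀ t ∈ Ioo 0 T, |H' t| ≤ B' t) :
    |H T - H 0| ≤ B T - B 0 := by
  have key : ∀ F F' : ℝ → ℝ, ContinuousOn F (Icc 0 T) → (∀ t ∈ Ioo 0 T, HasDerivAt F (F' t) t) →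
      (∀ t ∈ Ioo 0 T, F' t ≤ B' t) → F T - F 0 ≤ B T - B 0 := by
    intro F F' hF hF' hle
    have h1 : AntitoneOn (fun t => F t - B t) (Icc 0 T) := by
      refine antitoneOn_of_deriv_nonpos (convex_Icc 0 T) (hF.sub hB) ?_ ?_
      · rw [interior_Icc]
        exact fun t ht => ((hF' t ht).sub (hB' t ht)).differentiableAt.differentiableWithinAt
      · rw [interior_Icc]
        intro t ht
        rw [HasDerivAt.deriv (f := fun t => F t - B t) ((hF' t ht).sub (hB' t ht))]
        linarith [hle t ht]
    have := h1 (left_mem_Icc.2 hT.le) (right_mem_Icc.2 hT.le) hT.le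
    simp only at this
    linarith
  rw [abs_le]
  constructor
  · have := key (fun t => -H t) (fun t => -H' t) hH.neg (fun t ht => (hH' t ht).neg)
      fun t ht => by linarith [(abs_le.1 (h t ht)).1]
    linarith
  · exact key H H' hH hH' fun t ht => (abs_le.1 (h t ht)).2

lemma aux_bdd {η : E → E →L[ℝ] ℝ} (hη : Continuous η) (hc : HasCompactSupport η) {w : E → ℝ}
    {N : ℝ} (hw : ∀ x, |w x| ≤ N) (e : E) :
    |∫ z, η z e * w z| ≤ N * ‖e‖ * ∫ z, ‖η z‖ := by
  have hi : Integrable fun z => ‖η z‖ := hη.norm.integrable_of_hasCompactSupport hc.norm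
  rw [← Real.norm_eq_abs, ← integral_const_mul]
  refine norm_integral_le_of_norm_le (hi.const_mul _) (Filter.Eventually.of_forall fun z => ?_)
  rw [norm_mul, Real.norm_eq_abs (w z)]
  calc _ ≤ (‖η z‖ * ‖e‖) * N := by
        gcongr
        · exact ContinuousLinearMap.le_opNorm _ _
        · exact hw z
    _ = _ := by ring

lemma aux_transl {η : E → E →L[ℝ] ℝ} (hη : Continuous η) (hc : HasCompactSupport η) {C β : ℝ}
    (hC : ∀ a : E, ∫ z, ‖η (z + a) - η z‖ ≤ C * ‖a‖ ^ β) {w : E → ℝ} (hwc : Continuous w)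
    {N : ℝ} (hw : ∀ x, |w x| ≤ N) (e x y : E) {t : ℝ} (ht : 0 < t) :
    |(∫ z, η z e * w (x - t • z)) - ∫ z, η z e * w (y - t • z)|
      ≤ N * ‖e‖ * C * ‖x - y‖ ^ β * t ^ (-β) := by
  have hN : 0 ≤ N := (abs_nonneg _).trans (hw 0)
  set a : E := t⁻¹ • (y - x) with ha
  have hshift : ∀ z : E, y - t • (z + a) = x - t • z := by
    intro z
    rw [ha, smul_add, smul_smul, mul_inv_cancel₀ ht.ne', one_smul]; abel
  have h1 : ∫ z, η z e * w (y - t • z) = ∫ z, η (z + a) e * w (x - t • z) := by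
    rw [← integral_add_right_eq_self (fun z => η z e * w (y - t • z)) a]
    simp_rw [hshift]
  have hwx : Continuous fun z => w (x - t • z) := hwc.comp (by fun_prop)
  have hη' : Continuous fun z => η (z + a) := hη.comp (by fun_prop)
  have hc' : HasCompactSupport fun z => η (z + a) := hc.comp_homeomorph (Homeomorph.addRight a)
  have hs : HasCompactSupport fun z => η (z + a) - η z := hc'.sub hc
  have hi1 : Integrable fun z => η z e * w (x - t • z) := by
    refine ((hη.clm_apply continuous_const).mul hwx).integrable_of_hasCompactSupport ?_
    exact HasCompactSupport.mul_right (hc.comp_left (g := fun l : E →L[ℝ] ℝ => l e) (by simp))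
  have hi2 : Integrable fun z => η (z + a) e * w (x - t • z) := by
    refine ((hη'.clm_apply continuous_const).mul hwx).integrable_of_hasCompactSupport ?_
    exact HasCompactSupport.mul_right (hc'.comp_left (g := fun l : E →L[ℝ] ℝ => l e) (by simp))
  rw [h1, abs_sub_comm, ← integral_sub hi2 hi1]
  have h2 := aux_bdd (hη'.sub hη) hs (w := fun z => w (x - t • z)) (fun z => hw _) e
  calc _ = |∫ z, (η (z + a) - η z) e * w (x - t • z)| := by
        congr 2; ext z; simp; ring
    _ ≤ _ := h2
    _ ≤ N * ‖e‖ * (C * ‖a‖ ^ β) := by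
        gcongr; exact hC a
    _ = _ := by
        rw [ha, norm_smul, Real.norm_of_nonneg (by positivity), Real.mul_rpow (by positivity) (norm_nonneg _),
          Real.inv_rpow ht.le, Real.rpow_neg ht.le, norm_sub_rev]
        ring

lemma aux_schauder {ι : Type*} [Fintype ι] (b : OrthonormalBasis ι ℝ E) {s : ℝ}
    (hs : s ∈ Ioo (0:ℝ) 1) :
    ∃ C : ℝ, 0 < C ∧ ∀ (T : ℝ), 0 < T → ∀ (v : E → ℝ), ContDiff ℝ 2 v → ∀ (M N L : ℝ),
      (∀ x, |v x| ≤ M) → (∀ x, ‖fderiv ℝ (fderiv ℝ v) x‖ ≤ L) →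
      (∀ x, |∑ i, fderiv ℝ (fderiv ℝ v) x (b i) (b i)| ≤ N) →
      (∀ x, ‖fderiv ℝ v x‖ ≤ C * (M * T⁻¹ + N * T)) ∧
      (∀ x y, ‖fderiv ℝ v x - fderiv ℝ v y‖ ≤
        C * (M * (T⁻¹ * T ^ (-s)) + N * T ^ (1 - s)) * ‖x - y‖ ^ s) := by
  obtain ⟨ρ, ψ, hρ, hψ, hρc, hψc, hρ1, hρψ⟩ := aux_bump (E := E)
  have hdρ : ContDiff ℝ 1 (fderiv ℝ ρ) := hρ.fderiv_right (by norm_num)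
  have hdψ : ContDiff ℝ 1 (fderiv ℝ ψ) := hψ.fderiv_right (by norm_num)
  have hdρc := hρc.fderiv ℝ
  have hdψc := hψc.fderiv ℝ
  obtain ⟨Cρ, hCρ0, hCρ⟩ := aux_modulus _ hdρ hdρc hs.1 hs.2.le
  obtain ⟨Cψ, hCψ0, hCψ⟩ := aux_modulus _ hdψ hdψc hs.1 hs.2.le
  set Iρ := ∫ z, ‖fderiv ℝ ρ z‖ with hIρ
  set Iψ := ∫ z, ‖fderiv ℝ ψ z‖ with hIψ
  have hIρ0 : 0 ≤ Iρ := integral_nonneg fun _ => norm_nonneg _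
  have hIψ0 : 0 ≤ Iψ := integral_nonneg fun _ => norm_nonneg _
  have hs1 : 0 < 1 - s := by linarith [hs.2]
  have hD0 : 0 ≤ Cψ / (1 - s) := by positivity
  refine ⟨1 + Iρ + Iψ + Cρ + Cψ / (1 - s), by positivity, ?_⟩
  set CC := 1 + Iρ + Iψ + Cρ + Cψ / (1 - s) with hCC
  intro T hT v hv M N L hM hL hN
  have hM0 : 0 ≤ M := (abs_nonneg _).trans (hM 0)
  have hN0 : 0 ≤ N := (abs_nonneg _).trans (hN 0)
  set Λ : E → ℝ := fun x => ∑ i, fderiv ℝ (fderiv ℝ v) x (b i) (b i) with hΛ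
  have hv1 : ContDiff ℝ 1 (fderiv ℝ v) := hv.fderiv_right (m := 1) (by norm_num)
  have hv2 : Continuous (fderiv ℝ (fderiv ℝ v)) := hv1.continuous_fderiv one_ne_zero
  have hΛc : Continuous Λ := continuous_finsetSum _ fun i _ =>
    (hv2.clm_apply continuous_const).clm_apply continuous_const
  set G : E → E → ℝ → ℝ := fun x e t => ∫ z, ρ z * fderiv ℝ v (x - t • z) e with hG
  have hGd : ∀ x e t, HasDerivAt (G x e) (∫ z, -(ρ z * fderiv ℝ (fderiv ℝ v) (x - t • z) z e)) t :=
    fun x e t => aux_G hρ.continuous hρc hv hL x e t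
  have hGd' : ∀ x e t, 0 < t → HasDerivAt (G x e) (∫ z, fderiv ℝ ψ z e * Λ (x - t • z)) t := by
    intro x e t ht
    have := hGd x e t
    rwa [aux_G' b (hψ.of_le (by norm_num)) hψc hρψ hv x e ht] at this
  have hGc : ∀ x e, Continuous (G x e) := fun x e =>
    continuous_iff_continuousAt.2 fun t => (hGd x e t).continuousAt
  have hG0 : ∀ x e, G x e 0 = fderiv ℝ v x e := by
    intro x e
    simp [hG, integral_mul_const, hρ1]
  have hGT : ∀ x e, G x e T = T⁻¹ * ∫ z, fderiv ℝ ρ z e * v (x - T • z) := by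
    intro x e
    have hw : ContDiff ℝ 1 fun z : E => v (x - T • z) := by
      refine (hv.of_le (by norm_num)).comp ?_
      fun_prop
    have h := aux_ibp (hρ.of_le (by norm_num)) hρc hw e
    have hwd : ∀ z c, fderiv ℝ (fun z : E => v (x - T • z)) z c
        = -T * fderiv ℝ v (x - T • z) c := by
      intro z c
      have h1 : HasFDerivAt (fun z : E => x - T • z) (-(T • ContinuousLinearMap.id ℝ E)) z :=
        ((hasFDerivAt_id z).const_smul T).const_sub x
      have h2 := ((hv.differentiable two_ne_zero (x - T • z)).hasFDerivAt).comp z h1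
      rw [HasFDerivAt.fderiv (f := fun z : E => v (x - T • z)) h2]
      simp
    simp_rw [hwd] at h
    have h4 : ∫ z, ρ z * (-T * fderiv ℝ v (x - T • z) e) = -T * G x e T := by
      rw [hG, ← integral_const_mul]
      congr 1; ext z; ring
    rw [h4] at h
    have h5 : T * G x e T = ∫ z, fderiv ℝ ρ z e * v (x - T • z) := by linarith
    rw [← h5, ← mul_assoc, inv_mul_cancel₀ hT.ne', one_mul]
  constructor
  · intro x
    refine ContinuousLinearMap.opNorm_le_bound _ (by positivity) fun e => ?_
    rw [Real.norm_eq_abs]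
    have h1 : |G x e T - G x e 0| ≤ (N * ‖e‖ * Iψ) * T - (N * ‖e‖ * Iψ) * 0 := by
      refine aux_cmp (B := fun t => (N * ‖e‖ * Iψ) * t) (B' := fun t => N * ‖e‖ * Iψ) hT (hGc x e).continuousOn (fun t ht => hGd' x e t ht.1)
        (by fun_prop) (fun t ht => by simpa using (hasDerivAt_id t).const_mul (N * ‖e‖ * Iψ))
        fun t ht => ?_
      exact aux_bdd hdψ.continuous hdψc (w := fun z => Λ (x - t • z)) (fun z => hN _) e
    have h2 : |G x e T| ≤ T⁻¹ * (M * ‖e‖ * Iρ) := by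
      rw [hGT, abs_mul, abs_of_pos (inv_pos.2 hT)]
      gcongr
      exact aux_bdd hdρ.continuous hdρc (w := fun z => v (x - T • z)) (fun z => hM _) e
    rw [hG0] at h1
    have h3 : |fderiv ℝ v x e| ≤ |G x e T| + |G x e T - fderiv ℝ v x e| := by
      have := abs_sub (G x e T) (G x e T - fderiv ℝ v x e)
      rwa [sub_sub_cancel] at this
    calc _ ≤ T⁻¹ * (M * ‖e‖ * Iρ) + (N * ‖e‖ * Iψ) * T := by linarith
      _ = (Iρ * (M * T⁻¹) + Iψ * (N * T)) * ‖e‖ := by ring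
      _ ≤ (CC * (M * T⁻¹) + CC * (N * T)) * ‖e‖ := by
          gcongr
          · linarith
          · linarith
      _ = _ := by ring
  · intro x y
    have hTs : 0 ≤ T ^ (-s) := Real.rpow_nonneg hT.le _
    have hTs' : 0 ≤ T ^ (1-s) := Real.rpow_nonneg hT.le _
    have hxy : 0 ≤ ‖x - y‖ ^ s := Real.rpow_nonneg (norm_nonneg _) _
    refine ContinuousLinearMap.opNorm_le_bound _ (by positivity) fun e => ?_
    rw [Real.norm_eq_abs, sub_apply]
    set K := N * ‖e‖ * Cψ * ‖x - y‖ ^ s with hK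
    have h1 : |(G x e T - G y e T) - (G x e 0 - G y e 0)| ≤
        K / (1 - s) * T ^ (1 - s) - K / (1 - s) * 0 ^ (1 - s) := by
      refine aux_cmp (H := fun t => G x e t - G y e t) (B := fun t => K / (1 - s) * t ^ (1 - s))
        (H' := fun t => (∫ z, fderiv ℝ ψ z e * Λ (x - t • z)) - ∫ z, fderiv ℝ ψ z e * Λ (y - t • z))
        (B' := fun t => K * t ^ (-s)) hT
        ((hGc x e).sub (hGc y e)).continuousOn
        (fun t ht => (hGd' x e t ht.1).sub (hGd' y e t ht.1)) ?_ (fun t ht => ?_) fun t ht => ?_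
      · refine ContinuousOn.mul continuousOn_const ?_
        exact continuousOn_id.rpow_const fun t _ => Or.inr hs1.le
      · have := (Real.hasDerivAt_rpow_const (x := t) (p := 1 - s) (Or.inl ht.1.ne')).const_mul (K / (1 - s))
        have h9 : K * t ^ (-s) = K / (1 - s) * ((1 - s) * t ^ (1 - s - 1)) := by
          rw [show 1 - s - 1 = -s by ring]; field_simp
        simp only [h9]
        exact this
      · exact aux_transl hdψ.continuous hdψc hCψ hΛc hN e x y ht.1
    rw [Real.zero_rpow hs1.ne', mul_zero, sub_zero, hG0, hG0] at h1
    have h2 : |G x e T - G y e T| ≤ T⁻¹ * (M * ‖e‖ * Cρ * ‖x - y‖ ^ s * T ^ (-s)) := by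
      rw [hGT, hGT, ← mul_sub, abs_mul, abs_of_pos (inv_pos.2 hT)]
      gcongr
      exact aux_transl hdρ.continuous hdρc hCρ hv.continuous hM e x y hT
    have h3 : |fderiv ℝ v x e - fderiv ℝ v y e| ≤ |G x e T - G y e T|
        + |(G x e T - G y e T) - (fderiv ℝ v x e - fderiv ℝ v y e)| := by
      have := abs_sub (G x e T - G y e T) ((G x e T - G y e T) - (fderiv ℝ v x e - fderiv ℝ v y e))
      rwa [sub_sub_cancel] at this
    calc _ ≤ T⁻¹ * (M * ‖e‖ * Cρ * ‖x - y‖ ^ s * T ^ (-s)) + K / (1 - s) * T ^ (1 - s) := by linarith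
      _ = (Cρ * (M * (T⁻¹ * T ^ (-s))) + Cψ / (1 - s) * (N * T ^ (1 - s))) * ‖x - y‖ ^ s * ‖e‖ := by
          rw [hK]; ring
      _ ≤ (CC * (M * (T⁻¹ * T ^ (-s))) + CC * (N * T ^ (1 - s))) * ‖x - y‖ ^ s * ‖e‖ := by
          gcongr
          · linarith
          · linarith
      _ = _ := by ring

lemma aux_holder {F : Type*} [NormedAddCommGroup F] {g : E → F} {K B α β : ℝ} (hα : 0 < α)
    (hαβ : α ≤ β) (hK : 0 ≤ K) (h1 : ∀ x y, ‖g x - g y‖ ≤ K * ‖x - y‖ ^ β) (h2 : ∀ x, ‖g x‖ ≤ B)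
    (x y : E) : ‖g x - g y‖ ≤ (K + 2 * B) * ‖x - y‖ ^ α := by
  have hB : 0 ≤ B := (norm_nonneg _).trans (h2 0)
  rcases le_total ‖x - y‖ 1 with h | h
  · calc _ ≤ K * ‖x - y‖ ^ β := h1 x y
      _ ≤ (K + 2 * B) * ‖x - y‖ ^ α := by
        have h3 : ‖x - y‖ ^ β ≤ ‖x - y‖ ^ α := by
          rcases (norm_nonneg (x - y)).eq_or_lt with h0 | h0
          · rw [← h0, Real.zero_rpow hα.ne', Real.zero_rpow (hα.trans_le hαβ).ne']
          · exact Real.rpow_le_rpow_of_exponent_ge h0 h hαβ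
        refine mul_le_mul (by linarith) h3 (Real.rpow_nonneg (norm_nonneg _) _) (by linarith)
  · calc _ ≤ ‖g x‖ + ‖g y‖ := norm_sub_le _ _
      _ ≤ (K + 2 * B) * 1 := by linarith [h2 x, h2 y]
      _ ≤ _ := by
        gcongr
        exact Real.one_le_rpow h hα.le

lemma aux_locint {u : E → ℝ} (hu : Measurable u) {M : ℝ} (hM : ∀ x, |u x| ≤ M) :
    LocallyIntegrable u := by
  refine (locallyIntegrable_const M).mono hu.aestronglyMeasurable (Filter.Eventually.of_forall fun x => ?_)
  rw [Real.norm_eq_abs]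
  exact (hM x).trans (le_abs_self M)

section conv
variable {F : Type*} [NormedAddCommGroup F] [NormedSpace ℝ F] [CompleteSpace F]

lemma aux_conv_int {u : E → ℝ} (hu : Measurable u) {M : ℝ} (hM : ∀ x, |u x| ≤ M) {g : E → F}
    (hg : Continuous g) (hc : HasCompactSupport g) (x : E) :
    Integrable fun y => u y • g (x - y) := by
  have h1 : Integrable fun y => g (x - y) := (hg.integrable_of_hasCompactSupport hc).comp_sub_left x
  refine Integrable.bdd_smul h1 M hu.aestronglyMeasurable (Filter.Eventually.of_forall hM)

lemma aux_conv_bdd {u : E → ℝ} {M : ℝ} (hM : ∀ x, |u x| ≤ M) {g : E → F}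
    (hg : Continuous g) (hc : HasCompactSupport g) (x : E) :
    ‖∫ y, u y • g (x - y)‖ ≤ M * ∫ y, ‖g y‖ := by
  have h1 : Integrable fun y => ‖g (x - y)‖ :=
    ((hg.integrable_of_hasCompactSupport hc).comp_sub_left x).norm
  rw [← integral_sub_left_eq_self (fun y => ‖g y‖) volume x, ← integral_const_mul]
  refine norm_integral_le_of_norm_le (h1.const_mul _) (Filter.Eventually.of_forall fun y => ?_)
  rw [norm_smul]
  gcongr
  exact hM y

lemma aux_conv_deriv {u : E → ℝ} (hu : Measurable u) {M : ℝ} (hM : ∀ x, |u x| ≤ M) {g : E → F}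
    (hg : ContDiff ℝ 1 g) (hc : HasCompactSupport g) (x : E) :
    HasFDerivAt (fun x => ∫ y, u y • g (x - y)) (∫ y, u y • fderiv ℝ g (x - y)) x := by
  have := hc.hasFDerivAt_convolution_right (ContinuousLinearMap.lsmul ℝ ℝ) (aux_locint hu hM) hg x
  exact this

lemma aux_conv_fderiv {u : E → ℝ} (hu : Measurable u) {M : ℝ} (hM : ∀ x, |u x| ≤ M) {g : E → F}
    (hg : ContDiff ℝ 1 g) (hc : HasCompactSupport g) :
    fderiv ℝ (fun x => ∫ y, u y • g (x - y)) = fun x => ∫ y, u y • fderiv ℝ g (x - y) :=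
  funext fun x => (aux_conv_deriv hu hM hg hc x).fderiv

lemma aux_conv_smooth {u : E → ℝ} (hu : Measurable u) {M : ℝ} (hM : ∀ x, |u x| ≤ M) {g : E → F}
    (hg : ContDiff ℝ 2 g) (hc : HasCompactSupport g) :
    ContDiff ℝ 2 (fun x => ∫ y, u y • g (x - y)) := by
  have := HasCompactSupport.contDiff_convolution_right (n := 2) (ContinuousLinearMap.lsmul ℝ ℝ) hc
    (aux_locint hu hM) (by exact_mod_cast hg)
  exact_mod_cast this

end conv

lemma aux_second_L1 {φ : E → ℝ} (hφ : ContDiff ℝ 2 φ) (hc : HasCompactSupport φ) {s : ℝ}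
    (hs : s ∈ Ioo (0:ℝ) 1) :
    ∃ C : ℝ, 0 ≤ C ∧ ∀ z : E, Integrable (fun y => 2 * φ y - φ (y + z) - φ (y - z)) ∧
      ∫ y, |2 * φ y - φ (y + z) - φ (y - z)| ≤ C * min 1 (‖z‖ ^ (1 + s)) := by
  have hd : ContDiff ℝ 1 (fderiv ℝ φ) := hφ.fderiv_right (by norm_num)
  have hdc := hc.fderiv ℝ
  obtain ⟨K, hK⟩ := ContDiff.lipschitzWith_of_hasCompactSupport hdc hd one_ne_zero
  obtain ⟨B, hB⟩ := hd.continuous.bounded_above_of_compact_support hdc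
  have hB0 : 0 ≤ B := (norm_nonneg _).trans (hB 0)
  obtain ⟨R, hR⟩ := hc.isCompact.isBounded.subset_closedBall (0 : E)
  have hz : ∀ z : E, R < ‖z‖ → φ z = 0 := by
    intro z hz
    by_contra h
    have := hR (subset_tsupport _ h)
    simp at this
    linarith
  have hH : ∀ x y, ‖fderiv ℝ φ x - fderiv ℝ φ y‖ ≤ (K + 2 * B) * ‖x - y‖ ^ s := by
    refine aux_holder (β := 1) hs.1 hs.2.le K.2 (fun x y => ?_) hB
    rw [Real.rpow_one]; exact hK.norm_sub_le x y
  set A : ℝ := K + 2 * B with hA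
  have hA0 : 0 ≤ A := by positivity
  have hsd := fun x z => aux_second_diff (fun x => (hφ.differentiable two_ne_zero x).hasFDerivAt)
    hs.1 hH hA0 x z
  have hi : Integrable φ := hφ.continuous.integrable_of_hasCompactSupport hc
  have hI0 : 0 ≤ ∫ y, |φ y| := integral_nonneg fun _ => abs_nonneg _
  set V := (volume : Measure E).real (closedBall 0 (R + 1)) with hV
  have hV0 : 0 ≤ V := measureReal_nonneg
  refine ⟨V * (2 * A) + 4 * ∫ y, |φ y|, by positivity, fun z => ?_⟩
  have hi1 : Integrable fun y => φ (y + z) := hi.comp_add_right z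
  have hi2 : Integrable fun y => φ (y - z) := hi.comp_sub_right z
  have hit : Integrable (fun y => 2 * φ y - φ (y + z) - φ (y - z)) :=
    ((hi.const_mul 2).sub hi1).sub hi2
  refine ⟨hit, ?_⟩
  rcases le_total ‖z‖ 1 with h | h
  · rw [min_eq_right (Real.rpow_le_one (norm_nonneg _) h (by linarith [hs.1]))]
    have hzn : 0 ≤ ‖z‖ ^ (1 + s) := Real.rpow_nonneg (norm_nonneg _) _
    calc ∫ y, |2 * φ y - φ (y + z) - φ (y - z)|
        ≤ ∫ y, (closedBall (0:E) (R + 1)).indicator (fun _ => 2 * A * ‖z‖ ^ (1 + s)) y := by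
          refine integral_mono hit.abs ?_ fun y => ?_
          · refine (integrable_indicator_iff measurableSet_closedBall).2 ?_
            exact integrableOn_const measure_closedBall_lt_top.ne
          · by_cases hy : y ∈ closedBall (0:E) (R + 1)
            · rw [indicator_of_mem hy]; exact hsd y z
            · rw [indicator_of_notMem hy]
              have hy' : R + 1 < ‖y‖ := by simpa using hy
              have h2 : ‖y‖ ≤ ‖y + z‖ + ‖z‖ := by simpa using norm_sub_le (y + z) z
              have h3 : ‖y‖ ≤ ‖y - z‖ + ‖z‖ := by simpa using norm_add_le (y - z) z
              rw [hz y (by linarith), hz (y + z) (by linarith), hz (y - z) (by linarith)]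
              simp
      _ = V * (2 * A) * ‖z‖ ^ (1 + s) := by
          rw [integral_indicator measurableSet_closedBall, setIntegral_const, smul_eq_mul]; ring
      _ ≤ _ := by gcongr; linarith
  · rw [min_eq_left (Real.one_le_rpow h (by linarith [hs.1]))]
    calc ∫ y, |2 * φ y - φ (y + z) - φ (y - z)| ≤ ∫ y, (2 * |φ y| + |φ (y + z)| + |φ (y - z)|) := by
          refine integral_mono hit.abs (((hi.abs.const_mul 2).add hi1.abs).add hi2.abs) fun y => ?_
          simp only
          calc _ ≤ |2 * φ y - φ (y + z)| + |φ (y - z)| := abs_sub _ _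
            _ ≤ |2 * φ y| + |φ (y + z)| + |φ (y - z)| := by gcongr; exact abs_sub _ _
            _ = _ := by rw [abs_mul]; simp
      _ = 4 * ∫ y, |φ y| := by
          have hi3 : Integrable fun y => 2 * |φ y| + |φ (y + z)| := (hi.abs.const_mul 2).add hi1.abs
          rw [integral_add hi3 hi2.abs,
            integral_add (hi.abs.const_mul 2) hi1.abs, integral_const_mul,
            integral_add_right_eq_self (fun y => |φ y|) z, integral_sub_right_eq_self (fun y => |φ y|) z]
          ring
      _ ≤ _ := by
          have : 0 ≤ V * (2 * A) := by positivity
          linarith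

lemma aux_fubini [Nontrivial E] {φ u : E → ℝ} (hφ : ContDiff ℝ 2 φ) (hc : HasCompactSupport φ) {s : ℝ}
    (hs : s ∈ Ioo (0:ℝ) 1) (hu : Measurable u) {M : ℝ} (hM : ∀ x, |u x| ≤ M) :
    Integrable (Function.uncurry fun y z : E => u y * ((2 * φ y - φ (y + z) - φ (y - z)) /
      ‖z‖ ^ ((Module.finrank ℝ E : ℝ) + 2 * s))) (volume.prod volume) := by
  obtain ⟨C, hC0, hC⟩ := aux_second_L1 hφ hc hs
  have hM0 : 0 ≤ M := (abs_nonneg _).trans (hM 0)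
  have hφm := hφ.continuous.measurable
  have hmeas : Measurable (Function.uncurry fun y z : E => u y * ((2 * φ y - φ (y + z) - φ (y - z)) /
      ‖z‖ ^ ((Module.finrank ℝ E : ℝ) + 2 * s))) := by
    simp only [Function.uncurry_def]
    fun_prop
  have hInt : ∀ z : E, Integrable fun y => u y * ((2 * φ y - φ (y + z) - φ (y - z)) /
      ‖z‖ ^ ((Module.finrank ℝ E : ℝ) + 2 * s)) := fun z =>
    ((hC z).1.div_const _).bdd_mul hu.aestronglyMeasurable (Filter.Eventually.of_forall hM)
  rw [integrable_prod_iff' hmeas.aestronglyMeasurable]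
  refine ⟨Filter.Eventually.of_forall hInt, ?_⟩
  refine ((aux_kernel (E := E) hs).const_mul (M * C)).mono' ?_ (Filter.Eventually.of_forall fun z => ?_)
  · exact (hmeas.norm.stronglyMeasurable.integral_prod_left').aestronglyMeasurable
  · have hk : 0 ≤ ‖z‖ ^ ((Module.finrank ℝ E : ℝ) + 2 * s) := Real.rpow_nonneg (norm_nonneg _) _
    rw [Real.norm_of_nonneg (integral_nonneg fun _ => norm_nonneg _)]
    calc ∫ y, ‖Function.uncurry (fun y z : E => u y * ((2 * φ y - φ (y + z) - φ (y - z)) /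
          ‖z‖ ^ ((Module.finrank ℝ E : ℝ) + 2 * s))) (y, z)‖
        ≤ ∫ y, M * |2 * φ y - φ (y + z) - φ (y - z)| / ‖z‖ ^ ((Module.finrank ℝ E : ℝ) + 2 * s) := by
          refine integral_mono (hInt z).norm (((hC z).1.abs.const_mul M).div_const _) fun y => ?_
          simp only [Function.uncurry]
          rw [norm_mul, norm_div, Real.norm_of_nonneg hk, Real.norm_eq_abs, Real.norm_eq_abs, mul_div_assoc]
          gcongr
          exact hM y
      _ = M * (∫ y, |2 * φ y - φ (y + z) - φ (y - z)|) / ‖z‖ ^ ((Module.finrank ℝ E : ℝ) + 2 * s) := by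
          rw [integral_div, integral_const_mul]
      _ ≤ M * (C * min 1 (‖z‖ ^ (1 + s))) / ‖z‖ ^ ((Module.finrank ℝ E : ℝ) + 2 * s) := by
          gcongr
          exact (hC z).2
      _ = _ := by ring

section generic

lemma aux_start {v : E → ℝ} (hv : ContDiff ℝ 2 v) {L1 L2 s : ℝ} (hs : s ∈ Ioo (0:ℝ) 1)
    (hL1 : ∀ x, ‖fderiv ℝ v x‖ ≤ L1) (hL2 : ∀ x, ‖fderiv ℝ (fderiv ℝ v) x‖ ≤ L2) :
    0 ≤ L1 ∧ 0 ≤ L2 ∧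
      ∀ x y, ‖fderiv ℝ v x - fderiv ℝ v y‖ ≤ (L2 + 2 * L1) * ‖x - y‖ ^ s := by
  have hL10 : 0 ≤ L1 := (norm_nonneg _).trans (hL1 0)
  have hL20 : 0 ≤ L2 := le_trans (norm_nonneg (fderiv ℝ (fderiv ℝ v) 0)) (hL2 0)
  have hv1 : ContDiff ℝ 1 (fderiv ℝ v) := hv.fderiv_right (m := 1) (by norm_num)
  refine ⟨hL10, hL20, ?_⟩
  refine aux_holder (β := 1) hs.1 hs.2.le hL20 (fun x y => ?_) hL1
  rw [Real.rpow_one]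
  exact convex_univ.norm_image_sub_le_of_norm_fderiv_le (𝕜 := ℝ)
    (fun z _ => hv1.differentiable one_ne_zero z) (fun z _ => hL2 z) (mem_univ y) (mem_univ x)

section genericF
variable {F : Type*} [NormedAddCommGroup F] [NormedSpace ℝ F] [CompleteSpace F]

lemma aux_conv_bound1 {u : E → ℝ} (hu : Measurable u) {M : ℝ} (hM : ∀ x, |u x| ≤ M) {g : E → F}
    (hg : ContDiff ℝ 1 g) (hc : HasCompactSupport g) :
    ∃ L : ℝ, ∀ x, ‖fderiv ℝ (fun x => ∫ y, u y • g (x - y)) x‖ ≤ L := by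
  refine ⟨M * ∫ y, ‖fderiv ℝ g y‖, fun x => ?_⟩
  rw [aux_conv_fderiv hu hM hg hc]
  exact aux_conv_bdd hM (hg.continuous_fderiv one_ne_zero) (hc.fderiv ℝ) x

lemma aux_conv_apply {u : E → ℝ} (hu : Measurable u) {M : ℝ} (hM : ∀ x, |u x| ≤ M) {g : E → F}
    (hg : ContDiff ℝ 1 g) (hc : HasCompactSupport g) (x e : E) :
    Integrable (fun y => u y • fderiv ℝ g (x - y) e) ∧
    fderiv ℝ (fun x => ∫ y, u y • g (x - y)) x e = ∫ y, u y • fderiv ℝ g (x - y) e := by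
  have hInt : Integrable fun y => u y • fderiv ℝ g (x - y) :=
    aux_conv_int hu hM (hg.continuous_fderiv one_ne_zero) (hc.fderiv ℝ) x
  refine ⟨hInt.apply_continuousLinearMap e, ?_⟩
  rw [aux_conv_fderiv hu hM hg hc, ContinuousLinearMap.integral_apply hInt]
  rfl

end genericF

lemma aux_conv_bounds {u ρ : E → ℝ} (hu : Measurable u) {M : ℝ} (hM : ∀ x, |u x| ≤ M)
    (hρ : ContDiff ℝ 2 ρ) (hc : HasCompactSupport ρ) :
    ∃ L1 L2 : ℝ, (∀ x, ‖fderiv ℝ (fun x => ∫ y, u y • ρ (x - y)) x‖ ≤ L1) ∧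
      ∀ x, ‖fderiv ℝ (fderiv ℝ (fun x => ∫ y, u y • ρ (x - y))) x‖ ≤ L2 := by
  have hρ1 : ContDiff ℝ 1 ρ := hρ.of_le (by norm_num)
  have hd1 : ContDiff ℝ 1 (fderiv ℝ ρ) := hρ.fderiv_right (by norm_num)
  obtain ⟨L1, h1⟩ := aux_conv_bound1 hu hM hρ1 hc
  obtain ⟨L2, h2⟩ := aux_conv_bound1 hu hM hd1 (hc.fderiv ℝ)
  refine ⟨L1, L2, h1, ?_⟩
  rw [aux_conv_fderiv hu hM hρ1 hc]
  exact h2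

lemma aux_conv_lap {ι : Type*} [Fintype ι] (b : ι → E) {u ρ : E → ℝ} (hu : Measurable u) {M : ℝ}
    (hM : ∀ x, |u x| ≤ M) (hρ : ContDiff ℝ 2 ρ) (hc : HasCompactSupport ρ) (x : E) :
    Integrable (fun y => u y * ∑ i, fderiv ℝ (fderiv ℝ ρ) (x - y) (b i) (b i)) ∧
    ∑ i, fderiv ℝ (fderiv ℝ (fun x => ∫ y, u y • ρ (x - y))) x (b i) (b i)
      = ∫ y, u y * ∑ i, fderiv ℝ (fderiv ℝ ρ) (x - y) (b i) (b i) := by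
  have hρ1 : ContDiff ℝ 1 ρ := hρ.of_le (by norm_num)
  have hd1 : ContDiff ℝ 1 (fderiv ℝ ρ) := hρ.fderiv_right (by norm_num)
  have hInt := fun i => aux_conv_apply hu hM hd1 (hc.fderiv ℝ) x (b i)
  have hInt2 : ∀ i, Integrable fun y => u y * fderiv ℝ (fderiv ℝ ρ) (x - y) (b i) (b i) :=
    fun i => (hInt i).1.apply_continuousLinearMap (b i)
  simp_rw [Finset.mul_sum]
  constructor
  · exact integrable_finsetSum _ fun i _ => hInt2 i
  · rw [aux_conv_fderiv hu hM hρ1 hc, integral_finsetSum _ fun i _ => hInt2 i]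
    refine Finset.sum_congr rfl fun i _ => ?_
    rw [(hInt i).2, ContinuousLinearMap.integral_apply (hInt i).1]
    rfl

lemma aux_limit {w : ℕ → E → ℝ} (hw : ∀ k, Differentiable ℝ (w k)) {M B A s : ℝ} (hs : 0 < s)
    (hA0 : 0 ≤ A) (hM : ∀ k x, |w k x| ≤ M) (hB : ∀ k x, ‖fderiv ℝ (w k) x‖ ≤ B)
    (hA : ∀ k x y, ‖fderiv ℝ (w k) x - fderiv ℝ (w k) y‖ ≤ A * ‖x - y‖ ^ s) :
    ∃ (v : E → ℝ) (g : E → E →L[ℝ] ℝ), (∀ x, HasFDerivAt v (g x) x) ∧ (∀ x, |v x| ≤ M) ∧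
      (∀ x, ‖g x‖ ≤ B) ∧ (∀ x y, ‖g x - g y‖ ≤ A * ‖x - y‖ ^ s) ∧
      ∀ x c, Filter.Tendsto (fun k => w k x) Filter.atTop (nhds c) → v x = c := by
  set U : Ultrafilter ℕ := Filter.hyperfilter ℕ
  have hU : (U : Filter ℕ) ≤ Filter.atTop := Nat.hyperfilter_le_atTop
  have h1 : ∀ x, ∃ c, Filter.Tendsto (fun k => w k x) U (nhds c) := by
    intro x
    obtain ⟨c, -, hc⟩ := (isCompact_closedBall (0:ℝ) M).ultrafilter_le_nhds (U.map fun k => w k x) (by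
      rw [Filter.le_principal_iff]
      refine Filter.mem_map.2 (Filter.univ_mem' fun k => ?_)
      simpa using hM k x)
    exact ⟨c, hc⟩
  have h2 : ∀ x, ∃ c, Filter.Tendsto (fun k => fderiv ℝ (w k) x) U (nhds c) := by
    intro x
    obtain ⟨c, -, hc⟩ := (isCompact_closedBall (0 : E →L[ℝ] ℝ) B).ultrafilter_le_nhds
      (U.map fun k => fderiv ℝ (w k) x) (by
      rw [Filter.le_principal_iff]
      refine Filter.mem_map.2 (Filter.univ_mem' fun k => ?_)
      simpa using hB k x)
    exact ⟨c, hc⟩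
  choose v hv using h1
  choose g hg using h2
  have hT : ∀ x z, |v (x + z) - v x - g x z| ≤ A * ‖z‖ ^ (1 + s) := by
    intro x z
    have t1 : Filter.Tendsto (fun k => |w k (x + z) - w k x - fderiv ℝ (w k) x z|) U
        (nhds |v (x + z) - v x - g x z|) := by
      refine (((hv _).sub (hv x)).sub ?_).abs
      exact ((ContinuousLinearMap.apply ℝ ℝ z).continuous.tendsto _).comp (hg x)
    exact le_of_tendsto' t1 fun k =>
      aux_taylor (fun x => (hw k x).hasFDerivAt) hs (hA k) hA0 x z
  refine ⟨v, g, fun x => ?_, fun x => ?_, fun x => ?_, fun x y => ?_, fun x c hc => ?_⟩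
  · rw [hasFDerivAt_iff_isLittleO_nhds_zero, Asymptotics.isLittleO_iff]
    intro c hc
    have t : Filter.Tendsto (fun z : E => A * ‖z‖ ^ s) (nhds 0) (nhds 0) := by
      have : Continuous fun z : E => A * ‖z‖ ^ s :=
        continuous_const.mul (continuous_norm.rpow_const fun _ => Or.inr hs.le)
      have h := this.tendsto 0
      simpa [Real.zero_rpow hs.ne'] using h
    filter_upwards [t.eventually (gt_mem_nhds hc)] with z hz
    refine (hT x z).trans ?_
    have h2 : ‖z‖ ^ (1 + s) = ‖z‖ ^ s * ‖z‖ := by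
      rcases (norm_nonneg z).eq_or_lt with h | h
      · rw [← h, Real.zero_rpow (by linarith)]; simp
      · rw [Real.rpow_add h, Real.rpow_one, mul_comm]
    rw [h2, ← mul_assoc]
    gcongr
  · exact le_of_tendsto' (hv x).abs fun k => hM k x
  · exact le_of_tendsto' (hg x).norm fun k => hB k x
  · exact le_of_tendsto' ((hg x).sub (hg y)).norm fun k => hA k x y
  · exact tendsto_nhds_unique (hv x) (hc.mono_left hU)

/-- mollifiers -/
lemma aux_mollify {u : E → ℝ} (hu : Measurable u) {M : ℝ} (hM : ∀ x, |u x| ≤ M) :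
    ∃ ρ : ℕ → E → ℝ, (∀ k, ContDiff ℝ ((⊤ : ℕ∞) : WithTop ℕ∞) (ρ k)) ∧
      (∀ k, HasCompactSupport (ρ k)) ∧ (∀ k, ∫ y, ‖ρ k y‖ = 1) ∧
      ∀ᵐ x, Filter.Tendsto (fun k => ∫ y, u y • ρ k (x - y)) Filter.atTop (nhds (u x)) := by
  let φ : ℕ → ContDiffBump (0 : E) := fun k =>
    ⟨1 / ((k : ℝ) + 1), 2 * (1 / ((k : ℝ) + 1)), by positivity,
      by have : 0 < 1 / ((k : ℝ) + 1) := by positivity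
         linarith⟩
  refine ⟨fun k => (φ k).normed volume, fun k => (φ k).contDiff_normed, fun k =>
    (φ k).hasCompactSupport_normed, fun k => ?_, ?_⟩
  · rw [← (φ k).integral_normed (μ := volume)]
    exact integral_congr_ae (Filter.Eventually.of_forall fun y =>
      Real.norm_of_nonneg ((φ k).nonneg_normed y))
  · have h0 : Filter.Tendsto (fun k => (φ k).rOut) Filter.atTop (nhds 0) := by
      have := (tendsto_one_div_add_atTop_nhds_zero_nat (𝕜 := ℝ)).const_mul 2
      rw [mul_zero] at this
      exact this
    have h := ContDiffBump.ae_convolution_tendsto_right_of_locallyIntegrable (K := 2) (μ := volume)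
      (φ := φ) h0 (Filter.Eventually.of_forall fun k => le_refl _) (aux_locint hu hM)
    filter_upwards [h] with x hx
    refine hx.congr fun k => ?_
    rw [convolution_eq_swap]
    refine integral_congr_ae (Filter.Eventually.of_forall fun y => ?_)
    simp [mul_comm]

end generic

end Aux

section Main

variable {n : ℕ}

lemma aux_lap (v : EuclideanSpace ℝ (Fin n) → ℝ) (x : EuclideanSpace ℝ (Fin n)) :
    lap n v x = ∑ i, fderiv ℝ (fderiv ℝ v) x (EuclideanSpace.basisFun (Fin n) ℝ i)
      (EuclideanSpace.basisFun (Fin n) ℝ i) := by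
  simp [lap, iteratedFDeriv_two_apply]

lemma aux_fderiv_sub {F : Type*} [NormedAddCommGroup F] [NormedSpace ℝ F]
    (g : EuclideanSpace ℝ (Fin n) → F) (x : EuclideanSpace ℝ (Fin n)) (hg : Differentiable ℝ g) :
    fderiv ℝ (fun y => g (x - y)) = fun y => -fderiv ℝ g (x - y) := by
  ext1 y
  have h1 : HasFDerivAt (fun y => x - y) (-(ContinuousLinearMap.id ℝ (EuclideanSpace ℝ (Fin n)))) y :=
    (hasFDerivAt_id y).const_sub x
  have h2 := ((hg (x - y)).hasFDerivAt).comp y h1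
  rw [HasFDerivAt.fderiv (f := fun y => g (x - y)) h2]
  ext e
  simp

lemma aux_lap_sub {ρ : EuclideanSpace ℝ (Fin n) → ℝ} (hρ : ContDiff ℝ 2 ρ)
    (x y : EuclideanSpace ℝ (Fin n)) : lap n (fun y => ρ (x - y)) y = lap n ρ (x - y) := by
  have h1 : ContDiff ℝ 1 (fderiv ℝ ρ) := hρ.fderiv_right (by norm_num)
  have h2 : fderiv ℝ (fderiv ℝ (fun y => ρ (x - y))) y = fderiv ℝ (fderiv ℝ ρ) (x - y) := by
    rw [aux_fderiv_sub ρ x (hρ.differentiable two_ne_zero)]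
    have h3 := congrFun (aux_fderiv_sub (fderiv ℝ ρ) x (h1.differentiable one_ne_zero)) y
    have h4 : fderiv ℝ (fun y => -fderiv ℝ ρ (x - y)) y = -fderiv ℝ (fun y => fderiv ℝ ρ (x - y)) y :=
      fderiv_fun_neg
    rw [h4, h3, neg_neg]
  simp only [aux_lap, h2]

/-- the mollified function solves the mollified equation pointwise -/
lemma aux_eqn (hn : 3 ≤ n) {s : ℝ} (hs : s ∈ Ioo (0:ℝ) 1) {u f ρ : EuclideanSpace ℝ (Fin n) → ℝ}
    {M : ℝ} (hu : Measurable u) (hM : ∀ x, |u x| ≤ M)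
    (hρ : ContDiff ℝ ((⊤ : ℕ∞) : WithTop ℕ∞) ρ) (hc : HasCompactSupport ρ)
    (h : ∀ φ : SchwartzMap (EuclideanSpace ℝ (Fin n)) ℝ,
          (∫ x : EuclideanSpace ℝ (Fin n), u x * (-lap n (⇑φ) x + fracLap n s (⇑φ) x))
            = ∫ x : EuclideanSpace ℝ (Fin n), f x * φ x) (x : EuclideanSpace ℝ (Fin n)) :
    -lap n (fun x => ∫ y, u y • ρ (x - y)) x + fracLap n s (fun x => ∫ y, u y • ρ (x - y)) x
      = ∫ y, f y • ρ (x - y) := by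
  have : Nonempty (Fin n) := ⟨⟨0, by omega⟩⟩
  have hρ2 : ContDiff ℝ 2 ρ := contDiff_infty.1 hρ 2
  have hρ1 : ContDiff ℝ 1 ρ := hρ2.of_le (by norm_num)
  set φ : EuclideanSpace ℝ (Fin n) → ℝ := fun y => ρ (x - y) with hφdef
  have hφ : ContDiff ℝ ((⊤ : ℕ∞) : WithTop ℕ∞) φ := hρ.comp (contDiff_const.sub contDiff_id)
  have hφ2 : ContDiff ℝ 2 φ := contDiff_infty.1 hφ 2
  have hφc : HasCompactSupport φ := hc.comp_homeomorph (Homeomorph.subLeft x)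
  have h1 := h (hφc.toSchwartzMap hφ)
  have hcoe : ⇑(hφc.toSchwartzMap hφ) = φ := rfl
  rw [hcoe] at h1
  -- Laplacian part
  have hL := aux_conv_lap (fun i => EuclideanSpace.basisFun (Fin n) ℝ i) hu hM hρ2 hc x
  have e2 : ∀ y, lap n φ y = ∑ i, fderiv ℝ (fderiv ℝ ρ) (x - y)
      (EuclideanSpace.basisFun (Fin n) ℝ i) (EuclideanSpace.basisFun (Fin n) ℝ i) := by
    intro y
    rw [hφdef, aux_lap_sub hρ2, aux_lap]
  have hlapv : lap n (fun x => ∫ y, u y • ρ (x - y)) x = ∫ y, u y * lap n φ y := by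
    rw [aux_lap, hL.2]
    simp_rw [e2]
  have hlapi : Integrable fun y => u y * lap n φ y := by
    simp_rw [e2]
    exact hL.1
  -- fractional part
  have hF := aux_fubini hφ2 hφc hs hu hM
  rw [finrank_euclideanSpace_fin] at hF
  have hfrac : ∀ y, u y * fracLap n s φ y = (fracLapConst n s / 2) * ∫ z, u y *
      ((2 * φ y - φ (y + z) - φ (y - z)) / ‖z‖ ^ ((n : ℝ) + 2 * s)) := by
    intro y
    rw [fracLap, integral_const_mul]; ring
  have hfraci : Integrable fun y => u y * fracLap n s φ y := by
    simp_rw [hfrac]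
    exact hF.integral_prod_left.const_mul _
  have hi0 : ∀ w, Integrable fun y => u y • ρ (w - y) := fun w =>
    aux_conv_int hu hM hρ2.continuous hc w
  have hfracv : fracLap n s (fun x => ∫ y, u y • ρ (x - y)) x = ∫ y, u y * fracLap n s φ y := by
    simp_rw [hfrac]
    rw [integral_const_mul, integral_integral_swap hF, fracLap]
    congr 2
    ext z
    have e3 : ∀ y, u y * ((2 * φ y - φ (y + z) - φ (y - z)) / ‖z‖ ^ ((n : ℝ) + 2 * s))
        = (2 * (u y • ρ (x - y)) - u y • ρ (x + z - y) - u y • ρ (x - z - y))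
          / ‖z‖ ^ ((n : ℝ) + 2 * s) := by
      intro y
      have a1 : x - (y + z) = x - z - y := by abel
      have a2 : x - (y - z) = x + z - y := by abel
      simp only [hφdef, smul_eq_mul, a1, a2]
      ring
    simp_rw [e3]
    have i3 : Integrable fun y => 2 * (u y • ρ (x - y)) - u y • ρ (x + z - y) :=
      ((hi0 x).const_mul 2).sub (hi0 (x + z))
    rw [integral_div, integral_sub i3 (hi0 (x - z)),
      integral_sub ((hi0 x).const_mul 2) (hi0 (x + z)), integral_const_mul]
  have hneg : Integrable fun y => -(u y * lap n φ y) := hlapi.neg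
  rw [hlapv, hfracv, ← integral_neg, ← integral_add hneg hfraci]
  simp only [smul_eq_mul]
  rw [← h1]
  congr 1; ext y
  ring

lemma aux_frac_bdd (hn : 3 ≤ n) {s : ℝ} (hs : s ∈ Ioo (0:ℝ) 1) :
    ∃ C : ℝ, 0 < C ∧ ∀ (v : EuclideanSpace ℝ (Fin n) → ℝ) (M A : ℝ), Differentiable ℝ v →
      (∀ x, |v x| ≤ M) → 0 ≤ A → (∀ x y, ‖fderiv ℝ v x - fderiv ℝ v y‖ ≤ A * ‖x - y‖ ^ s) →
      ∀ x, |fracLap n s v x| ≤ C * (A + M) := by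
  have : Nonempty (Fin n) := ⟨⟨0, by omega⟩⟩
  have hk := aux_kernel (E := EuclideanSpace ℝ (Fin n)) hs
  rw [finrank_euclideanSpace_fin] at hk
  set I := ∫ z : EuclideanSpace ℝ (Fin n), min 1 (‖z‖ ^ (1 + s)) / ‖z‖ ^ ((n:ℝ) + 2 * s) with hI
  have hI0 : 0 ≤ I := integral_nonneg fun z =>
    div_nonneg (le_min zero_le_one (Real.rpow_nonneg (norm_nonneg _) _)) (Real.rpow_nonneg (norm_nonneg _) _)
  refine ⟨|fracLapConst n s / 2| * (4 * I) + 1, by positivity, ?_⟩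
  intro v M A hv hM hA0 hA x
  have hM0 : 0 ≤ M := (abs_nonneg _).trans (hM 0)
  rw [fracLap, abs_mul]
  have h1 : |∫ z : EuclideanSpace ℝ (Fin n),
      (2 * v x - v (x + z) - v (x - z)) / ‖z‖ ^ ((n : ℝ) + 2 * s)| ≤ (4 * (A + M)) * I := by
    rw [← Real.norm_eq_abs, hI, ← integral_const_mul]
    refine norm_integral_le_of_norm_le (hk.const_mul _) (Filter.Eventually.of_forall fun z => ?_)
    have hk : 0 ≤ ‖z‖ ^ ((n : ℝ) + 2 * s) := Real.rpow_nonneg (norm_nonneg _) _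
    have hk' : 0 ≤ ‖z‖ ^ (1 + s) := Real.rpow_nonneg (norm_nonneg _) _
    rw [norm_div, Real.norm_of_nonneg hk, ← mul_div_assoc, Real.norm_eq_abs]
    gcongr
    rw [mul_min_of_nonneg _ _ (by positivity)]
    refine le_min ?_ ?_
    · have a1 := abs_le.1 (hM x)
      have a2 := abs_le.1 (hM (x + z))
      have a3 := abs_le.1 (hM (x - z))
      rw [abs_le]
      constructor <;> linarith [a1.1, a1.2, a2.1, a2.2, a3.1, a3.2]
    · refine (aux_second_diff (fun x => (hv x).hasFDerivAt) hs.1 hA hA0 x z).trans ?_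
      refine mul_le_mul_of_nonneg_right ?_ hk'
      linarith
  calc _ ≤ |fracLapConst n s / 2| * ((4 * (A + M)) * I) := by gcongr
    _ = |fracLapConst n s / 2| * (4 * I) * (A + M) := by ring
    _ ≤ _ := by gcongr; linarith

lemma aux_core (hn : 3 ≤ n) {s : ℝ} (hs : s ∈ Ioo (0:ℝ) 1) :
    ∃ C : ℝ, 0 < C ∧ ∀ (v : EuclideanSpace ℝ (Fin n) → ℝ) (M N L1 L2 : ℝ), ContDiff ℝ 2 v →
      (∀ x, |v x| ≤ M) → (∀ x, ‖fderiv ℝ v x‖ ≤ L1) → (∀ x, ‖fderiv ℝ (fderiv ℝ v) x‖ ≤ L2) →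
      (∀ x, |-lap n v x + fracLap n s v x| ≤ N) →
      (∀ x, ‖fderiv ℝ v x‖ ≤ C * (N + M)) ∧
      (∀ x y, ‖fderiv ℝ v x - fderiv ℝ v y‖ ≤ C * (N + M) * ‖x - y‖ ^ s) := by
  obtain ⟨C1, hC1, hS⟩ := aux_schauder (EuclideanSpace.basisFun (Fin n) ℝ) hs
  obtain ⟨C2, hC2, hFb⟩ := aux_frac_bdd hn hs
  have hs1 : 0 < 1 - s := by linarith [hs.2]
  -- choose T
  obtain ⟨T, hT, hTs⟩ : ∃ T : ℝ, 0 < T ∧ C1 * C2 * T ^ (1 - s) = 1 / 2 := by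
    refine ⟨(1 / (2 * (C1 * C2))) ^ (1 / (1 - s)), by positivity, ?_⟩
    rw [← Real.rpow_mul (by positivity), one_div_mul_cancel hs1.ne', Real.rpow_one]
    field_simp
  have hTp : 0 < T ^ (-s) := Real.rpow_pos_of_pos hT _
  have hTp' : 0 < T ^ (1 - s) := Real.rpow_pos_of_pos hT _
  set D := C1 * (T⁻¹ * T ^ (-s)) + C1 * T ^ (1 - s) + 1 / 2 with hD
  have hD0 : 0 < D := by positivity
  refine ⟨2 * D + C1 * (1 + 1 + C2 * (2 * D + 1)), by positivity, ?_⟩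
  intro v M N L1 L2 hv hM hL1 hL2 hN
  have hM0 : 0 ≤ M := (abs_nonneg _).trans (hM 0)
  have hN0 : 0 ≤ N := (abs_nonneg _).trans (hN 0)
  obtain ⟨hL10, hL20, hstart0⟩ := aux_start hv hs hL1 hL2
  have hvd : Differentiable ℝ v := hv.differentiable two_ne_zero
  set P : ℝ → Prop := fun A => ∀ x y, ‖fderiv ℝ v x - fderiv ℝ v y‖ ≤ A * ‖x - y‖ ^ s with hP
  have hlap : ∀ A, 0 ≤ A → P A → ∀ x, |∑ i, fderiv ℝ (fderiv ℝ v) x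
      (EuclideanSpace.basisFun (Fin n) ℝ i) (EuclideanSpace.basisFun (Fin n) ℝ i)|
      ≤ N + C2 * (A + M) := by
    intro A hA0 hA x
    rw [← aux_lap]
    have a1 := abs_le.1 (hN x)
    have a2 := abs_le.1 (hFb v M A hvd hM hA0 hA x)
    rw [abs_le]
    constructor <;> linarith [a1.1, a1.2, a2.1, a2.2]
  have hstep : ∀ A, 0 ≤ A → P A → P (D * (N + M) + A / 2) := by
    intro A hA0 hA x y
    refine ((hS T hT v hv M _ L2 hM hL2 (hlap A hA0 hA)).2 x y).trans ?_
    have hxy : 0 ≤ ‖x - y‖ ^ s := Real.rpow_nonneg (norm_nonneg _) _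
    refine mul_le_mul_of_nonneg_right ?_ hxy
    have e : C1 * (M * (T⁻¹ * T ^ (-s)) + (N + C2 * (A + M)) * T ^ (1 - s))
        = C1 * (T⁻¹ * T ^ (-s)) * M + C1 * T ^ (1 - s) * N + (C1 * C2 * T ^ (1 - s)) * (A + M) := by
      ring
    rw [e, hTs, hD]
    have b1 : 0 ≤ C1 * (T⁻¹ * T ^ (-s)) * N := by positivity
    have b2 : 0 ≤ C1 * T ^ (1 - s) * M := by positivity
    nlinarith
  have hstart : P (L2 + 2 * L1) := hstart0
  have hiter : ∀ k : ℕ, P (2 * (D * (N + M)) + (L2 + 2 * L1) / 2 ^ k) := by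
    intro k
    induction k with
    | zero =>
      intro x y
      refine (hstart x y).trans ?_
      refine mul_le_mul_of_nonneg_right ?_ (Real.rpow_nonneg (norm_nonneg _) _)
      rw [pow_zero, div_one]
      have : 0 ≤ 2 * (D * (N + M)) := by positivity
      linarith
    | succ k ih =>
      have := hstep _ (by positivity) ih
      convert this using 1
      rw [pow_succ]; field_simp; ring
  have hfin : P (2 * (D * (N + M))) := by
    intro x y
    have ht : Filter.Tendsto (fun k : ℕ => (2 * (D * (N + M)) + (L2 + 2 * L1) / 2 ^ k) * ‖x - y‖ ^ s)
        Filter.atTop (nhds ((2 * (D * (N + M)) + 0) * ‖x - y‖ ^ s)) := by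
      refine (Filter.Tendsto.const_add _ ?_).mul_const _
      have := (tendsto_pow_atTop_nhds_zero_of_lt_one (r := (1/2 : ℝ)) (by norm_num) (by norm_num)).const_mul (L2 + 2 * L1)
      simpa [div_eq_mul_inv] using this
    rw [add_zero] at ht
    exact ge_of_tendsto' ht fun k => hiter k x y
  have hNM : 0 ≤ N + M := by positivity
  constructor
  · intro x
    refine ((hS 1 one_pos v hv M _ L2 hM hL2 (hlap _ (by positivity) hfin)).1 x).trans ?_
    have e : C1 * (M * 1⁻¹ + (N + C2 * (2 * (D * (N + M)) + M)) * 1)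
      = C1 * (M + N + C2 * (2 * D * (N + M) + M)) := by rw [inv_one]; ring
    rw [e]
    calc _ ≤ C1 * ((N + M) + (N + M) + C2 * (2 * D * (N + M) + (N + M))) := by
          gcongr <;> linarith
      _ = (C1 * (1 + 1 + C2 * (2 * D + 1))) * (N + M) := by ring
      _ ≤ _ := by gcongr; linarith
  · intro x y
    refine (hfin x y).trans ?_
    have hxy : 0 ≤ ‖x - y‖ ^ s := Real.rpow_nonneg (norm_nonneg _) _
    refine mul_le_mul_of_nonneg_right ?_ hxy
    rw [← mul_assoc]
    refine mul_le_mul_of_nonneg_right ?_ hNM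
    have : 0 ≤ C1 * (1 + 1 + C2 * (2 * D + 1)) := by positivity
    linarith

lemma aux_main (hn : 3 ≤ n) {s : ℝ} (hs : s ∈ Ioo (0:ℝ) 1) :
    ∃ C : ℝ, 0 < C ∧ ∀ (u f : EuclideanSpace ℝ (Fin n) → ℝ) (Mu Mf : ℝ),
        Measurable u → (∀ x, |u x| ≤ Mu) → Measurable f → (∀ x, |f x| ≤ Mf) →
        (∀ φ : SchwartzMap (EuclideanSpace ℝ (Fin n)) ℝ,
          (∫ x : EuclideanSpace ℝ (Fin n), u x * (-lap n (⇑φ) x + fracLap n s (⇑φ) x))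
            = ∫ x : EuclideanSpace ℝ (Fin n), f x * φ x) →
        ∃ (v : EuclideanSpace ℝ (Fin n) → ℝ)
          (g : EuclideanSpace ℝ (Fin n) → EuclideanSpace ℝ (Fin n) →L[ℝ] ℝ),
          (∀ᵐ x, v x = u x) ∧ (∀ x, HasFDerivAt v (g x) x) ∧ (∀ x, |v x| ≤ Mu) ∧
          (∀ x, ‖g x‖ ≤ C * (Mf + Mu)) ∧
          (∀ x y, ‖g x - g y‖ ≤ C * (Mf + Mu) * ‖x - y‖ ^ s) := by
  obtain ⟨C, hC, hcore⟩ := aux_core hn hs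
  refine ⟨C, hC, ?_⟩
  intro u f Mu Mf hu hMu hf hMf heq
  have hMu0 : 0 ≤ Mu := (abs_nonneg _).trans (hMu 0)
  have hMf0 : 0 ≤ Mf := (abs_nonneg _).trans (hMf 0)
  obtain ⟨ρ, hρ, hρc, hρ1, hlim⟩ := aux_mollify hu hMu
  have hρ2 : ∀ k, ContDiff ℝ 2 (ρ k) := fun k => contDiff_infty.1 (hρ k) 2
  have hb : ∀ (w : EuclideanSpace ℝ (Fin n) → ℝ) (M : ℝ), (∀ x, |w x| ≤ M) → ∀ k x,
      |∫ y, w y • ρ k (x - y)| ≤ M := by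
    intro w M hw k x
    have := aux_conv_bdd hw (hρ2 k).continuous (hρc k) x
    rwa [hρ1, mul_one, Real.norm_eq_abs] at this
  have hsm : ∀ k, ContDiff ℝ 2 (fun x => ∫ y, u y • ρ k (x - y)) := fun k =>
    aux_conv_smooth hu hMu (hρ2 k) (hρc k)
  have hk : ∀ k, (∀ x, ‖fderiv ℝ (fun x => ∫ y, u y • ρ k (x - y)) x‖ ≤ C * (Mf + Mu)) ∧
      (∀ x y, ‖fderiv ℝ (fun x => ∫ y, u y • ρ k (x - y)) x
        - fderiv ℝ (fun x => ∫ y, u y • ρ k (x - y)) y‖ ≤ C * (Mf + Mu) * ‖x - y‖ ^ s) := by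
    intro k
    obtain ⟨L1, L2, hL1, hL2⟩ := aux_conv_bounds hu hMu (hρ2 k) (hρc k)
    refine hcore _ Mu Mf L1 L2 (hsm k) (hb u Mu hMu k) hL1 hL2 fun x => ?_
    rw [aux_eqn hn hs hu hMu (hρ k) (hρc k) heq x]
    exact hb f Mf hMf k x
  obtain ⟨v, g, h1, h2, h3, h4, h5⟩ := aux_limit (w := fun k x => ∫ y, u y • ρ k (x - y))
    (fun k => (hsm k).differentiable two_ne_zero) hs.1 (by positivity : 0 ≤ C * (Mf + Mu))
    (hb u Mu hMu) (fun k => (hk k).1) (fun k => (hk k).2)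
  refine ⟨v, g, ?_, h1, h2, h3, h4⟩
  filter_upwards [hlim] with x hx
  exact h5 x _ hx

end Main

/-- Schauder-type estimate with bounded right-hand side: if `u ∈ L^∞` solves
`-Δu + (-Δ)ˢu = f ∈ L^∞` in the distributional sense, then `u ∈ C^{0,α}` for all
`α < 2s` when `2s ≤ 1`, and `u ∈ C^{1,α}` for all `α < 2s-1` when `2s > 1`, with
constants depending only on `n, α, s`. -/
theorem stmt11 (n : ℕ) (hn : 3 ≤ n) (s α : ℝ) (hs : s ∈ Ioo (0 : ℝ) 1) :
    ∃ C : ℝ, 0 < C ∧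
      ∀ (u f : EuclideanSpace ℝ (Fin n) → ℝ) (Mu Mf : ℝ),
        Measurable u → (∀ x, |u x| ≤ Mu) →
        Measurable f → (∀ x, |f x| ≤ Mf) →
        -- distributional formulation against Schwartz test functions
        (∀ φ : SchwartzMap (EuclideanSpace ℝ (Fin n)) ℝ,
          (∫ x : EuclideanSpace ℝ (Fin n), u x * (-lap n (⇑φ) x + fracLap n s (⇑φ) x))
            = ∫ x : EuclideanSpace ℝ (Fin n), f x * φ x) →
        -- (1) case 2s ≤ 1
        ((2 * s ≤ 1 → 0 < α → α < 2 * s →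
          ∃ v : EuclideanSpace ℝ (Fin n) → ℝ,
            (∀ᵐ x : EuclideanSpace ℝ (Fin n), v x = u x) ∧
            (∀ x, |v x| ≤ C * (Mf + Mu)) ∧
            (∀ x y, |v x - v y| ≤ C * (Mf + Mu) * ‖x - y‖ ^ α)) ∧
        -- (2) case 2s > 1
        (1 < 2 * s → 0 < α → α < 2 * s - 1 →
          ∃ v : EuclideanSpace ℝ (Fin n) → ℝ,
            (∀ᵐ x : EuclideanSpace ℝ (Fin n), v x = u x) ∧
            ContDiff ℝ 1 v ∧
            (∀ x, |v x| + ‖gradient v x‖ ≤ C * (Mf + Mu)) ∧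
            (∀ x y, ‖gradient v x - gradient v y‖ ≤ C * (Mf + Mu) * ‖x - y‖ ^ α))) := by
  obtain ⟨C, hC, hmain⟩ := aux_main hn hs
  refine ⟨3 * C + 2, by positivity, ?_⟩
  intro u f Mu Mf hu hMu hf hMf heq
  have hMu0 : 0 ≤ Mu := (abs_nonneg _).trans (hMu 0)
  have hMf0 : 0 ≤ Mf := (abs_nonneg _).trans (hMf 0)
  obtain ⟨v, g, hvu, hg, hv, hgb, hgh⟩ := hmain u f Mu Mf hu hMu hf hMf heq
  have hK0 : 0 ≤ C * (Mf + Mu) := by positivity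
  have hS : (3 * C + 2) * (Mf + Mu) = 3 * (C * (Mf + Mu)) + 2 * Mf + 2 * Mu := by ring
  constructor
  · intro h2s hα hα2
    refine ⟨v, hvu, fun x => (hv x).trans (by rw [hS]; linarith), fun x y => ?_⟩
    have hl : ∀ x y, ‖v x - v y‖ ≤ (C * (Mf + Mu)) * ‖x - y‖ ^ (1:ℝ) := by
      intro x y
      rw [Real.rpow_one]
      exact convex_univ.norm_image_sub_le_of_norm_hasFDerivWithin_le (𝕜 := ℝ)
        (fun z _ => (hg z).hasFDerivWithinAt) (fun z _ => hgb z) (mem_univ y) (mem_univ x)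
    have := aux_holder (g := v) hα (by linarith) hK0 hl hv x y
    refine le_trans this (mul_le_mul_of_nonneg_right ?_ (Real.rpow_nonneg (norm_nonneg _) _))
    rw [hS]; linarith
  · intro h2s hα hα2
    have hfd : fderiv ℝ v = g := funext fun x => (hg x).fderiv
    have hgn : ∀ x, ‖gradient v x‖ = ‖g x‖ := by
      intro x
      rw [gradient, hfd, LinearIsometryEquiv.norm_map]
    refine ⟨v, hvu, ?_, fun x => ?_, fun x y => ?_⟩
    · rw [contDiff_one_iff_fderiv, hfd]
      refine ⟨fun x => (hg x).differentiableAt, continuous_iff_continuousAt.2 fun x => ?_⟩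
      rw [ContinuousAt, tendsto_iff_norm_sub_tendsto_zero]
      have hc : Continuous fun y : EuclideanSpace ℝ (Fin n) => C * (Mf + Mu) * ‖y - x‖ ^ s :=
        continuous_const.mul ((continuous_id.sub continuous_const).norm.rpow_const
          fun _ => Or.inr hs.1.le)
      have h0 := hc.tendsto x
      rw [sub_self, norm_zero, Real.zero_rpow hs.1.ne', mul_zero] at h0
      exact squeeze_zero (fun y => norm_nonneg _) (fun y => hgh y x) h0
    · rw [hgn, hS]
      linarith [hv x, hgb x]
    · have e : ‖gradient v x - gradient v y‖ = ‖g x - g y‖ := by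
        rw [gradient, gradient, hfd, ← map_sub, LinearIsometryEquiv.norm_map]
      rw [e]
      refine (aux_holder hα (by linarith [hs.2]) hK0 hgh hgb x y).trans
        (mul_le_mul_of_nonneg_right ?_ (Real.rpow_nonneg (norm_nonneg _) _))
      rw [hS]; linarith
end
end

section
/- Let n ≥ 1, 0 < α < 1, and f ∈ L^∞(ℝⁿ). Then for all x, y ∈ ℝⁿ the function z ↦ (|x−z|^{α−n} − |y−z|^{α−n}) f(z) is integrable on ℝⁿ, and there is a constant C = C(n, α) such that | ∫_{ℝⁿ} (|x−z|^{α−n} − |y−z|^{α−n}) f(z) dz | ≤ C ‖f‖_{L^∞} |x−y|^α. -/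
open MeasureTheory Metric Set
noncomputable section

open Real in
lemma aux_ptw (n : ℕ) (hn : 1 ≤ n) (α : ℝ) (h0 : 0 < α) (h1 : α < 1) (a b : ℝ) (ha : 0 ≤ a)
    (hab : a ≤ b) (hb : b ≤ a + 1) :
    |a ^ (α - (n:ℝ)) - b ^ (α - (n:ℝ))| ≤ 2 * n * (a ^ (α - (n:ℝ)) / (1 + a) + b ^ (α - (n:ℝ)) / (1 + b)) := by
  have hn' : (1:ℝ) ≤ n := by exact_mod_cast hn
  have hs : α - (n:ℝ) < 0 := by linarith
  have hB : 0 ≤ b ^ (α - (n:ℝ)) := rpow_nonneg (ha.trans hab) _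
  rcases ha.eq_or_lt with rfl | ha
  · rw [zero_rpow hs.ne, zero_sub, abs_neg, abs_of_nonneg hB, zero_div, zero_add]
    rw [← mul_div_assoc, le_div_iff₀ (by linarith)]
    nlinarith
  · have hb0 : 0 < b := ha.trans_le hab
    have hA : 0 < a ^ (α - (n:ℝ)) := rpow_pos_of_pos ha _
    have hle : b ^ (α - (n:ℝ)) ≤ a ^ (α - (n:ℝ)) := rpow_le_rpow_of_nonpos ha hab hs.le
    rw [abs_of_nonneg (by linarith)]
    have e : b ^ (α - (n:ℝ)) = a ^ (α - (n:ℝ)) * (a / b) ^ ((n:ℝ) - α) := by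
      rw [div_rpow ha.le hb0.le, mul_div_assoc', ← rpow_add ha,
        show α - (n:ℝ) + (n - α) = 0 by ring, rpow_zero, one_div, ← rpow_neg hb0.le]
      congr 1; ring
    have k1 : (a / b) ^ (n:ℝ) ≤ (a / b) ^ ((n:ℝ) - α) :=
      rpow_le_rpow_of_exponent_ge (by positivity) ((div_le_one hb0).2 hab) (by linarith)
    have k2 : a / (1 + a) ≤ a / b := div_le_div_of_nonneg_left ha.le hb0 (by linarith)
    have k3 : (a / (1 + a)) ^ n ≤ (a / b) ^ n := pow_le_pow_left₀ (by positivity) k2 n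
    have k4 : 1 + (n:ℝ) * (-(1 / (1 + a))) ≤ (1 + (-(1 / (1 + a)))) ^ n := by
      apply one_add_mul_le_pow
      have : 1 / (1 + a) ≤ 1 := (div_le_one (by linarith)).2 (by linarith)
      linarith
    rw [show 1 + (-(1 / (1 + a))) = a / (1 + a) by field_simp; ring] at k4
    rw [rpow_natCast] at k1
    have k5 : 1 - (a / b) ^ ((n:ℝ) - α) ≤ n * (1 / (1 + a)) := by linarith
    have k6 := mul_le_mul_of_nonneg_left k5 hA.le
    have k7 : 0 ≤ b ^ (α - (n:ℝ)) / (1 + b) := by positivity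
    have k8 : 0 ≤ a ^ (α - (n:ℝ)) / (1 + a) := by positivity
    calc _ = a ^ (α - (n:ℝ)) * (1 - (a / b) ^ ((n:ℝ) - α)) := by rw [e]; ring
      _ ≤ _ := k6
      _ = n * (a ^ (α - (n:ℝ)) / (1 + a)) := by ring
      _ ≤ _ := by nlinarith [mul_nonneg (zero_le_one.trans hn') k7, mul_nonneg (zero_le_one.trans hn') k8]

open Real in
lemma aux_ptw' (n : ℕ) (hn : 1 ≤ n) (α : ℝ) (h0 : 0 < α) (h1 : α < 1) (a b : ℝ) (ha : 0 ≤ a)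
    (hb : 0 ≤ b) (hab : |a - b| ≤ 1) :
    |a ^ (α - (n:ℝ)) - b ^ (α - (n:ℝ))| ≤ 2 * n * (a ^ (α - (n:ℝ)) / (1 + a) + b ^ (α - (n:ℝ)) / (1 + b)) := by
  rw [abs_le] at hab
  rcases le_total a b with h | h
  · exact aux_ptw n hn α h0 h1 a b ha h (by linarith)
  · rw [abs_sub_comm, add_comm (a ^ (α - (n:ℝ)) / (1 + a))]
    exact aux_ptw n hn α h0 h1 b a hb h (by linarith)

open Real in
lemma aux_int (n : ℕ) (hn : 1 ≤ n) (α : ℝ) (h0 : 0 < α) (h1 : α < 1) :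
    Integrable (fun w : EuclideanSpace ℝ (Fin n) => ‖w‖ ^ (α - (n:ℝ)) / (1 + ‖w‖)) := by
  haveI : Nonempty (Fin n) := ⟨⟨0, hn⟩⟩
  rw [integrable_fun_norm_addHaar volume (f := fun t : ℝ => t ^ (α - (n:ℝ)) / (1 + t))]
  simp only [finrank_euclideanSpace, Fintype.card_fin, smul_eq_mul]
  have e : ∀ t ∈ Ioi (0:ℝ), t ^ (α - 1) / (1 + t) = t ^ (n - 1) * (t ^ (α - (n:ℝ)) / (1 + t)) := by
    intro t ht
    rw [← mul_div_assoc, ← rpow_natCast, ← rpow_add ht, Nat.cast_sub hn]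
    congr 2; push_cast; ring
  refine IntegrableOn.congr_fun ?_ e measurableSet_Ioi
  have hm : Measurable (fun t : ℝ => t ^ (α - 1) / (1 + t)) := by fun_prop
  rw [← Ioc_union_Ioi_eq_Ioi zero_le_one, integrableOn_union]
  constructor
  · have : IntegrableOn (fun t : ℝ => t ^ (α - 1)) (Ioc 0 1) := by
      rw [← intervalIntegrable_iff_integrableOn_Ioc_of_le zero_le_one]
      exact intervalIntegral.intervalIntegrable_rpow' (by linarith)
    refine this.mono' hm.aestronglyMeasurable ?_
    filter_upwards [ae_restrict_mem measurableSet_Ioc] with t ht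
    have h := rpow_nonneg ht.1.le (α - 1)
    rw [norm_of_nonneg (div_nonneg h (by linarith [ht.1]))]
    exact div_le_self h (by linarith [ht.1])
  · have : IntegrableOn (fun t : ℝ => t ^ (α - 2)) (Ioi 1) :=
      integrableOn_Ioi_rpow_of_lt (by linarith) one_pos
    refine this.mono' hm.aestronglyMeasurable ?_
    filter_upwards [ae_restrict_mem measurableSet_Ioi] with t ht
    have ht : 1 < t := ht
    have ht0 : 0 < t := by linarith
    have h := rpow_nonneg ht0.le (α - 1)
    rw [norm_of_nonneg (div_nonneg h (by linarith))]
    rw [show α - 2 = (α - 1) - 1 by ring, rpow_sub_one ht0.ne' (α - 1)]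
    exact div_le_div_of_nonneg_left h ht0 (by linarith)




/-- `α`-Hölder continuity of the Riesz potential of a bounded function, via the
absolutely convergent difference of kernels: for `0 < α < 1` and `f ∈ L^∞(ℝⁿ)`,
`z ↦ (|x-z|^{α-n} - |y-z|^{α-n}) f(z)` is integrable and
`|∫ (|x-z|^{α-n} - |y-z|^{α-n}) f(z) dz| ≤ C ‖f‖_∞ |x-y|^α` with `C = C(n,α)`. -/
theorem stmt13 (n : ℕ) (hn : 1 ≤ n) (α : ℝ) (hα : α ∈ Ioo (0 : ℝ) 1) :
    ∃ C : ℝ, 0 < C ∧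
      ∀ (f : EuclideanSpace ℝ (Fin n) → ℝ) (Mf : ℝ),
        Measurable f → (∀ z, |f z| ≤ Mf) →
        ∀ x y : EuclideanSpace ℝ (Fin n),
          Integrable (fun z : EuclideanSpace ℝ (Fin n) =>
            (‖x - z‖ ^ (α - (n : ℝ)) - ‖y - z‖ ^ (α - (n : ℝ))) * f z) ∧
          |∫ z : EuclideanSpace ℝ (Fin n),
              (‖x - z‖ ^ (α - (n : ℝ)) - ‖y - z‖ ^ (α - (n : ℝ))) * f z|
            ≤ C * Mf * ‖x - y‖ ^ α := by
  obtain ⟨h0, h1⟩ := hα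
  set H : EuclideanSpace ℝ (Fin n) → ℝ := fun w => ‖w‖ ^ (α - (n:ℝ)) / (1 + ‖w‖) with hH
  have hHi : Integrable H := aux_int n hn α h0 h1
  have hH0 : ∀ w, 0 ≤ H w := fun w => by rw [hH]; positivity
  have hI : 0 ≤ ∫ w, H w := integral_nonneg hH0
  refine ⟨4 * n * (∫ w, H w) + 1, by positivity, ?_⟩
  intro f Mf hf hM x y
  have hMf : 0 ≤ Mf := (abs_nonneg _).trans (hM 0)
  rcases eq_or_ne x y with rfl | hxy
  · simp [Real.zero_rpow h0.ne']
  set r := ‖x - y‖ with hr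
  have hr0 : 0 < r := norm_pos_iff.2 (sub_ne_zero.2 hxy)
  have hi : ∀ u : EuclideanSpace ℝ (Fin n), Integrable (fun z => H (r⁻¹ • (u - z))) := fun u =>
    (hHi.comp_smul (inv_ne_zero hr0.ne')).comp_sub_left u
  have hv : ∀ u : EuclideanSpace ℝ (Fin n), ∫ z, H (r⁻¹ • (u - z)) = r ^ n * ∫ w, H w := by
    intro u
    rw [integral_sub_left_eq_self (fun z => H (r⁻¹ • z)) volume u, Measure.integral_comp_smul]
    simp [abs_of_pos hr0]
  set G : EuclideanSpace ℝ (Fin n) → ℝ := fun z =>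
    (r ^ (α - (n:ℝ)) * (2 * n) * Mf) * (H (r⁻¹ • (x - z)) + H (r⁻¹ • (y - z))) with hG
  have hGi : Integrable G := ((hi x).add (hi y)).const_mul _
  have hs : ∀ u : EuclideanSpace ℝ (Fin n),
      ‖u‖ ^ (α - (n:ℝ)) = r ^ (α - (n:ℝ)) * ‖r⁻¹ • u‖ ^ (α - (n:ℝ)) := by
    intro u
    rw [← Real.mul_rpow hr0.le (norm_nonneg _), norm_smul, norm_inv, Real.norm_of_nonneg hr0.le,
      mul_inv_cancel_left₀ hr0.ne']
  have hb : ∀ z, ‖(‖x - z‖ ^ (α - (n : ℝ)) - ‖y - z‖ ^ (α - (n : ℝ))) * f z‖ ≤ G z := by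
    intro z
    have hd : |‖r⁻¹ • (x - z)‖ - ‖r⁻¹ • (y - z)‖| ≤ 1 := by
      refine (abs_norm_sub_norm_le _ _).trans ?_
      rw [← smul_sub, sub_sub_sub_cancel_right, norm_smul, norm_inv, Real.norm_of_nonneg hr0.le,
        ← hr, inv_mul_cancel₀ hr0.ne']
    have hp := aux_ptw' n hn α h0 h1 _ _ (norm_nonneg _) (norm_nonneg _) hd
    have hR : 0 ≤ r ^ (α - (n:ℝ)) := Real.rpow_nonneg hr0.le _
    rw [norm_mul, Real.norm_eq_abs, Real.norm_eq_abs, hs (x - z), hs (y - z), ← mul_sub, abs_mul,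
      abs_of_nonneg hR]
    calc _ ≤ r ^ (α - (n:ℝ)) * (2 * n * (H (r⁻¹ • (x - z)) + H (r⁻¹ • (y - z)))) * Mf := by
          have := hH0 (r⁻¹ • (x - z))
          have := hH0 (r⁻¹ • (y - z))
          exact mul_le_mul (mul_le_mul_of_nonneg_left hp hR) (hM z) (abs_nonneg _) (by positivity)
      _ = G z := by rw [hG]; ring
  refine ⟨hGi.mono' (by fun_prop) (Filter.Eventually.of_forall hb), ?_⟩
  have hle := norm_integral_le_of_norm_le hGi (Filter.Eventually.of_forall hb)
  rw [Real.norm_eq_abs] at hle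
  refine hle.trans ?_
  have : ∫ z, G z = 4 * n * (∫ w, H w) * Mf * r ^ α := by
    rw [hG, integral_const_mul, integral_add (hi x) (hi y), hv, hv]
    rw [Real.rpow_sub hr0, Real.rpow_natCast]
    field_simp
    ring
  rw [this]
  have : 0 ≤ Mf * r ^ α := by positivity
  nlinarith
end
end

section
/- Let n ≥ 1, 1 < α < 2, and f ∈ L^∞(ℝⁿ). Then for all x, y ∈ ℝⁿ the function z ↦ ((x−z)/|x−z|^{n−α+2} − (y−z)/|y−z|^{n−α+2}) f(z) is integrable on ℝⁿ, and there is a constant C = C(n, α) such that | ∫_{ℝⁿ} ( (x−z)/|x−z|^{n−α+2} − (y−z)/|y−z|^{n−α+2} ) f(z) dz | ≤ C ‖f‖_{L^∞} |x−y|^{α−1}. -/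
open MeasureTheory Metric Set
noncomputable section

lemma aux_rpow_sub {p a b m : ℝ} (hp : 0 < p) (hm : 0 < m) (ha : m ≤ a) (hb : m ≤ b) :
    |a ^ (-p) - b ^ (-p)| ≤ p * m ^ (-p - 1) * |a - b| := by
  have key := Convex.norm_image_sub_le_of_norm_hasDerivWithin_le (𝕜 := ℝ)
    (f := fun t : ℝ => t ^ (-p)) (f' := fun t : ℝ => (-p) * t ^ (-p - 1))
    (C := p * m ^ (-p - 1)) (s := Ici m) (x := b) (y := a)
    (fun t ht => (Real.hasDerivAt_rpow_const
      (Or.inl (lt_of_lt_of_le hm ht).ne')).hasDerivWithinAt)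
    (fun t ht => by
      have ht0 : 0 < t := lt_of_lt_of_le hm ht
      rw [norm_mul, Real.norm_eq_abs, Real.norm_eq_abs, abs_neg, abs_of_pos hp,
        abs_of_pos (Real.rpow_pos_of_pos ht0 _)]
      exact mul_le_mul_of_nonneg_left
        (Real.rpow_le_rpow_of_nonpos hm ht (by linarith)) hp.le)
    (convex_Ici m) hb ha
  simpa [Real.norm_eq_abs] using key

lemma aux_far {E : Type*} [NormedAddCommGroup E] [NormedSpace ℝ E] {p : ℝ} (hp : 0 < p)
    (u v : E) (huv : 0 < ‖u - v‖) (h : 2 * ‖u - v‖ ≤ ‖u‖) :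
    ‖(1 / ‖u‖ ^ p) • u - (1 / ‖v‖ ^ p) • v‖
      ≤ (1 + p * (1 / 2 : ℝ) ^ (-p - 1) * (3 / 2)) * ‖u - v‖ * ‖u‖ ^ (-p) := by
  have ha : 0 < ‖u‖ := by linarith
  have h1 : |‖u‖ - ‖v‖| ≤ ‖u - v‖ := abs_norm_sub_norm_le u v
  have h2 := abs_le.1 h1
  have hb : ‖u‖ * (1 / 2) ≤ ‖v‖ := by linarith
  have hb2 : ‖v‖ ≤ (3 / 2) * ‖u‖ := by linarith
  have key := aux_rpow_sub (m := ‖u‖ * (1 / 2)) hp (by linarith)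
    (by linarith : ‖u‖ * (1 / 2) ≤ ‖u‖) hb
  rw [Real.mul_rpow ha.le (by norm_num)] at key
  have e1 : ‖u‖ ^ (-p - 1) * ‖u‖ = ‖u‖ ^ (-p) := by
    rw [Real.rpow_sub_one ha.ne']; field_simp
  have eq : (1 / ‖u‖ ^ p) • u - (1 / ‖v‖ ^ p) • v
      = ‖u‖ ^ (-p) • (u - v) + (‖u‖ ^ (-p) - ‖v‖ ^ (-p)) • v := by
    rw [Real.rpow_neg ha.le, Real.rpow_neg (norm_nonneg v), one_div, one_div, smul_sub, sub_smul]
    abel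
  rw [eq]
  have hpos : 0 < (1 / 2 : ℝ) ^ (-p - 1) := by positivity
  calc _ ≤ ‖‖u‖ ^ (-p) • (u - v)‖ + ‖(‖u‖ ^ (-p) - ‖v‖ ^ (-p)) • v‖ := norm_add_le _ _
    _ = ‖u‖ ^ (-p) * ‖u - v‖ + |‖u‖ ^ (-p) - ‖v‖ ^ (-p)| * ‖v‖ := by
        rw [norm_smul, norm_smul, Real.norm_eq_abs, Real.norm_eq_abs,
          abs_of_pos (Real.rpow_pos_of_pos ha _)]
    _ ≤ ‖u‖ ^ (-p) * ‖u - v‖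
        + (p * (‖u‖ ^ (-p - 1) * (1 / 2 : ℝ) ^ (-p - 1)) * ‖u - v‖) * ((3 / 2) * ‖u‖) := by
        gcongr
        exact key.trans (by gcongr)
    _ = _ := by rw [← e1]; ring

def aPhi (p t : ℝ) : ℝ := if t < 3 then t ^ (1 - p) else 0
def aPsi (p t : ℝ) : ℝ := if t < 2 then 0 else t ^ (-p)

lemma aPhi_nonneg {p t : ℝ} (ht : 0 ≤ t) : 0 ≤ aPhi p t := by
  unfold aPhi; split_ifs <;> positivity

lemma aPsi_nonneg {p t : ℝ} (ht : 0 ≤ t) : 0 ≤ aPsi p t := by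
  unfold aPsi; split_ifs <;> positivity

lemma aPhi_int (n : ℕ) (hn : 1 ≤ n) (p : ℝ) (hp : p < n + 1) :
    Integrable (fun w : EuclideanSpace ℝ (Fin n) => aPhi p ‖w‖) := by
  have : Nonempty (Fin n) := ⟨⟨0, hn⟩⟩
  refine (integrable_fun_norm_addHaar (E := EuclideanSpace ℝ (Fin n)) volume (f := aPhi p)).2 ?_
  rw [finrank_euclideanSpace_fin]
  have h0 : IntegrableOn (fun t : ℝ => t ^ ((n : ℝ) - p)) (Ioo 0 3) := by
    rw [intervalIntegral.integrableOn_Ioo_rpow_iff (by norm_num)]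
    linarith
  have h1 := (integrable_indicator_iff measurableSet_Ioo).2 h0
  refine h1.integrableOn.congr_fun (fun t ht => ?_) measurableSet_Ioi
  have ht : 0 < t := ht
  by_cases h3 : t < 3
  · simp only [indicator, mem_Ioo, ht, h3, and_self, if_true, aPhi, smul_eq_mul]
    rw [← Real.rpow_natCast, ← Real.rpow_add ht, Nat.cast_sub hn]
    congr 1; push_cast; ring
  · simp [indicator, h3, aPhi]

lemma aPsi_int (n : ℕ) (hn : 1 ≤ n) (p : ℝ) (hp : n < p) :
    Integrable (fun w : EuclideanSpace ℝ (Fin n) => aPsi p ‖w‖) := by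
  have : Nonempty (Fin n) := ⟨⟨0, hn⟩⟩
  refine (integrable_fun_norm_addHaar (E := EuclideanSpace ℝ (Fin n)) volume (f := aPsi p)).2 ?_
  rw [finrank_euclideanSpace_fin]
  have h0 : IntegrableOn (fun t : ℝ => t ^ ((n : ℝ) - 1 - p)) (Ici 2) := by
    rw [integrableOn_Ici_iff_integrableOn_Ioi, integrableOn_Ioi_rpow_iff (by norm_num)]
    linarith
  have h1 := (integrable_indicator_iff measurableSet_Ici).2 h0
  refine h1.integrableOn.congr_fun (fun t ht => ?_) measurableSet_Ioi
  have ht : 0 < t := ht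
  by_cases h3 : t < 2
  · simp [indicator, h3, aPsi]
  · simp only [indicator, mem_Ici, not_lt.1 h3, h3, if_true, if_false, aPsi, smul_eq_mul]
    rw [← Real.rpow_natCast, ← Real.rpow_add ht, Nat.cast_sub hn]
    congr 1; push_cast; ring

lemma aux_K {E : Type*} [NormedAddCommGroup E] [NormedSpace ℝ E] {p : ℝ} (hp : 1 < p)
    (u : E) : ‖(1 / ‖u‖ ^ p) • u‖ = ‖u‖ ^ (1 - p) := by
  rcases eq_or_ne u 0 with rfl | hu
  · simp [Real.zero_rpow (by linarith : 1 - p ≠ 0)]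
  · have : 0 < ‖u‖ := norm_pos_iff.2 hu
    rw [norm_smul, Real.norm_eq_abs, abs_of_pos (by positivity), Real.rpow_sub this, Real.rpow_one]
    ring

lemma aux_pt {E : Type*} [NormedAddCommGroup E] [NormedSpace ℝ E] {p : ℝ} (hp : 1 < p)
    (u v : E) (r : ℝ) (hr : r = ‖u - v‖) (hr0 : 0 < r) :
    ‖(1 / ‖u‖ ^ p) • u - (1 / ‖v‖ ^ p) • v‖
      ≤ r ^ (1 - p) * (aPhi p ‖r⁻¹ • u‖ + aPhi p ‖r⁻¹ • v‖
        + (1 + p * (1 / 2 : ℝ) ^ (-p - 1) * (3 / 2)) * aPsi p ‖r⁻¹ • u‖) := by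
  have hc : 0 ≤ 1 + p * (1 / 2 : ℝ) ^ (-p - 1) * (3 / 2) := by positivity
  set c := 1 + p * (1 / 2 : ℝ) ^ (-p - 1) * (3 / 2) with hcdef
  have hn : ∀ w : E, ‖r⁻¹ • w‖ = r⁻¹ * ‖w‖ := fun w => by
    rw [norm_smul, norm_inv, Real.norm_eq_abs, abs_of_pos hr0]
  have hsc : ∀ w : E, r ^ (1 - p) * (r⁻¹ * ‖w‖) ^ (1 - p) = ‖w‖ ^ (1 - p) := fun w => by
    rw [← Real.mul_rpow hr0.le (by positivity)]
    congr 1; field_simp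
  rw [hn, hn]
  by_cases h : ‖u‖ < 2 * r
  · have hv : ‖v‖ < 3 * r := by
      have := norm_sub_norm_le v u
      rw [norm_sub_rev] at this; linarith
    have h1 : r⁻¹ * ‖u‖ < 2 := by rw [inv_mul_lt_iff₀ hr0]; linarith
    have h2 : r⁻¹ * ‖v‖ < 3 := by rw [inv_mul_lt_iff₀ hr0]; linarith
    refine (norm_sub_le _ _).trans ?_
    rw [aux_K hp, aux_K hp, aPhi, aPhi, aPsi, if_pos (by linarith), if_pos h2, if_pos h1,
      mul_zero, add_zero, mul_add, hsc, hsc]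
  · have h1 : ¬ r⁻¹ * ‖u‖ < 2 := by rw [inv_mul_lt_iff₀ hr0]; linarith
    have key := aux_far (by linarith : 0 < p) u v (hr ▸ hr0) (by rw [← hr]; linarith)
    rw [← hr, ← hcdef] at key
    refine key.trans ?_
    have e : c * r * ‖u‖ ^ (-p) = r ^ (1 - p) * (c * aPsi p (r⁻¹ * ‖u‖)) := by
      have e2 : r * ‖u‖ ^ (-p) = r ^ (1 - p) * (r⁻¹ * ‖u‖) ^ (-p) := by
        rw [Real.mul_rpow (by positivity) (norm_nonneg u), Real.inv_rpow hr0.le, Real.rpow_neg hr0.le,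
          inv_inv, Real.rpow_sub hr0, Real.rpow_one]
        have := Real.rpow_pos_of_pos hr0 p
        field_simp
      rw [aPsi, if_neg h1, mul_assoc, e2]; ring
    rw [e]
    have a1 := aPhi_nonneg (p := p) (t := r⁻¹ * ‖u‖) (by positivity)
    have a2 := aPhi_nonneg (p := p) (t := r⁻¹ * ‖v‖) (by positivity)
    gcongr
    linarith

lemma aux_scale (n : ℕ) (g : EuclideanSpace ℝ (Fin n) → ℝ) (hg : Integrable g) (r : ℝ) (hr : 0 < r)
    (x : EuclideanSpace ℝ (Fin n)) :
    Integrable (fun z => g (r⁻¹ • (x - z))) ∧ ∫ z, g (r⁻¹ • (x - z)) = r ^ (n : ℝ) * ∫ z, g z := by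
  constructor
  · exact (hg.comp_smul (inv_ne_zero hr.ne')).comp_sub_left x
  · rw [integral_sub_left_eq_self (fun w => g (r⁻¹ • w)) volume x,
      Measure.integral_comp_inv_smul_of_nonneg _ _ hr.le, finrank_euclideanSpace_fin]
    simp

/-- `(α-1)`-Hölder continuity of the gradient of the Riesz potential of a bounded
function, via the absolutely convergent difference of the gradient kernels: for
`1 < α < 2` and `f ∈ L^∞(ℝⁿ)`, the function
`z ↦ ((x-z)/|x-z|^{n-α+2} - (y-z)/|y-z|^{n-α+2}) f(z)` is integrable and
`‖∫ ((x-z)/|x-z|^{n-α+2} - (y-z)/|y-z|^{n-α+2}) f(z) dz‖ ≤ C ‖f‖_∞ |x-y|^{α-1}`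
with `C = C(n,α)`. -/
theorem stmt14 (n : ℕ) (hn : 1 ≤ n) (α : ℝ) (hα : α ∈ Ioo (1 : ℝ) 2) :
    ∃ C : ℝ, 0 < C ∧
      ∀ (f : EuclideanSpace ℝ (Fin n) → ℝ) (Mf : ℝ),
        Measurable f → (∀ z, |f z| ≤ Mf) →
        ∀ x y : EuclideanSpace ℝ (Fin n),
          Integrable (fun z : EuclideanSpace ℝ (Fin n) =>
            f z • ((1 / ‖x - z‖ ^ ((n : ℝ) - α + 2)) • (x - z)
              - (1 / ‖y - z‖ ^ ((n : ℝ) - α + 2)) • (y - z))) ∧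
          ‖∫ z : EuclideanSpace ℝ (Fin n),
              f z • ((1 / ‖x - z‖ ^ ((n : ℝ) - α + 2)) • (x - z)
                - (1 / ‖y - z‖ ^ ((n : ℝ) - α + 2)) • (y - z))‖
            ≤ C * Mf * ‖x - y‖ ^ (α - 1) := by
  obtain ⟨hα1, hα2⟩ := hα
  have hn1 : (1 : ℝ) ≤ n := by exact_mod_cast hn
  set p : ℝ := (n : ℝ) - α + 2 with hp
  have hp1 : 1 < p := by linarith
  have iΦ := aPhi_int n hn p (by linarith)
  have iΨ := aPsi_int n hn p (by linarith)
  set c : ℝ := 1 + p * (1 / 2 : ℝ) ^ (-p - 1) * (3 / 2) with hc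
  have hc0 : 0 ≤ c := by positivity
  set A : ℝ := ∫ w : EuclideanSpace ℝ (Fin n), aPhi p ‖w‖ with hA
  set B : ℝ := ∫ w : EuclideanSpace ℝ (Fin n), aPsi p ‖w‖ with hB
  have hA0 : 0 ≤ A := integral_nonneg fun w => aPhi_nonneg (norm_nonneg w)
  have hB0 : 0 ≤ B := integral_nonneg fun w => aPsi_nonneg (norm_nonneg w)
  refine ⟨A + A + c * B + 1, by positivity, ?_⟩
  intro f Mf hf hM x y
  have hMf : 0 ≤ Mf := (abs_nonneg _).trans (hM 0)
  rcases eq_or_ne x y with rfl | hxy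
  · simp [Real.zero_rpow (by linarith : α - 1 ≠ 0)]
  have hr0 : 0 < ‖x - y‖ := norm_pos_iff.2 (sub_ne_zero.2 hxy)
  set r := ‖x - y‖ with hr
  obtain ⟨i1, e1⟩ := aux_scale n _ iΦ r hr0 x
  obtain ⟨i2, e2⟩ := aux_scale n _ iΦ r hr0 y
  obtain ⟨i3, e3⟩ := aux_scale n _ iΨ r hr0 x
  have hpt : ∀ z, ‖f z • ((1 / ‖x - z‖ ^ p) • (x - z) - (1 / ‖y - z‖ ^ p) • (y - z))‖
      ≤ Mf * (r ^ (1 - p) * (aPhi p ‖r⁻¹ • (x - z)‖ + aPhi p ‖r⁻¹ • (y - z)‖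
        + c * aPsi p ‖r⁻¹ • (x - z)‖)) := fun z => by
    rw [norm_smul]
    exact mul_le_mul (hM z) (aux_pt hp1 _ _ r (by simp [hr]) hr0) (norm_nonneg _) hMf
  have ib := (((i1.add i2).add (i3.const_mul c)).const_mul (r ^ (1 - p))).const_mul Mf
  have hmeas : AEStronglyMeasurable (fun z : EuclideanSpace ℝ (Fin n) =>
      f z • ((1 / ‖x - z‖ ^ p) • (x - z) - (1 / ‖y - z‖ ^ p) • (y - z))) volume := by
    apply Measurable.aestronglyMeasurable
    fun_prop
  refine ⟨ib.mono' hmeas (Filter.Eventually.of_forall hpt), ?_⟩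
  refine (norm_integral_le_of_norm_le ib (Filter.Eventually.of_forall hpt)).trans ?_
  have hint : ∫ z, Mf * (r ^ (1 - p) * (aPhi p ‖r⁻¹ • (x - z)‖ + aPhi p ‖r⁻¹ • (y - z)‖
        + c * aPsi p ‖r⁻¹ • (x - z)‖)) = Mf * (r ^ (1 - p) * (r ^ (n : ℝ) * (A + A + c * B))) := by
    rw [integral_const_mul, integral_const_mul, integral_add (by exact i1.add i2) (i3.const_mul c),
      integral_add i1 i2, integral_const_mul, e1, e2, e3]
    ring
  refine (le_of_eq hint).trans ?_
  have hpow : r ^ (1 - p) * r ^ (n : ℝ) = r ^ (α - 1) := by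
    rw [← Real.rpow_add hr0]; congr 1; rw [hp]; ring
  have hpos : 0 ≤ r ^ (α - 1) := by positivity
  calc _ = (A + A + c * B) * Mf * r ^ (α - 1) := by rw [← hpow]; ring
    _ ≤ _ := mul_le_mul_of_nonneg_right (mul_le_mul_of_nonneg_right (by linarith) hMf) hpos
end
end

section
/- Let n > 4s with s ∈ (0,1), let 𝓗 be the mixed heat kernel, 𝓩(x) = ∫₀^{+∞} 𝓗(x,t) dt, and define ω(x) := ∫_{B_{1/2}} 𝓩(x−y) dy. Then ω > 0 in ℝⁿ, lim_{|x|→+∞} ω(x) = 0, and there is a constant c₁ > 0 such that ω(x) ≥ c₁/|x|^{n+2s} for every |x| > 1. -/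
open MeasureTheory Metric Set
open scoped RealInnerProductSpace
noncomputable section

/-- The mixed heat kernel `𝓗(x,t) = ∫_{ℝⁿ} e^{-t(|ξ|² + |ξ|^{2s}) + 2πi x·ξ} dξ`. -/
def mixedHeatKernel (n : ℕ) (s : ℝ) (x : EuclideanSpace ℝ (Fin n)) (t : ℝ) : ℝ :=
  (∫ ξ : EuclideanSpace ℝ (Fin n),
    Complex.exp (-(t : ℂ) * ((‖ξ‖ ^ 2 + ‖ξ‖ ^ (2 * s) : ℝ) : ℂ)
      + 2 * (Real.pi : ℂ) * Complex.I * ((⟪x, ξ⟫ : ℝ) : ℂ))).re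

/-- The fundamental solution `𝓩(x) = ∫₀^{+∞} 𝓗(x,t) dt`. -/
def mixedZ (n : ℕ) (s : ℝ) (x : EuclideanSpace ℝ (Fin n)) : ℝ :=
  ∫ t in Ioi (0 : ℝ), mixedHeatKernel n s x t

section helpers

variable {n : ℕ}

lemma gauss_int {b : ℝ} (hb : 0 < b) :
    Integrable (fun ξ : EuclideanSpace ℝ (Fin n) => Real.exp (-b * ‖ξ‖ ^ 2)) := by
  have h := GaussianFourier.integrable_cexp_neg_mul_sq_norm_add (V := EuclideanSpace ℝ (Fin n))
    (b := (b : ℂ)) (by simpa using hb) 0 0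
  have h2 := h.norm
  refine h2.congr (Filter.Eventually.of_forall fun ξ => ?_)
  simp only [Complex.norm_exp]
  congr 1
  simp [← Complex.ofReal_pow]

lemma gauss_cos {b : ℝ} (hb : 0 < b) (θ : ℝ) (x : EuclideanSpace ℝ (Fin n)) :
    ∫ ξ : EuclideanSpace ℝ (Fin n), Real.exp (-b * ‖ξ‖ ^ 2) * Real.cos (θ + 2 * Real.pi * ⟪x, ξ⟫)
      = (Real.pi / b) ^ ((n : ℝ) / 2) * Real.exp (-(Real.pi ^ 2 * ‖x‖ ^ 2 / b)) * Real.cos θ := by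
  have hi := GaussianFourier.integrable_cexp_neg_mul_sq_norm_add (V := EuclideanSpace ℝ (Fin n))
    (b := (b : ℂ)) (by simpa using hb) (2 * Real.pi * Complex.I) x
  have h := GaussianFourier.integral_cexp_neg_mul_sq_norm_add (V := EuclideanSpace ℝ (Fin n))
    (b := (b : ℂ)) (by simpa using hb) (2 * Real.pi * Complex.I) x
  have h2 := congrArg (fun z => (Complex.exp (θ * Complex.I) * z).re) h
  rw [← integral_const_mul] at h2
  have h3 : (∫ a : EuclideanSpace ℝ (Fin n), Complex.exp (θ * Complex.I) *
      Complex.exp (-(b : ℂ) * ‖a‖ ^ 2 + 2 * Real.pi * Complex.I * ((⟪x, a⟫ : ℝ) : ℂ))).re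
      = ∫ a : EuclideanSpace ℝ (Fin n), (Complex.exp (θ * Complex.I) *
      Complex.exp (-(b : ℂ) * ‖a‖ ^ 2 + 2 * Real.pi * Complex.I * ((⟪x, a⟫ : ℝ) : ℂ))).re :=
    (integral_re (hi.const_mul (Complex.exp (θ * Complex.I)))).symm
  rw [h3] at h2
  have e1 : ∀ a : EuclideanSpace ℝ (Fin n), (Complex.exp (θ * Complex.I) *
      Complex.exp (-(b : ℂ) * ‖a‖ ^ 2 + 2 * Real.pi * Complex.I * ((⟪x, a⟫ : ℝ) : ℂ))).re
      = Real.exp (-b * ‖a‖ ^ 2) * Real.cos (θ + 2 * Real.pi * ⟪x, a⟫) := by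
    intro a
    rw [← Complex.exp_add]
    have : (θ * Complex.I + (-(b : ℂ) * ‖a‖ ^ 2 + 2 * Real.pi * Complex.I * ((⟪x, a⟫ : ℝ) : ℂ)))
      = ((-b * ‖a‖ ^ 2 : ℝ) : ℂ) + ((θ + 2 * Real.pi * ⟪x, a⟫ : ℝ) : ℂ) * Complex.I := by
      push_cast; ring
    rw [this, Complex.exp_add, ← Complex.ofReal_exp, Complex.re_ofReal_mul,
      Complex.exp_ofReal_mul_I_re]
  simp only [e1] at h2
  rw [h2]
  have e2 : (Real.pi / (b : ℂ)) ^ ((Module.finrank ℝ (EuclideanSpace ℝ (Fin n)) : ℂ) / 2)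
      = (((Real.pi / b) ^ ((n : ℝ) / 2) : ℝ) : ℂ) := by
    rw [Complex.ofReal_cpow (by positivity)]
    simp
  have e3 : (2 * Real.pi * Complex.I) ^ 2 * (‖x‖ : ℂ) ^ 2 / (4 * b)
      = ((-(Real.pi ^ 2 * ‖x‖ ^ 2 / b) : ℝ) : ℂ) := by
    push_cast
    rw [mul_pow, Complex.I_sq]
    have : (b : ℂ) ≠ 0 := by exact_mod_cast hb.ne'
    field_simp
    ring
  rw [e2, e3, ← Complex.ofReal_exp, ← Complex.ofReal_mul, mul_comm, Complex.re_ofReal_mul,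
    Complex.exp_ofReal_mul_I_re]

/-- Positivity class: behaves like a mixture of Gaussians of variance parameter at least `a`. -/
def KK (n : ℕ) (a : ℝ) (f : EuclideanSpace ℝ (Fin n) → ℝ) : Prop :=
  Measurable f ∧ (∀ ξ, 0 ≤ f ξ) ∧ (∃ C, ∀ ξ, f ξ ≤ C) ∧
  ∀ b : ℝ, 0 < b → ∀ x : EuclideanSpace ℝ (Fin n),
    Real.exp (-(Real.pi ^ 2 * ‖x‖ ^ 2 / (a + b))) * ∫ ξ, Real.exp (-b * ‖ξ‖ ^ 2) * f ξ
      ≤ ∫ ξ, Real.exp (-b * ‖ξ‖ ^ 2) * f ξ * Real.cos (2 * Real.pi * ⟪x, ξ⟫)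

lemma wint {f : EuclideanSpace ℝ (Fin n) → ℝ} (hm : Measurable f) (h0 : ∀ ξ, 0 ≤ f ξ) {C : ℝ}
    (hC : ∀ ξ, f ξ ≤ C) {b : ℝ} (hb : 0 < b) :
    Integrable (fun ξ => Real.exp (-b * ‖ξ‖ ^ 2) * f ξ) := by
  refine ((gauss_int hb).mul_const C).mono' (by fun_prop) (Filter.Eventually.of_forall fun ξ => ?_)
  rw [Real.norm_eq_abs, abs_of_nonneg (mul_nonneg (Real.exp_nonneg _) (h0 ξ))]
  exact mul_le_mul_of_nonneg_left (hC ξ) (Real.exp_nonneg _)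

lemma wintcos {f : EuclideanSpace ℝ (Fin n) → ℝ} (hf : Integrable f) (x : EuclideanSpace ℝ (Fin n)) :
    Integrable (fun ξ => f ξ * Real.cos (2 * Real.pi * ⟪x, ξ⟫)) := by
  refine hf.norm.mono' (hf.aestronglyMeasurable.mul (Measurable.aestronglyMeasurable (by fun_prop)))
    (Filter.Eventually.of_forall fun ξ => ?_)
  rw [norm_mul]
  exact mul_le_of_le_one_right (norm_nonneg _) (Real.abs_cos_le_one _)

lemma KK_one : KK n 0 (fun _ => 1) := by
  refine ⟨measurable_const, fun _ => zero_le_one, ⟨1, fun _ => le_rfl⟩, fun b hb x => ?_⟩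
  have h1 := gauss_cos (n := n) hb 0 x
  have h2 := gauss_cos (n := n) hb 0 0
  simp only [zero_add, inner_zero_left, mul_zero, Real.cos_zero, mul_one, norm_zero] at h1 h2
  simp only [mul_one, zero_add]
  rw [h1, h2]
  simp [mul_comm]

lemma KK_add {a : ℝ} {f g : EuclideanSpace ℝ (Fin n) → ℝ} (hf : KK n a f) (hg : KK n a g) :
    KK n a (fun ξ => f ξ + g ξ) := by
  obtain ⟨f1, f2, ⟨C, f3⟩, f4⟩ := hf
  obtain ⟨g1, g2, ⟨D, g3⟩, g4⟩ := hg
  refine ⟨f1.add g1, fun ξ => add_nonneg (f2 ξ) (g2 ξ), ⟨C + D, fun ξ => add_le_add (f3 ξ) (g3 ξ)⟩,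
    fun b hb x => ?_⟩
  have i1 := wint f1 f2 f3 hb
  have i2 := wint g1 g2 g3 hb
  simp only [mul_add, add_mul]
  rw [integral_add i1 i2, integral_add (wintcos i1 x) (wintcos i2 x), mul_add]
  exact add_le_add (f4 b hb x) (g4 b hb x)

lemma KK_smul {a c : ℝ} (hc : 0 ≤ c) {f : EuclideanSpace ℝ (Fin n) → ℝ} (hf : KK n a f) :
    KK n a (fun ξ => c * f ξ) := by
  obtain ⟨f1, f2, ⟨C, f3⟩, f4⟩ := hf
  refine ⟨f1.const_mul c, fun ξ => mul_nonneg hc (f2 ξ),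
    ⟨c * C, fun ξ => mul_le_mul_of_nonneg_left (f3 ξ) hc⟩, fun b hb x => ?_⟩
  have e1 : ∀ ξ : EuclideanSpace ℝ (Fin n), Real.exp (-b * ‖ξ‖ ^ 2) * (c * f ξ)
    = c * (Real.exp (-b * ‖ξ‖ ^ 2) * f ξ) := fun ξ => by ring
  simp only [e1, mul_assoc c, integral_const_mul]
  have := mul_le_mul_of_nonneg_left (f4 b hb x) hc
  linarith

lemma KK_zero {a : ℝ} : KK n a (fun _ => 0) := by
  refine ⟨measurable_const, fun _ => le_rfl, ⟨0, fun _ => le_rfl⟩, fun b hb x => ?_⟩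
  simp

lemma KK_sum {a : ℝ} {f : ℕ → EuclideanSpace ℝ (Fin n) → ℝ} (hf : ∀ k, KK n a (f k)) (N : ℕ) :
    KK n a (fun ξ => ∑ k ∈ Finset.range N, f k ξ) := by
  induction N with
  | zero => simpa using KK_zero
  | succ N ih =>
    simp only [Finset.sum_range_succ]
    exact KK_add ih (hf N)

lemma KK_mono {a a' : ℝ} (h0 : 0 ≤ a') (h : a' ≤ a) {f : EuclideanSpace ℝ (Fin n) → ℝ}
    (hf : KK n a f) : KK n a' f := by
  obtain ⟨f1, f2, f3, f4⟩ := hf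
  refine ⟨f1, f2, f3, fun b hb x => le_trans ?_ (f4 b hb x)⟩
  refine mul_le_mul_of_nonneg_right ?_
    (integral_nonneg fun ξ => mul_nonneg (Real.exp_nonneg _) (f2 ξ))
  gcongr

lemma KK_lim {a C : ℝ} {F : ℕ → EuclideanSpace ℝ (Fin n) → ℝ} {f : EuclideanSpace ℝ (Fin n) → ℝ}
    (hF : ∀ N, KK n a (F N)) (hC : ∀ N ξ, F N ξ ≤ C)
    (hl : ∀ ξ, Filter.Tendsto (fun N => F N ξ) Filter.atTop (nhds (f ξ))) : KK n a f := by
  refine ⟨measurable_of_tendsto_metrizable (fun N => (hF N).1) (tendsto_pi_nhds.2 hl),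
    fun ξ => ge_of_tendsto' (hl ξ) fun N => (hF N).2.1 ξ,
    ⟨C, fun ξ => le_of_tendsto' (hl ξ) fun N => hC N ξ⟩, fun b hb x => ?_⟩
  have bd : ∀ N ξ, ‖Real.exp (-b * ‖ξ‖ ^ 2) * F N ξ‖ ≤ Real.exp (-b * ‖ξ‖ ^ 2) * C := by
    intro N ξ
    rw [Real.norm_eq_abs, abs_of_nonneg (mul_nonneg (Real.exp_nonneg _) ((hF N).2.1 ξ))]
    exact mul_le_mul_of_nonneg_left (hC N ξ) (Real.exp_nonneg _)
  have t1 : Filter.Tendsto (fun N => ∫ ξ, Real.exp (-b * ‖ξ‖ ^ 2) * F N ξ) Filter.atTop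
      (nhds (∫ ξ, Real.exp (-b * ‖ξ‖ ^ 2) * f ξ)) := by
    refine tendsto_integral_of_dominated_convergence (fun ξ => Real.exp (-b * ‖ξ‖ ^ 2) * C)
      (fun N => ?_) ((gauss_int hb).mul_const C) (fun N => Filter.Eventually.of_forall (bd N))
      (Filter.Eventually.of_forall fun ξ => (hl ξ).const_mul _)
    have := (hF N).1
    exact Measurable.aestronglyMeasurable (by fun_prop)
  have t2 : Filter.Tendsto (fun N => ∫ ξ, Real.exp (-b * ‖ξ‖ ^ 2) * F N ξ *
      Real.cos (2 * Real.pi * ⟪x, ξ⟫)) Filter.atTop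
      (nhds (∫ ξ, Real.exp (-b * ‖ξ‖ ^ 2) * f ξ * Real.cos (2 * Real.pi * ⟪x, ξ⟫))) := by
    refine tendsto_integral_of_dominated_convergence (fun ξ => Real.exp (-b * ‖ξ‖ ^ 2) * C)
      (fun N => ?_) ((gauss_int hb).mul_const C)
      (fun N => Filter.Eventually.of_forall fun ξ => ?_)
      (Filter.Eventually.of_forall fun ξ => ((hl ξ).const_mul _).mul_const _)
    · have := (hF N).1
      exact Measurable.aestronglyMeasurable (by fun_prop)
    · rw [norm_mul]
      exact (mul_le_of_le_one_right (norm_nonneg _) (Real.abs_cos_le_one _)).trans (bd N ξ)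
  exact le_of_tendsto_of_tendsto' (t1.const_mul _) t2 fun N => (hF N).2.2.2 b hb x

/-- Laplace transform of a measure evaluated at `|ξ|²`. -/
def LL (n : ℕ) (ν : Measure ℝ) (ξ : EuclideanSpace ℝ (Fin n)) : ℝ :=
  ∫ u, Real.exp (-u * ‖ξ‖ ^ 2) ∂ν

lemma LL_meas (ν : Measure ℝ) [IsFiniteMeasure ν] : Measurable (LL n ν) := by
  have : StronglyMeasurable (LL n ν) := by
    refine StronglyMeasurable.integral_prod_right
      (f := fun (ξ : EuclideanSpace ℝ (Fin n)) (u : ℝ) => Real.exp (-u * ‖ξ‖ ^ 2)) ?_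
    refine Measurable.stronglyMeasurable ?_
    unfold Function.uncurry
    fun_prop
  exact this.measurable

lemma LL_nonneg (ν : Measure ℝ) (ξ) : 0 ≤ LL n ν ξ := integral_nonneg fun _ => Real.exp_nonneg _

lemma exp_integrable (ν : Measure ℝ) [IsFiniteMeasure ν] {r : ℝ} (hr : 0 ≤ r)
    (hν : ∀ᵐ u ∂ν, r ≤ u) (ξ : EuclideanSpace ℝ (Fin n)) :
    Integrable (fun u => Real.exp (-u * ‖ξ‖ ^ 2)) ν := by
  refine (integrable_const (1 : ℝ)).mono' (Measurable.aestronglyMeasurable (by fun_prop)) ?_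
  filter_upwards [hν] with u hu
  rw [Real.norm_eq_abs, abs_of_nonneg (Real.exp_nonneg _), Real.exp_le_one_iff]
  have : 0 ≤ u := hr.trans hu
  have := mul_nonneg this (sq_nonneg ‖ξ‖)
  linarith

lemma LL_le (ν : Measure ℝ) [IsFiniteMeasure ν] {r : ℝ} (hr : 0 ≤ r)
    (hν : ∀ᵐ u ∂ν, r ≤ u) (ξ) : LL n ν ξ ≤ ν.real univ := by
  have : LL n ν ξ ≤ ∫ u, (1 : ℝ) ∂ν := by
    refine integral_mono_ae (exp_integrable ν hr hν ξ) (integrable_const _) ?_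
    filter_upwards [hν] with u hu
    have : 0 ≤ u := hr.trans hu
    have := mul_nonneg this (sq_nonneg ‖ξ‖)
    simp only [Real.exp_le_one_iff]
    linarith
  simpa using this

lemma KK_mulL (ν : Measure ℝ) [IsFiniteMeasure ν] {r a : ℝ} (hr : 0 ≤ r) (ha : 0 ≤ a)
    (hν : ∀ᵐ u ∂ν, r ≤ u) {f : EuclideanSpace ℝ (Fin n) → ℝ} (hf : KK n a f) :
    KK n (a + r) (fun ξ => LL n ν ξ * f ξ) := by
  obtain ⟨f1, f2, ⟨C, f3⟩, f4⟩ := hf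
  refine ⟨(LL_meas ν).mul f1, fun ξ => mul_nonneg (LL_nonneg ν ξ) (f2 ξ), ⟨ν.real univ * C, fun ξ =>
    mul_le_mul (LL_le ν hr hν ξ) (f3 ξ) (f2 ξ) measureReal_nonneg⟩, fun b hb x => ?_⟩
  have i0 : Integrable (fun p : EuclideanSpace ℝ (Fin n) × ℝ =>
      Real.exp (-b * ‖p.1‖ ^ 2) * f p.1 * (1 : ℝ)) (volume.prod ν) :=
    (wint f1 f2 f3 hb).mul_prod (integrable_const (1 : ℝ))
  have hp : ∀ᵐ p ∂((volume : Measure (EuclideanSpace ℝ (Fin n))).prod ν), r ≤ p.2 :=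
    Measure.quasiMeasurePreserving_snd.ae hν
  have key : ∀ φ : EuclideanSpace ℝ (Fin n) → ℝ, Measurable φ → (∀ ξ, |φ ξ| ≤ 1) →
      (∫ ξ, Real.exp (-b * ‖ξ‖ ^ 2) * (LL n ν ξ * f ξ) * φ ξ
        = ∫ u, (∫ ξ, Real.exp (-(b + u) * ‖ξ‖ ^ 2) * f ξ * φ ξ) ∂ν) ∧
      Integrable (fun u => ∫ ξ, Real.exp (-(b + u) * ‖ξ‖ ^ 2) * f ξ * φ ξ) ν := by
    intro φ hφ hφ1
    have i1 : Integrable (Function.uncurry fun (ξ : EuclideanSpace ℝ (Fin n)) (u : ℝ) =>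
        Real.exp (-(b + u) * ‖ξ‖ ^ 2) * f ξ * φ ξ) (volume.prod ν) := by
      refine i0.mono' (Measurable.aestronglyMeasurable ?_) ?_
      · unfold Function.uncurry; fun_prop
      filter_upwards [hp] with p hu
      simp only [Function.uncurry, mul_one]
      rw [norm_mul, norm_mul, Real.norm_eq_abs, Real.norm_eq_abs, Real.norm_eq_abs,
        abs_of_nonneg (Real.exp_nonneg _), abs_of_nonneg (f2 _)]
      refine (mul_le_of_le_one_right (mul_nonneg (Real.exp_nonneg _) (f2 _)) (hφ1 _)).trans ?_
      refine mul_le_mul_of_nonneg_right (Real.exp_le_exp.2 ?_) (f2 _)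
      have : 0 ≤ p.2 := hr.trans hu
      have := mul_nonneg this (sq_nonneg ‖p.1‖)
      linarith
    refine ⟨?_, i1.integral_prod_right⟩
    rw [← integral_integral_swap i1]
    congr 1
    ext ξ
    have : ∀ u : ℝ, Real.exp (-(b + u) * ‖ξ‖ ^ 2) * f ξ * φ ξ
      = Real.exp (-u * ‖ξ‖ ^ 2) * (Real.exp (-b * ‖ξ‖ ^ 2) * f ξ * φ ξ) := by
      intro u
      rw [show -(b + u) * ‖ξ‖ ^ 2 = -u * ‖ξ‖ ^ 2 + -b * ‖ξ‖ ^ 2 by ring, Real.exp_add]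
      ring
    simp only [this, integral_mul_const]
    unfold LL
    ring
  obtain ⟨k1, k2⟩ := key (fun ξ => Real.cos (2 * Real.pi * ⟪x, ξ⟫)) (by fun_prop)
    (fun ξ => Real.abs_cos_le_one _)
  obtain ⟨k3, k4⟩ := key (fun _ => 1) measurable_const (by simp)
  simp only [mul_one] at k3 k4
  rw [k1, k3, ← integral_const_mul]
  refine integral_mono_ae (k4.const_mul _) k2 ?_
  filter_upwards [hν] with u hu
  refine le_trans ?_ (f4 (b + u) (by linarith) x)
  refine mul_le_mul_of_nonneg_right ?_
    (integral_nonneg fun ξ => mul_nonneg (Real.exp_nonneg _) (f2 ξ))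
  have : a + r + b ≤ a + (b + u) := by linarith
  gcongr

lemma KK_series (ν : Measure ℝ) [IsFiniteMeasure ν] {a : ℝ} (ha : 0 ≤ a)
    (hν : ∀ᵐ u ∂ν, 0 ≤ u) {f : EuclideanSpace ℝ (Fin n) → ℝ} (hf : KK n a f) (c : ℕ → ℝ)
    (G : ℝ → ℝ) (hc : ∀ k, 0 ≤ c k) (hc1 : ∀ k, c k ≤ 1 / (k.factorial : ℝ))
    (hG : ∀ y, HasSum (fun k => c k * y ^ k) (G y)) :
    KK n a (fun ξ => G (LL n ν ξ) * f ξ) := by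
  have hpow : ∀ k : ℕ, KK n a (fun ξ => LL n ν ξ ^ k * f ξ) := by
    intro k
    induction k with
    | zero => simpa using hf
    | succ k ih =>
      have := KK_mulL ν le_rfl ha hν ih
      rw [add_zero] at this
      refine (congrArg (KK n a) ?_).mp this
      ext ξ; ring
  obtain ⟨C, hC⟩ := hf.2.2.1
  have f2 := hf.2.1
  refine KK_lim (C := Real.exp (ν.real univ) * C)
    (F := fun N ξ => ∑ k ∈ Finset.range N, c k * (LL n ν ξ ^ k * f ξ))
    (fun N => KK_sum (fun k => KK_smul (hc k) (hpow k)) N) ?_ ?_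
  · intro N ξ
    simp only [← mul_assoc, ← Finset.sum_mul]
    refine mul_le_mul ?_ (hC ξ) (f2 ξ) (Real.exp_nonneg _)
    have hL := LL_le ν le_rfl hν ξ
    have hL0 := LL_nonneg ν ξ
    refine le_trans ?_ (Real.exp_le_exp.2 hL)
    refine le_trans (Finset.sum_le_sum fun k _ => ?_) (Real.sum_le_exp_of_nonneg hL0 N)
    have := mul_le_mul_of_nonneg_right (hc1 k) (pow_nonneg hL0 k)
    calc _ ≤ _ := this
      _ = _ := by ring
  · intro ξ
    simp only [← mul_assoc, ← Finset.sum_mul]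
    exact ((hG (LL n ν ξ)).tendsto_sum_nat).mul_const _

lemma exp_hasSum (y : ℝ) : HasSum (fun k : ℕ => 1 / (k.factorial : ℝ) * y ^ k) (Real.exp y) := by
  have h := NormedSpace.expSeries_div_hasSum_exp (𝔸 := ℝ) y
  rw [← Real.exp_eq_exp_ℝ] at h
  refine h.congr_fun ?_ |> fun h => h
  intro k; ring

lemma KK_exp (ν : Measure ℝ) [IsFiniteMeasure ν] {a : ℝ} (ha : 0 ≤ a)
    (hν : ∀ᵐ u ∂ν, 0 ≤ u) {f : EuclideanSpace ℝ (Fin n) → ℝ} (hf : KK n a f) :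
    KK n a (fun ξ => Real.exp (LL n ν ξ) * f ξ) :=
  KK_series ν ha hν hf (fun k => 1 / (k.factorial : ℝ)) Real.exp (fun k => by positivity)
    (fun k => le_rfl) exp_hasSum

lemma KK_exp_sub (ν : Measure ℝ) [IsFiniteMeasure ν] {a : ℝ} (ha : 0 ≤ a)
    (hν : ∀ᵐ u ∂ν, 0 ≤ u) {f : EuclideanSpace ℝ (Fin n) → ℝ} (hf : KK n a f) :
    KK n a (fun ξ => (Real.exp (LL n ν ξ) - LL n ν ξ) * f ξ) := by
  refine KK_series ν ha hν hf (fun k => if k = 1 then 0 else 1 / (k.factorial : ℝ))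
    (fun y => Real.exp y - y) (fun k => by split_ifs <;> positivity)
    (fun k => by split_ifs <;> [positivity; exact le_rfl]) ?_
  intro y
  have h := (exp_hasSum y).sub (hasSum_ite_eq 1 y)
  refine (congrArg (fun F => HasSum F (Real.exp y - y)) ?_).mp h
  ext k
  by_cases hk : k = 1
  · subst hk; simp
  · simp [hk]

lemma levy_base {s : ℝ} (hs : s ∈ Ioo (0 : ℝ) 1) :
    IntegrableOn (fun v : ℝ => (1 - Real.exp (-v)) * v ^ (-1 - s)) (Ioi 0) := by
  have hm : Measurable (fun v : ℝ => (1 - Real.exp (-v)) * v ^ (-1 - s)) := by fun_prop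
  rw [← Ioc_union_Ioi_eq_Ioi (zero_le_one' ℝ)]
  refine IntegrableOn.union ?_ ?_
  · have h : IntegrableOn (fun v : ℝ => v ^ (-s)) (Ioc 0 1) :=
      (intervalIntegrable_iff_integrableOn_Ioc_of_le zero_le_one).1
        (intervalIntegral.intervalIntegrable_rpow' (by linarith [hs.2]))
    refine Integrable.mono' h hm.aestronglyMeasurable ?_
    refine (ae_restrict_iff' measurableSet_Ioc).2 (Filter.Eventually.of_forall fun v hv => ?_)
    have h1 : 0 ≤ 1 - Real.exp (-v) := by
      have : Real.exp (-v) ≤ 1 := Real.exp_le_one_iff.2 (by linarith [hv.1])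
      linarith
    have h2 : 1 - Real.exp (-v) ≤ v := by linarith [Real.add_one_le_exp (-v)]
    rw [Real.norm_eq_abs, abs_of_nonneg (mul_nonneg h1 (Real.rpow_nonneg hv.1.le _))]
    calc _ ≤ v * v ^ (-1 - s) := mul_le_mul_of_nonneg_right h2 (Real.rpow_nonneg hv.1.le _)
      _ = v ^ (1 + (-1 - s)) := by rw [Real.rpow_add hv.1, Real.rpow_one]
      _ = v ^ (-s) := by congr 1; ring
  · refine Integrable.mono' (integrableOn_Ioi_rpow_of_lt (a := -1 - s) (by linarith [hs.1]) one_pos)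
      hm.aestronglyMeasurable ?_
    refine (ae_restrict_iff' measurableSet_Ioi).2 (Filter.Eventually.of_forall fun v hv => ?_)
    have hv0 : 0 < v := lt_trans one_pos hv
    have h1 : 0 ≤ 1 - Real.exp (-v) := by
      have : Real.exp (-v) ≤ 1 := Real.exp_le_one_iff.2 (by linarith)
      linarith
    have h2 : 1 - Real.exp (-v) ≤ 1 := by linarith [Real.exp_pos (-v)]
    rw [Real.norm_eq_abs, abs_of_nonneg (mul_nonneg h1 (Real.rpow_nonneg hv0.le _))]
    exact mul_le_of_le_one_left (Real.rpow_nonneg hv0.le _) h2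

lemma levy_const {s : ℝ} (hs : s ∈ Ioo (0 : ℝ) 1) : ∃ c : ℝ, 0 < c ∧ ∀ l : ℝ, 0 ≤ l →
    IntegrableOn (fun u : ℝ => (c * u ^ (-1 - s)) * (1 - Real.exp (-u * l))) (Ioi 0) ∧
    ∫ u in Ioi (0 : ℝ), (c * u ^ (-1 - s)) * (1 - Real.exp (-u * l)) = l ^ s := by
  have hb := levy_base hs
  set I := ∫ v in Ioi (0 : ℝ), (1 - Real.exp (-v)) * v ^ (-1 - s) with hI
  have hpos : ∀ v ∈ Ioi (0 : ℝ), 0 < (1 - Real.exp (-v)) * v ^ (-1 - s) := by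
    intro v hv
    have hv : 0 < v := hv
    have : Real.exp (-v) < 1 := by rw [Real.exp_lt_one_iff]; linarith
    exact mul_pos (by linarith) (Real.rpow_pos_of_pos hv _)
  have hIpos : 0 < I := by
    rw [hI, setIntegral_pos_iff_support_of_nonneg_ae _ hb]
    · have : Function.support (fun v : ℝ => (1 - Real.exp (-v)) * v ^ (-1 - s)) ∩ Ioi 0 = Ioi 0 :=
        inter_eq_right.2 fun v hv => (hpos v hv).ne'
      rw [this]; simp
    · exact (ae_restrict_iff' measurableSet_Ioi).2
        (Filter.Eventually.of_forall fun v hv => (hpos v hv).le)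
  refine ⟨I⁻¹, inv_pos.2 hIpos, fun l hl => ?_⟩
  rcases hl.eq_or_lt with rfl | hl
  · simp [Real.zero_rpow hs.1.ne']
  have e : ∀ u ∈ Ioi (0 : ℝ), (I⁻¹ * u ^ (-1 - s)) * (1 - Real.exp (-u * l))
      = (I⁻¹ * l ^ (1 + s)) * ((fun v : ℝ => (1 - Real.exp (-v)) * v ^ (-1 - s)) (l * u)) := by
    intro u hu
    have hu : 0 < u := hu
    simp only
    rw [Real.mul_rpow hl.le hu.le, show -u * l = -(l * u) by ring]
    have : l ^ (1 + s) * l ^ (-1 - s) = 1 := by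
      rw [← Real.rpow_add hl]; simp
    linear_combination (-(I⁻¹ * u ^ (-1 - s) * (1 - Real.exp (-(l * u))))) * this
  constructor
  · refine IntegrableOn.congr_fun (Integrable.const_mul ?_ _) (fun u hu => (e u hu).symm)
      measurableSet_Ioi
    have := (integrableOn_Ioi_comp_mul_left_iff
      (fun v : ℝ => (1 - Real.exp (-v)) * v ^ (-1 - s)) 0 hl).2 (by simpa using hb)
    exact this
  · have e3 := integral_comp_mul_left_Ioi
      (fun v : ℝ => (1 - Real.exp (-v)) * v ^ (-1 - s)) 0 hl
    rw [setIntegral_congr_fun measurableSet_Ioi e, integral_const_mul, e3, mul_zero, ← hI, smul_eq_mul, Real.rpow_add hl,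
      Real.rpow_one]
    field_simp

/-- The Lévy measure of the stable subordinator. -/
def nu0 (s κ : ℝ) : Measure ℝ :=
  (volume.restrict (Ioi 0)).withDensity (fun u => ENNReal.ofReal (κ * u ^ (-1 - s)))

lemma nu0_int {s κ : ℝ} (hκ : 0 ≤ κ) {A : Set ℝ} (hA : MeasurableSet A) (hA0 : A ⊆ Ioi 0)
    (φ : ℝ → ℝ) :
    ∫ u in A, φ u ∂(nu0 s κ) = ∫ u in A, (κ * u ^ (-1 - s)) * φ u := by
  unfold nu0
  rw [restrict_withDensity hA, Measure.restrict_restrict hA, inter_eq_left.2 hA0,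
    integral_withDensity_eq_integral_toReal_smul (by fun_prop) (by simp)]
  refine setIntegral_congr_fun hA fun u hu => ?_
  have : 0 < u := hA0 hu
  simp only [smul_eq_mul]
  rw [ENNReal.toReal_ofReal (by positivity)]

lemma nu0_integrable {s κ : ℝ} (hκ : 0 ≤ κ) {A : Set ℝ} (hA : MeasurableSet A) (hA0 : A ⊆ Ioi 0)
    (φ : ℝ → ℝ) (h : IntegrableOn (fun u => (κ * u ^ (-1 - s)) * φ u) A) :
    IntegrableOn φ A (nu0 s κ) := by
  unfold nu0 IntegrableOn
  rw [restrict_withDensity hA, Measure.restrict_restrict hA, inter_eq_left.2 hA0,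
    integrable_withDensity_iff (by fun_prop) (by simp)]
  refine IntegrableOn.congr_fun h (fun u hu => ?_) hA
  have : 0 < u := hA0 hu
  rw [ENNReal.toReal_ofReal (by positivity), mul_comm]

lemma nu0_fin {s κ : ℝ} (hs : 0 < s) (hκ : 0 ≤ κ) {ε : ℝ} (hε : 0 < ε) {A : Set ℝ}
    (hA : MeasurableSet A) (hA0 : A ⊆ Ici ε) :
    IsFiniteMeasure ((nu0 s κ).restrict A) := by
  have hsub : A ⊆ Ioi 0 := fun u hu => lt_of_lt_of_le hε (hA0 hu)
  have h : IntegrableOn (fun _ => (1 : ℝ)) A (nu0 s κ) := by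
    refine nu0_integrable hκ hA hsub _ ?_
    simp only [mul_one]
    refine Integrable.const_mul ?_ _
    exact ((integrableOn_Ici_iff_integrableOn_Ioi).2
      (integrableOn_Ioi_rpow_of_lt (a := -1 - s) (by linarith) hε)).mono_set hA0
  have := (integrable_const_iff (μ := (nu0 s κ).restrict A) (c := (1 : ℝ))).1 h
  simpa using this

lemma nu0_ae {s κ : ℝ} {r : ℝ} {A : Set ℝ} (hA : MeasurableSet A) (hA0 : A ⊆ Ici r) :
    ∀ᵐ u ∂((nu0 s κ).restrict A), r ≤ u :=
  (ae_restrict_iff' hA).2 (Filter.Eventually.of_forall fun _ hu => hA0 hu)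

lemma nu0_B {s κ R : ℝ} (hs : 0 < s) (hκ : 0 ≤ κ) (hR : 1 ≤ R) :
    ((nu0 s κ).restrict (Icc R (2 * R))).real univ ≤ κ ∧
    κ * (2 : ℝ) ^ (-1 - s) * R ^ (-s) ≤ ((nu0 s κ).restrict (Icc R (2 * R))).real univ := by
  have hR0 : 0 < R := by linarith
  have hsub : Icc R (2 * R) ⊆ Ioi 0 := fun u hu => lt_of_lt_of_le hR0 hu.1
  have hfin := nu0_fin (A := Icc R (2 * R)) hs hκ hR0 measurableSet_Icc (fun u hu => hu.1)
  have e : ((nu0 s κ).restrict (Icc R (2 * R))).real univ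
      = ∫ u in Icc R (2 * R), (κ * u ^ (-1 - s)) := by
    have := nu0_int (s := s) hκ measurableSet_Icc hsub (fun _ => (1 : ℝ))
    simp only [integral_const, smul_eq_mul, mul_one] at this
    exact this
  have hvol : volume.real (Icc R (2 * R)) = R := by
    rw [Real.volume_real_Icc_of_le (by linarith)]; ring
  have hitg : IntegrableOn (fun u : ℝ => κ * u ^ (-1 - s)) (Icc R (2 * R)) := by
    refine Integrable.const_mul ?_ _
    exact ((integrableOn_Ici_iff_integrableOn_Ioi).2
      (integrableOn_Ioi_rpow_of_lt (a := -1 - s) (by linarith) hR0)).mono_set fun u hu => hu.1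
  have hc : ∀ C : ℝ, IntegrableOn (fun _ : ℝ => C) (Icc R (2 * R)) := fun C =>
    integrableOn_const (by simp)
  have hRR : R * R ^ (-1 - s) = R ^ (-s) := by
    rw [← Real.rpow_one_add' hR0.le (by linarith)]; congr 1; ring
  rw [e]
  constructor
  · have : ∫ u in Icc R (2 * R), (κ * u ^ (-1 - s)) ≤ ∫ u in Icc R (2 * R), κ * R ^ (-1 - s) := by
      refine setIntegral_mono_on hitg (hc _) measurableSet_Icc fun u hu => ?_
      exact mul_le_mul_of_nonneg_left
        (Real.rpow_le_rpow_of_nonpos hR0 hu.1 (by linarith)) hκ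
    refine this.trans ?_
    rw [setIntegral_const, hvol, smul_eq_mul]
    have : R ^ (-s) ≤ 1 := Real.rpow_le_one_of_one_le_of_nonpos hR (by linarith)
    calc _ = κ * (R * R ^ (-1 - s)) := by ring
      _ = κ * R ^ (-s) := by rw [hRR]
      _ ≤ κ * 1 := mul_le_mul_of_nonneg_left this hκ
      _ = κ := mul_one _
  · have : ∫ u in Icc R (2 * R), κ * (2 * R) ^ (-1 - s) ≤ ∫ u in Icc R (2 * R), (κ * u ^ (-1 - s)) := by
      refine setIntegral_mono_on (hc _) hitg measurableSet_Icc fun u hu => ?_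
      exact mul_le_mul_of_nonneg_left
        (Real.rpow_le_rpow_of_nonpos (by linarith [hu.1]) hu.2 (by linarith)) hκ
    refine le_trans (le_of_eq ?_) this
    rw [setIntegral_const, hvol, smul_eq_mul, Real.mul_rpow (by norm_num) hR0.le, ← hRR]
    ring

/-- The stable multiplier `e^{-t|ξ|^{2s}}`. -/
def stab (n : ℕ) (s t : ℝ) (ξ : EuclideanSpace ℝ (Fin n)) : ℝ := Real.exp (-t * ‖ξ‖ ^ (2 * s))

lemma KK_g {s t R c : ℝ} (hs : s ∈ Ioo (0 : ℝ) 1) (ht : 0 < t) (hR : 1 ≤ R) (hc : 0 < c)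
    (hc2 : ∀ l : ℝ, 0 ≤ l →
    IntegrableOn (fun u : ℝ => (c * u ^ (-1 - s)) * (1 - Real.exp (-u * l))) (Ioi 0) ∧
    ∫ u in Ioi (0 : ℝ), (c * u ^ (-1 - s)) * (1 - Real.exp (-u * l)) = l ^ s) :
    KK n 0 (fun ξ => stab n s t ξ *
      Real.exp (-LL n ((nu0 s (t * c)).restrict (Icc R (2 * R))) ξ)) := by
  have hR0 : 0 < R := by linarith
  set κ := t * c with hκd
  have hκ : 0 ≤ κ := by positivity
  set B := Icc R (2 * R) with hB
  have hBsub : B ⊆ Ioi 0 := fun u hu => lt_of_lt_of_le hR0 hu.1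
  have hBm : MeasurableSet B := measurableSet_Icc
  have hBf : IsFiniteMeasure ((nu0 s κ).restrict B) :=
    nu0_fin hs.1 hκ hR0 hBm (fun u hu => hu.1)
  set D := ((nu0 s κ).restrict B).real univ with hD
  let A : ℕ → Set ℝ := fun N => Ici (1 / ((N : ℝ) + 1)) \ B
  have hεp : ∀ N : ℕ, 0 < 1 / ((N : ℝ) + 1) := fun N => by positivity
  have hAm : ∀ N, MeasurableSet (A N) := fun N => measurableSet_Ici.diff hBm
  have hAs : ∀ N, A N ⊆ Ici (1 / ((N : ℝ) + 1)) := fun N => sdiff_subset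
  have hAs0 : ∀ N, A N ⊆ Ioi 0 := fun N u hu => lt_of_lt_of_le (hεp N) (hAs N hu)
  have hAf : ∀ N, IsFiniteMeasure ((nu0 s κ).restrict (A N)) := fun N =>
    nu0_fin hs.1 hκ (hεp N) (hAm N) (hAs N)
  have hAe : ∀ N, ∀ᵐ u ∂((nu0 s κ).restrict (A N)), 0 ≤ u := fun N =>
    nu0_ae (hAm N) fun u hu => le_of_lt (mem_Ioi.1 (hAs0 N hu))
  have hBe : ∀ᵐ u ∂((nu0 s κ).restrict B), 0 ≤ u := nu0_ae hBm fun u hu => le_of_lt (mem_Ioi.1 (hBsub hu))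
  refine KK_lim (C := 1) (F := fun N ξ => Real.exp (-D - ((nu0 s κ).restrict (A N)).real univ) *
    (Real.exp (LL n ((nu0 s κ).restrict (A N)) ξ) * 1)) ?_ ?_ ?_
  · intro N
    exact KK_smul (Real.exp_nonneg _) (KK_exp _ le_rfl (hAe N) KK_one)
  · intro N ξ
    rw [mul_one, ← Real.exp_add, Real.exp_le_one_iff]
    have h1 := LL_le (n := n) ((nu0 s κ).restrict (A N)) le_rfl (hAe N) ξ
    have h2 : 0 ≤ D := measureReal_nonneg
    linarith
  · intro ξ
    simp only [mul_one, ← Real.exp_add, stab]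
    refine (Real.continuous_exp.tendsto _).comp ?_
    obtain ⟨i0, i1⟩ := hc2 (‖ξ‖ ^ 2) (by positivity)
    have i0' : IntegrableOn (fun u : ℝ => (κ * u ^ (-1 - s)) * (1 - Real.exp (-u * ‖ξ‖ ^ 2)))
        (Ioi 0) := by
      refine (Integrable.const_mul i0 t).congr (Filter.Eventually.of_forall fun u => ?_)
      simp only [hκd]; ring
    have j0 : IntegrableOn (fun u : ℝ => 1 - Real.exp (-u * ‖ξ‖ ^ 2)) (Ioi 0) (nu0 s κ) :=
      nu0_integrable hκ measurableSet_Ioi subset_rfl _ i0'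
    have j1 : ∫ u in Ioi 0, (1 - Real.exp (-u * ‖ξ‖ ^ 2)) ∂(nu0 s κ) = t * ‖ξ‖ ^ (2 * s) := by
      rw [nu0_int hκ measurableSet_Ioi subset_rfl]
      have : ∀ u : ℝ, (κ * u ^ (-1 - s)) * (1 - Real.exp (-u * ‖ξ‖ ^ 2))
        = t * ((c * u ^ (-1 - s)) * (1 - Real.exp (-u * ‖ξ‖ ^ 2))) := fun u => by
          rw [hκd]; ring
      simp only [this]
      rw [integral_const_mul, i1, Real.rpow_mul (norm_nonneg ξ), Real.rpow_two]
    have hU : ⋃ N, A N = Ioi 0 \ B := by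
      ext u
      simp only [A, mem_iUnion, mem_sdiff, mem_Ici, mem_Ioi, exists_and_right]
      refine and_congr_left fun _ => ⟨?_, fun hu => ?_⟩
      · rintro ⟨N, hN⟩
        exact lt_of_lt_of_le (hεp N) hN
      · obtain ⟨N, hN⟩ := exists_nat_one_div_lt hu
        exact ⟨N, hN.le⟩
    have hmono : Monotone A := by
      intro N M h
      refine sdiff_subset_sdiff_left (Ici_subset_Ici.2 ?_)
      exact Nat.one_div_le_one_div h
    have tt := tendsto_setIntegral_of_monotone (μ := nu0 s κ)
      (f := fun u : ℝ => 1 - Real.exp (-u * ‖ξ‖ ^ 2)) hAm hmono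
      (j0.mono_set (by rw [hU]; exact sdiff_subset))
    rw [hU, setIntegral_sdiff hBm j0 hBsub, j1] at tt
    have eL : ∀ S : Set ℝ, IsFiniteMeasure ((nu0 s κ).restrict S) →
        (∀ᵐ u ∂((nu0 s κ).restrict S), 0 ≤ u) →
        ∫ u in S, (1 - Real.exp (-u * ‖ξ‖ ^ 2)) ∂(nu0 s κ)
          = ((nu0 s κ).restrict S).real univ - LL n ((nu0 s κ).restrict S) ξ := by
      intro S hS hS0
      rw [integral_sub (integrable_const _) (exp_integrable _ le_rfl hS0 ξ)]
      simp [LL]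
    rw [eL B hBf hBe, ← hD] at tt
    have tt2 := (tt.neg).const_add (-D)
    refine (congrArg₂ (fun F l => Filter.Tendsto F Filter.atTop (nhds l)) ?_ ?_).mp tt2
    · ext N
      rw [eL (A N) (hAf N) (hAe N)]
      ring
    · ring

lemma KK_heat {s t R c : ℝ} (hs : s ∈ Ioo (0 : ℝ) 1) (ht : 0 < t) (hR : 1 ≤ R) (hc : 0 < c)
    (hc2 : ∀ l : ℝ, 0 ≤ l →
    IntegrableOn (fun u : ℝ => (c * u ^ (-1 - s)) * (1 - Real.exp (-u * l))) (Ioi 0) ∧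
    ∫ u in Ioi (0 : ℝ), (c * u ^ (-1 - s)) * (1 - Real.exp (-u * l)) = l ^ s) :
    KK n 0 (stab n s t) ∧
    ∃ h : EuclideanSpace ℝ (Fin n) → ℝ, KK n R h ∧ KK n 0 (fun ξ => stab n s t ξ - h ξ) ∧
      ∀ ξ, stab n s t ξ * Real.exp (-(t * c)) * (t * c * (2 : ℝ) ^ (-1 - s) * R ^ (-s)) *
        Real.exp (-(2 * R) * ‖ξ‖ ^ 2) ≤ h ξ := by
  have hR0 : 0 < R := by linarith
  have hg := KK_g (n := n) hs ht hR hc hc2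
  set κ := t * c with hκd
  have hκ : 0 ≤ κ := by positivity
  have hb := nu0_B (s := s) (κ := κ) hs.1 hκ hR
  have hBf : IsFiniteMeasure ((nu0 s κ).restrict (Icc R (2 * R))) :=
    nu0_fin hs.1 hκ hR0 measurableSet_Icc (fun u hu => hu.1)
  have hBe : ∀ᵐ u ∂((nu0 s κ).restrict (Icc R (2 * R))), R ≤ u :=
    nu0_ae measurableSet_Icc fun u hu => hu.1
  have hBe0 : ∀ᵐ u ∂((nu0 s κ).restrict (Icc R (2 * R))), 0 ≤ u := by
    filter_upwards [hBe] with u hu; linarith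
  have hBe2 : ∀ᵐ u ∂((nu0 s κ).restrict (Icc R (2 * R))), u ≤ 2 * R :=
    (ae_restrict_iff' measurableSet_Icc).2 (Filter.Eventually.of_forall fun _ hu => hu.2)
  set μ := (nu0 s κ).restrict (Icc R (2 * R)) with hμ
  have hid : ∀ ξ, Real.exp (LL n μ ξ) * (stab n s t ξ * Real.exp (-LL n μ ξ)) = stab n s t ξ := by
    intro ξ
    rw [Real.exp_neg]
    field_simp
  refine ⟨?_, fun ξ => LL n μ ξ * (stab n s t ξ * Real.exp (-LL n μ ξ)), ?_, ?_, ?_⟩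
  · have := KK_exp μ le_rfl hBe0 hg
    simp only [hid] at this
    exact this
  · have := KK_mulL μ hR0.le le_rfl hBe hg
    rwa [zero_add] at this
  · have := KK_exp_sub μ le_rfl hBe0 hg
    simp only [sub_mul, hid] at this
    exact this
  · intro ξ
    have h1 := LL_le (n := n) μ le_rfl hBe0 ξ
    have h2 : Real.exp (-(2 * R) * ‖ξ‖ ^ 2) * μ.real univ ≤ LL n μ ξ := by
      have : ∫ u, Real.exp (-(2 * R) * ‖ξ‖ ^ 2) ∂μ ≤ LL n μ ξ := by
        refine integral_mono_ae (integrable_const _) (exp_integrable μ le_rfl hBe0 ξ) ?_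
        filter_upwards [hBe2] with u hu
        have := mul_le_mul_of_nonneg_right hu (sq_nonneg ‖ξ‖)
        exact Real.exp_le_exp.2 (by linarith)
      refine le_trans (le_of_eq ?_) this
      simp [mul_comm]
    have h3 : Real.exp (-κ) ≤ Real.exp (-LL n μ ξ) := Real.exp_le_exp.2 (by linarith [hb.1])
    have h4 : Real.exp (-(2 * R) * ‖ξ‖ ^ 2) * (κ * (2 : ℝ) ^ (-1 - s) * R ^ (-s)) ≤ LL n μ ξ :=
      le_trans (mul_le_mul_of_nonneg_left hb.2 (Real.exp_nonneg _)) h2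
    have h5 : 0 ≤ stab n s t ξ := Real.exp_nonneg _
    calc _ = (Real.exp (-(2 * R) * ‖ξ‖ ^ 2) * (κ * (2 : ℝ) ^ (-1 - s) * R ^ (-s))) *
          (stab n s t ξ * Real.exp (-κ)) := by ring
      _ ≤ LL n μ ξ * (stab n s t ξ * Real.exp (-LL n μ ξ)) :=
        mul_le_mul h4 (mul_le_mul_of_nonneg_left h3 h5) (mul_nonneg h5 (Real.exp_nonneg _))
          (LL_nonneg _ _)

lemma heat_eq {s t : ℝ} (ht : 0 < t) (x : EuclideanSpace ℝ (Fin n)) :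
    mixedHeatKernel n s x t
      = ∫ ξ, Real.exp (-t * ‖ξ‖ ^ 2) * stab n s t ξ * Real.cos (2 * Real.pi * ⟪x, ξ⟫) := by
  have e : ∀ ξ : EuclideanSpace ℝ (Fin n),
      (Complex.exp (-(t : ℂ) * ((‖ξ‖ ^ 2 + ‖ξ‖ ^ (2 * s) : ℝ) : ℂ)
      + 2 * (Real.pi : ℂ) * Complex.I * ((⟪x, ξ⟫ : ℝ) : ℂ)))
      = ((Real.exp (-t * ‖ξ‖ ^ 2) * stab n s t ξ : ℝ) : ℂ) *
        Complex.exp (((2 * Real.pi * ⟪x, ξ⟫ : ℝ) : ℂ) * Complex.I) := by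
    intro ξ
    rw [stab, ← Real.exp_add, Complex.ofReal_exp, ← Complex.exp_add]
    congr 1
    push_cast
    ring
  have hst : Measurable (stab n s t) := by unfold stab; fun_prop
  have h1 : ∀ ξ, stab n s t ξ ≤ 1 := fun ξ => by
    unfold stab
    rw [Real.exp_le_one_iff]
    have := mul_nonneg ht.le (Real.rpow_nonneg (norm_nonneg ξ) (2 * s))
    linarith
  have hi := wint hst (fun ξ => Real.exp_nonneg _) h1 ht
  unfold mixedHeatKernel
  simp only [e]
  have hitg : Integrable (fun ξ : EuclideanSpace ℝ (Fin n) =>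
      ((Real.exp (-t * ‖ξ‖ ^ 2) * stab n s t ξ : ℝ) : ℂ) *
        Complex.exp (((2 * Real.pi * ⟪x, ξ⟫ : ℝ) : ℂ) * Complex.I)) := by
    refine hi.norm.mono' (Measurable.aestronglyMeasurable (by fun_prop))
      (Filter.Eventually.of_forall fun ξ => ?_)
    rw [norm_mul, Complex.norm_exp_ofReal_mul_I, mul_one, Complex.norm_real]
  have h3 := (integral_re hitg).symm
  refine h3.trans (integral_congr_ae (Filter.Eventually.of_forall fun ξ => ?_))
  simp only [RCLike.re_eq_complex_re]
  rw [Complex.re_ofReal_mul, Complex.exp_ofReal_mul_I_re]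

lemma heat_nonneg {s t : ℝ} (hs : s ∈ Ioo (0 : ℝ) 1) (ht : 0 < t) (x : EuclideanSpace ℝ (Fin n)) :
    0 ≤ mixedHeatKernel n s x t := by
  obtain ⟨c, hc, hc2⟩ := levy_const hs
  obtain ⟨h, _⟩ := KK_heat (n := n) hs ht le_rfl hc hc2
  rw [heat_eq ht]
  refine le_trans ?_ (h.2.2.2 t ht x)
  exact mul_nonneg (Real.exp_nonneg _) (integral_nonneg fun ξ =>
    mul_nonneg (Real.exp_nonneg _) (h.2.1 ξ))

lemma heat_lower (n : ℕ) {s : ℝ} (hs : s ∈ Ioo (0 : ℝ) 1) : ∃ k : ℝ, 0 < k ∧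
    ∀ (R : ℝ) (x : EuclideanSpace ℝ (Fin n)) (t : ℝ), 1 ≤ R → ‖x‖ ^ 2 ≤ R → t ∈ Ioc (1 : ℝ) 2 →
      k * R ^ (-((n : ℝ) / 2 + s)) ≤ mixedHeatKernel n s x t := by
  obtain ⟨c, hc, hc2⟩ := levy_const hs
  refine ⟨Real.exp (-Real.pi ^ 2) * (Real.exp (-(2 * c)) * (c * (2 : ℝ) ^ (-1 - s)) *
    Real.exp (-2) * (Real.pi / 6) ^ ((n : ℝ) / 2)), by positivity, fun R x t hR hx ht => ?_⟩
  have hR0 : 0 < R := by linarith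
  have ht0 : 0 < t := by linarith [ht.1]
  obtain ⟨k0, h, k1, k2, k3⟩ := KK_heat (n := n) hs ht0 hR hc hc2
  obtain ⟨C0, hC0⟩ := k0.2.2.1
  obtain ⟨C1, hC1⟩ := k1.2.2.1
  obtain ⟨C2, hC2⟩ := k2.2.2.1
  have ih := wint k1.1 k1.2.1 hC1 ht0
  have i2 := wint k2.1 k2.2.1 hC2 ht0
  have s1 : ∫ ξ, Real.exp (-t * ‖ξ‖ ^ 2) * h ξ * Real.cos (2 * Real.pi * ⟪x, ξ⟫)
      ≤ mixedHeatKernel n s x t := by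
    rw [heat_eq ht0]
    have e : ∀ ξ, Real.exp (-t * ‖ξ‖ ^ 2) * stab n s t ξ * Real.cos (2 * Real.pi * ⟪x, ξ⟫)
      = Real.exp (-t * ‖ξ‖ ^ 2) * h ξ * Real.cos (2 * Real.pi * ⟪x, ξ⟫) +
        Real.exp (-t * ‖ξ‖ ^ 2) * (stab n s t ξ - h ξ) * Real.cos (2 * Real.pi * ⟪x, ξ⟫) :=
      fun ξ => by ring
    simp only [e]
    rw [integral_add (wintcos ih x) (wintcos i2 x)]
    have := k2.2.2.2 t ht0 x
    have h0 : 0 ≤ ∫ ξ, Real.exp (-t * ‖ξ‖ ^ 2) * (stab n s t ξ - h ξ) :=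
      integral_nonneg fun ξ => mul_nonneg (Real.exp_nonneg _) (k2.2.1 ξ)
    have := le_trans (mul_nonneg (Real.exp_nonneg _) h0) this
    linarith
  refine le_trans ?_ s1
  refine le_trans ?_ (k1.2.2.2 t ht0 x)
  rw [mul_assoc]
  have hexp : Real.exp (-Real.pi ^ 2) ≤ Real.exp (-(Real.pi ^ 2 * ‖x‖ ^ 2 / (R + t))) := by
    refine Real.exp_le_exp.2 (neg_le_neg ?_)
    rw [div_le_iff₀ (by linarith)]
    exact mul_le_mul_of_nonneg_left (by linarith) (by positivity)
  refine mul_le_mul hexp ?_ (by positivity) (Real.exp_nonneg _)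
  have hgau : ∫ ξ : EuclideanSpace ℝ (Fin n), Real.exp (-(6 * R) * ‖ξ‖ ^ 2)
      = (Real.pi / 6) ^ ((n : ℝ) / 2) * R ^ (-((n : ℝ) / 2)) := by
    rw [GaussianFourier.integral_rexp_neg_mul_sq_norm (by positivity), finrank_euclideanSpace_fin,
      Real.rpow_neg hR0.le, ← div_div, Real.div_rpow (by positivity) hR0.le, div_eq_mul_inv]
  have e2 : Real.exp (-(2 * c)) * (c * (2 : ℝ) ^ (-1 - s)) *
    Real.exp (-2) * (Real.pi / 6) ^ ((n : ℝ) / 2) * R ^ (-((n : ℝ) / 2 + s))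
    = ∫ ξ : EuclideanSpace ℝ (Fin n), (Real.exp (-(2 * c)) * (c * (2 : ℝ) ^ (-1 - s)) *
    Real.exp (-2) * R ^ (-s)) * Real.exp (-(6 * R) * ‖ξ‖ ^ 2) := by
    rw [integral_const_mul, hgau, neg_add, Real.rpow_add hR0]
    ring
  rw [e2]
  refine integral_mono ((gauss_int (by positivity)).const_mul _) ih fun ξ => ?_
  have hst : Real.exp (-2) * Real.exp (-(6 * R) * ‖ξ‖ ^ 2) ≤
      Real.exp (-t * ‖ξ‖ ^ 2) * stab n s t ξ * Real.exp (-(2 * R) * ‖ξ‖ ^ 2) := by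
    unfold stab
    rw [← Real.exp_add, ← Real.exp_add, ← Real.exp_add]
    refine Real.exp_le_exp.2 ?_
    have h1 : ‖ξ‖ ^ (2 * s) ≤ 1 + ‖ξ‖ ^ 2 := by
      rcases le_total ‖ξ‖ 1 with h | h
      · have := Real.rpow_le_one (norm_nonneg ξ) h (by linarith [hs.1] : 0 ≤ 2 * s)
        nlinarith [sq_nonneg ‖ξ‖]
      · have := Real.rpow_le_rpow_of_exponent_le h (by linarith [hs.2] : 2 * s ≤ 2)
        rw [Real.rpow_two] at this
        linarith
    have h2 : t * ‖ξ‖ ^ (2 * s) ≤ 2 * (1 + ‖ξ‖ ^ 2) :=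
      mul_le_mul ht.2 h1 (Real.rpow_nonneg (norm_nonneg _) _) (by norm_num)
    have h3 : t * ‖ξ‖ ^ 2 ≤ 2 * ‖ξ‖ ^ 2 := mul_le_mul_of_nonneg_right ht.2 (sq_nonneg _)
    have h4 : ‖ξ‖ ^ 2 ≤ R * ‖ξ‖ ^ 2 := le_mul_of_one_le_left (sq_nonneg _) hR
    linarith
  have hcc : Real.exp (-(2 * c)) * (c * (2 : ℝ) ^ (-1 - s)) ≤
      Real.exp (-(t * c)) * (t * c * (2 : ℝ) ^ (-1 - s)) := by
    have h1 : t * c ≤ 2 * c := mul_le_mul_of_nonneg_right ht.2 hc.le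
    have h2 : c ≤ t * c := le_mul_of_one_le_left hc.le ht.1.le
    gcongr
  calc _ = (Real.exp (-(2 * c)) * (c * (2 : ℝ) ^ (-1 - s))) * R ^ (-s) *
        (Real.exp (-2) * Real.exp (-(6 * R) * ‖ξ‖ ^ 2)) := by ring
    _ ≤ (Real.exp (-(t * c)) * (t * c * (2 : ℝ) ^ (-1 - s))) * R ^ (-s) *
        (Real.exp (-t * ‖ξ‖ ^ 2) * stab n s t ξ * Real.exp (-(2 * R) * ‖ξ‖ ^ 2)) := by gcongr
    _ = Real.exp (-t * ‖ξ‖ ^ 2) * (stab n s t ξ * Real.exp (-(t * c)) *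
        (t * c * (2 : ℝ) ^ (-1 - s) * R ^ (-s)) * Real.exp (-(2 * R) * ‖ξ‖ ^ 2)) := by ring
    _ ≤ _ := mul_le_mul_of_nonneg_left (k3 ξ) (Real.exp_nonneg _)

lemma heat_meas (n : ℕ) (s : ℝ) :
    Measurable (fun p : EuclideanSpace ℝ (Fin n) × ℝ => mixedHeatKernel n s p.1 p.2) := by
  unfold mixedHeatKernel
  refine Complex.measurable_re.comp ?_
  refine StronglyMeasurable.measurable ?_
  refine StronglyMeasurable.integral_prod_right (f := fun (p : EuclideanSpace ℝ (Fin n) × ℝ)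
    (ξ : EuclideanSpace ℝ (Fin n)) => Complex.exp (-(p.2 : ℂ) * ((‖ξ‖ ^ 2 + ‖ξ‖ ^ (2 * s) : ℝ) : ℂ)
      + 2 * (Real.pi : ℂ) * Complex.I * ((⟪p.1, ξ⟫ : ℝ) : ℂ))) ?_
  refine Measurable.stronglyMeasurable ?_
  unfold Function.uncurry
  fun_prop

/-- The weight (Fourier transform of `e^{-|z|²}`). -/
def ww (n : ℕ) (ξ : EuclideanSpace ℝ (Fin n)) : ℝ :=
  Real.pi ^ ((n : ℝ) / 2) * Real.exp (-Real.pi ^ 2 * ‖ξ‖ ^ 2)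

/-- The multiplier. -/
def mm (n : ℕ) (s t : ℝ) (ξ : EuclideanSpace ℝ (Fin n)) : ℝ :=
  Real.exp (-t * ‖ξ‖ ^ 2) * stab n s t ξ

lemma mm_meas (n : ℕ) (s t : ℝ) : Measurable (mm n s t) := by
  unfold mm stab; fun_prop

lemma ww_meas (n : ℕ) : Measurable (ww n) := by
  unfold ww; fun_prop

lemma mm_int {s t : ℝ} (ht : 0 < t) : Integrable (mm n s t) := by
  have hst : Measurable (stab n s t) := by unfold stab; fun_prop
  have h1 : ∀ ξ, stab n s t ξ ≤ 1 := fun ξ => by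
    unfold stab
    rw [Real.exp_le_one_iff]
    have := mul_nonneg ht.le (Real.rpow_nonneg (norm_nonneg ξ) (2 * s))
    linarith
  exact wint hst (fun ξ => Real.exp_nonneg _) h1 ht

lemma conv_eq {s t : ℝ} (ht : 0 < t) (x : EuclideanSpace ℝ (Fin n)) :
    Integrable (fun z : EuclideanSpace ℝ (Fin n) =>
      Real.exp (-1 * ‖z‖ ^ 2) * mixedHeatKernel n s (x - z) t) ∧
    ∫ z : EuclideanSpace ℝ (Fin n), Real.exp (-1 * ‖z‖ ^ 2) * mixedHeatKernel n s (x - z) t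
      = ∫ ξ, ww n ξ * mm n s t ξ * Real.cos (2 * Real.pi * ⟪x, ξ⟫) := by
  have hi := mm_int (n := n) (s := s) ht
  have hmm := mm_meas n s t
  have i0 := (gauss_int (n := n) one_pos).mul_prod hi
  have i1 : Integrable (Function.uncurry fun (z ξ : EuclideanSpace ℝ (Fin n)) =>
      Real.exp (-1 * ‖z‖ ^ 2) * (mm n s t ξ * Real.cos (2 * Real.pi * ⟪x - z, ξ⟫)))
      (volume.prod volume) := by
    refine i0.norm.mono' (Measurable.aestronglyMeasurable ?_)
      (Filter.Eventually.of_forall fun p => ?_)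
    · unfold Function.uncurry; fun_prop
    · simp only [Function.uncurry]
      rw [← mul_assoc, norm_mul]
      exact mul_le_of_le_one_right (norm_nonneg _) (Real.abs_cos_le_one _)
  have e : ∀ z : EuclideanSpace ℝ (Fin n),
      Real.exp (-1 * ‖z‖ ^ 2) * mixedHeatKernel n s (x - z) t
      = ∫ ξ, Real.exp (-1 * ‖z‖ ^ 2) * (mm n s t ξ * Real.cos (2 * Real.pi * ⟪x - z, ξ⟫)) := by
    intro z
    rw [integral_const_mul, heat_eq ht]
    rfl
  simp only [e]
  refine ⟨i1.integral_prod_left, ?_⟩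
  rw [integral_integral_swap i1]
  congr 1
  ext ξ
  have e2 : ∀ z : EuclideanSpace ℝ (Fin n),
      Real.exp (-1 * ‖z‖ ^ 2) * (mm n s t ξ * Real.cos (2 * Real.pi * ⟪x - z, ξ⟫))
      = mm n s t ξ * (Real.exp (-1 * ‖z‖ ^ 2) *
        Real.cos (2 * Real.pi * ⟪x, ξ⟫ + 2 * Real.pi * ⟪-ξ, z⟫)) := by
    intro z
    rw [inner_sub_left, inner_neg_left, real_inner_comm ξ z]
    rw [show 2 * Real.pi * ((⟪x, ξ⟫ : ℝ) - ⟪ξ, z⟫)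
      = 2 * Real.pi * ⟪x, ξ⟫ + 2 * Real.pi * -⟪ξ, z⟫ by ring]
    ring
  simp only [e2]
  rw [integral_const_mul, gauss_cos one_pos]
  simp only [ww, div_one, norm_neg, neg_mul]
  ring

lemma joint_int {s : ℝ} (hs : s ∈ Ioo (0 : ℝ) 1) (hns : 4 * s < (n : ℝ)) :
    Integrable (Function.uncurry fun (t : ℝ) (ξ : EuclideanSpace ℝ (Fin n)) =>
      ww n ξ * mm n s t ξ) ((volume.restrict (Ioi 0)).prod volume) := by
  have hn : 0 < n := by
    rcases Nat.eq_zero_or_pos n with h | h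
    · subst h; simp at hns; linarith [hs.1]
    · exact h
  have : Nonempty (Fin n) := ⟨⟨0, hn⟩⟩
  have hq : Integrable (fun ξ : EuclideanSpace ℝ (Fin n) => ww n ξ * (‖ξ‖ ^ (2 * s))⁻¹) := by
    have := (integrable_fun_norm_addHaar (volume : Measure (EuclideanSpace ℝ (Fin n)))
      (f := fun r : ℝ => Real.exp (-Real.pi ^ 2 * r ^ 2) * (r ^ (2 * s))⁻¹)).2 ?_
    · refine (this.const_mul (Real.pi ^ ((n : ℝ) / 2))).congr
        (Filter.Eventually.of_forall fun ξ => ?_)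
      simp only [ww]; ring
    · have h := integrableOn_rpow_mul_exp_neg_mul_rpow (p := 2) (s := (n : ℝ) - 1 - 2 * s)
        (b := Real.pi ^ 2) (by linarith [hs.1]) two_pos (by positivity)
      refine IntegrableOn.congr_fun h (fun r hr => ?_) measurableSet_Ioi
      have hr : 0 < r := hr
      simp only [finrank_euclideanSpace_fin, smul_eq_mul]
      rw [Real.rpow_sub hr, Real.rpow_two, ← Real.rpow_natCast r (n - 1), Nat.cast_sub hn,
        Nat.cast_one]
      ring
  have hm : Measurable (Function.uncurry fun (t : ℝ) (ξ : EuclideanSpace ℝ (Fin n)) =>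
      ww n ξ * Real.exp (-(‖ξ‖ ^ (2 * s)) * t)) := by
    unfold Function.uncurry ww; fun_prop
  have hdom : Integrable (Function.uncurry fun (t : ℝ) (ξ : EuclideanSpace ℝ (Fin n)) =>
      ww n ξ * Real.exp (-(‖ξ‖ ^ (2 * s)) * t)) ((volume.restrict (Ioi 0)).prod volume) := by
    rw [integrable_prod_iff' hm.aestronglyMeasurable]
    have hne : ∀ᵐ ξ : EuclideanSpace ℝ (Fin n), ξ ≠ 0 := by
      rw [ae_iff]; simp
    constructor
    · filter_upwards [hne] with ξ hξ
      have hp : 0 < ‖ξ‖ ^ (2 * s) := Real.rpow_pos_of_pos (norm_pos_iff.2 hξ) _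
      simp only [Function.uncurry]
      exact (integrableOn_exp_mul_Ioi (neg_lt_zero.2 hp) 0).const_mul (ww n ξ)
    · refine hq.congr ?_
      filter_upwards [hne] with ξ hξ
      have hp : 0 < ‖ξ‖ ^ (2 * s) := Real.rpow_pos_of_pos (norm_pos_iff.2 hξ) _
      have hw : 0 ≤ ww n ξ := by unfold ww; positivity
      simp only [Function.uncurry, norm_mul, Real.norm_eq_abs, Real.abs_exp, abs_of_nonneg hw]
      rw [integral_const_mul, integral_exp_mul_Ioi (neg_lt_zero.2 hp)]
      simp
  refine hdom.mono' (Measurable.aestronglyMeasurable ?_) ?_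
  · unfold Function.uncurry ww mm stab; fun_prop
  · have hae : ∀ᵐ p ∂((volume.restrict (Ioi (0 : ℝ))).prod
        (volume : Measure (EuclideanSpace ℝ (Fin n)))), p.1 ∈ Ioi (0 : ℝ) :=
      Measure.quasiMeasurePreserving_fst.ae (ae_restrict_mem measurableSet_Ioi)
    filter_upwards [hae] with p hp
    have hp : 0 < p.1 := hp
    simp only [Function.uncurry]
    have hw : 0 ≤ ww n p.2 := by unfold ww; positivity
    have hmm : 0 ≤ mm n s p.1 p.2 := by unfold mm stab; positivity
    rw [Real.norm_eq_abs, abs_of_nonneg (mul_nonneg hw hmm)]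
    refine mul_le_mul_of_nonneg_left ?_ hw
    unfold mm stab
    rw [← Real.exp_add, Real.exp_le_exp]
    have := mul_nonneg hp.le (sq_nonneg ‖p.2‖)
    linarith

/-- The majorant in Fourier form. -/
def WW (n : ℕ) (s : ℝ) (x : EuclideanSpace ℝ (Fin n)) : ℝ :=
  ∫ ξ, (∫ t in Ioi (0 : ℝ), ww n ξ * mm n s t ξ) * Real.cos (2 * Real.pi * ⟪x, ξ⟫)

lemma WW_tendsto {s : ℝ} (hs : s ∈ Ioo (0 : ℝ) 1) (hns : 4 * s < (n : ℝ)) :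
    Filter.Tendsto (WW n s) (Filter.cocompact _) (nhds 0) := by
  have hq := (joint_int hs hns).integral_prod_right
  simp only [Function.uncurry] at hq
  set q : EuclideanSpace ℝ (Fin n) → ℝ := fun ξ => ∫ t in Ioi (0 : ℝ), ww n ξ * mm n s t ξ with hqd
  have h := tendsto_integral_exp_inner_smul_cocompact (fun ξ => (q ξ : ℂ))
  have h2 := (Complex.continuous_re.tendsto 0).comp h
  rw [Complex.zero_re] at h2
  refine h2.congr fun x => ?_
  have hitg : Integrable (fun ξ => Real.fourierChar (-⟪ξ, x⟫) • (q ξ : ℂ)) :=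
    (Real.fourierIntegral_convergent_iff x).2 hq.ofReal
  have h3 := (integral_re hitg).symm
  refine h3.trans (integral_congr_ae (Filter.Eventually.of_forall fun ξ => ?_))
  simp only [RCLike.re_eq_complex_re]
  rw [Circle.smul_def, Real.fourierChar_apply, smul_eq_mul, mul_comm, Complex.re_ofReal_mul,
    Complex.exp_ofReal_mul_I_re, real_inner_comm, mul_neg, Real.cos_neg]

lemma WW_eq {s : ℝ} (hs : s ∈ Ioo (0 : ℝ) 1) (hns : 4 * s < (n : ℝ))
    (x : EuclideanSpace ℝ (Fin n)) :
    Integrable (fun t => ∫ ξ, ww n ξ * mm n s t ξ * Real.cos (2 * Real.pi * ⟪x, ξ⟫))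
      (volume.restrict (Ioi (0 : ℝ))) ∧
    ∫ t in Ioi (0 : ℝ), ∫ ξ, ww n ξ * mm n s t ξ * Real.cos (2 * Real.pi * ⟪x, ξ⟫) = WW n s x := by
  have i1 : Integrable (Function.uncurry fun (t : ℝ) (ξ : EuclideanSpace ℝ (Fin n)) =>
      ww n ξ * mm n s t ξ * Real.cos (2 * Real.pi * ⟪x, ξ⟫))
      ((volume.restrict (Ioi 0)).prod volume) := by
    refine (joint_int hs hns).norm.mono' (Measurable.aestronglyMeasurable ?_)
      (Filter.Eventually.of_forall fun p => ?_)
    · unfold Function.uncurry ww mm stab; fun_prop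
    · simp only [Function.uncurry]
      rw [norm_mul]
      exact mul_le_of_le_one_right (norm_nonneg _) (Real.abs_cos_le_one _)
  refine ⟨i1.integral_prod_left, ?_⟩
  rw [integral_integral_swap i1]
  simp only [integral_mul_const]
  rfl

lemma lint_bound {s : ℝ} (hs : s ∈ Ioo (0 : ℝ) 1) (hns : 4 * s < (n : ℝ))
    (x : EuclideanSpace ℝ (Fin n)) :
    ∫⁻ y in ball (0 : EuclideanSpace ℝ (Fin n)) (1 / 2), ∫⁻ t in Ioi (0 : ℝ),
      ENNReal.ofReal (mixedHeatKernel n s (x - y) t) ≤ ENNReal.ofReal (Real.exp 1 * WW n s x) := by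
  have hH := heat_meas n s
  have hHx : Measurable (fun p : EuclideanSpace ℝ (Fin n) × ℝ =>
      mixedHeatKernel n s (x - p.1) p.2) :=
    hH.comp (f := fun p : EuclideanSpace ℝ (Fin n) × ℝ => (x - p.1, p.2)) (by fun_prop)
  have hHy : ∀ y, Measurable (fun t => ENNReal.ofReal (mixedHeatKernel n s (x - y) t)) := fun y =>
    (hHx.comp (measurable_prodMk_left (x := y))).ennreal_ofReal
  have hcv := fun t (ht : 0 < t) => conv_eq (n := n) (s := s) ht x
  calc _ ≤ ∫⁻ y in ball (0 : EuclideanSpace ℝ (Fin n)) (1 / 2),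
        ENNReal.ofReal (Real.exp 1 * Real.exp (-1 * ‖y‖ ^ 2)) * ∫⁻ t in Ioi (0 : ℝ),
      ENNReal.ofReal (mixedHeatKernel n s (x - y) t) := by
        refine setLIntegral_mono' measurableSet_ball fun y hy => ?_
        refine le_mul_of_one_le_left zero_le ?_
        rw [ENNReal.one_le_ofReal, ← Real.exp_add]
        refine Real.one_le_exp ?_
        have hy : ‖y‖ < 1 / 2 := by simpa using hy
        nlinarith [norm_nonneg y]
    _ ≤ ∫⁻ y : EuclideanSpace ℝ (Fin n),
        ENNReal.ofReal (Real.exp 1 * Real.exp (-1 * ‖y‖ ^ 2)) * ∫⁻ t in Ioi (0 : ℝ),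
      ENNReal.ofReal (mixedHeatKernel n s (x - y) t) := setLIntegral_le_lintegral _ _
    _ = ENNReal.ofReal (Real.exp 1) * ∫⁻ y : EuclideanSpace ℝ (Fin n), ∫⁻ t in Ioi (0 : ℝ),
        ENNReal.ofReal (Real.exp (-1 * ‖y‖ ^ 2)) *
          ENNReal.ofReal (mixedHeatKernel n s (x - y) t) := by
        rw [← lintegral_const_mul']
        · congr 1
          ext y
          rw [lintegral_const_mul _ (hHy y), ← mul_assoc, ENNReal.ofReal_mul (Real.exp_nonneg _)]
        · exact ENNReal.ofReal_ne_top
    _ = ENNReal.ofReal (Real.exp 1) * ∫⁻ t in Ioi (0 : ℝ), ∫⁻ y : EuclideanSpace ℝ (Fin n),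
        ENNReal.ofReal (Real.exp (-1 * ‖y‖ ^ 2)) *
          ENNReal.ofReal (mixedHeatKernel n s (x - y) t) := by
        rw [lintegral_lintegral_swap]
        refine Measurable.aemeasurable ?_
        refine Measurable.mul ?_ hHx.ennreal_ofReal
        fun_prop
    _ = ENNReal.ofReal (Real.exp 1) * ∫⁻ t in Ioi (0 : ℝ),
        ENNReal.ofReal (∫ ξ, ww n ξ * mm n s t ξ * Real.cos (2 * Real.pi * ⟪x, ξ⟫)) := by
        congr 1
        refine setLIntegral_congr_fun measurableSet_Ioi fun t ht => ?_
        have ht : 0 < t := ht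
        rw [← (hcv t ht).2, ofReal_integral_eq_lintegral_ofReal (hcv t ht).1]
        · congr 1
          ext y
          rw [ENNReal.ofReal_mul (Real.exp_nonneg _)]
        · exact Filter.Eventually.of_forall fun y =>
            mul_nonneg (Real.exp_nonneg _) (heat_nonneg hs ht _)
    _ = ENNReal.ofReal (Real.exp 1) * ENNReal.ofReal (WW n s x) := by
        rw [← (WW_eq hs hns x).2, ofReal_integral_eq_lintegral_ofReal (WW_eq hs hns x).1]
        refine (ae_restrict_iff' measurableSet_Ioi).2 (Filter.Eventually.of_forall fun t ht => ?_)
        have ht : 0 < t := ht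
        simp only [Pi.zero_apply]
        rw [← (hcv t ht).2]
        exact integral_nonneg fun y => mul_nonneg (Real.exp_nonneg _) (heat_nonneg hs ht _)
    _ = _ := by rw [ENNReal.ofReal_mul (Real.exp_nonneg _)]

lemma prod_int {s : ℝ} (hs : s ∈ Ioo (0 : ℝ) 1) (hns : 4 * s < (n : ℝ))
    (x : EuclideanSpace ℝ (Fin n)) :
    Integrable (fun p : EuclideanSpace ℝ (Fin n) × ℝ => mixedHeatKernel n s (x - p.1) p.2)
      ((volume.restrict (ball (0 : EuclideanSpace ℝ (Fin n)) (1 / 2))).prod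
        (volume.restrict (Ioi (0 : ℝ)))) ∧
    0 ≤ ∫ y in ball (0 : EuclideanSpace ℝ (Fin n)) (1 / 2), mixedZ n s (x - y) ∧
    ∫ y in ball (0 : EuclideanSpace ℝ (Fin n)) (1 / 2), mixedZ n s (x - y)
      ≤ max (Real.exp 1 * WW n s x) 0 := by
  have hHx : Measurable (fun p : EuclideanSpace ℝ (Fin n) × ℝ =>
      mixedHeatKernel n s (x - p.1) p.2) :=
    (heat_meas n s).comp (f := fun p : EuclideanSpace ℝ (Fin n) × ℝ => (x - p.1, p.2))
      (by fun_prop)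
  have hb := lint_bound hs hns x
  have hl := lintegral_prod (μ := volume.restrict (ball (0 : EuclideanSpace ℝ (Fin n)) (1 / 2)))
    (ν := volume.restrict (Ioi (0 : ℝ)))
    (fun p : EuclideanSpace ℝ (Fin n) × ℝ => ENNReal.ofReal (mixedHeatKernel n s (x - p.1) p.2))
    hHx.ennreal_ofReal.aemeasurable
  have hae : ∀ᵐ p ∂((volume.restrict (ball (0 : EuclideanSpace ℝ (Fin n)) (1 / 2))).prod
        (volume.restrict (Ioi (0 : ℝ)))), 0 ≤ mixedHeatKernel n s (x - p.1) p.2 := by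
    have : ∀ᵐ p ∂((volume.restrict (ball (0 : EuclideanSpace ℝ (Fin n)) (1 / 2))).prod
        (volume.restrict (Ioi (0 : ℝ)))), p.2 ∈ Ioi (0 : ℝ) :=
      Measure.quasiMeasurePreserving_snd.ae (ae_restrict_mem measurableSet_Ioi)
    filter_upwards [this] with p hp
    exact heat_nonneg hs hp _
  have hi : Integrable (fun p : EuclideanSpace ℝ (Fin n) × ℝ => mixedHeatKernel n s (x - p.1) p.2)
      ((volume.restrict (ball (0 : EuclideanSpace ℝ (Fin n)) (1 / 2))).prod
        (volume.restrict (Ioi (0 : ℝ)))) := by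
    refine ⟨hHx.aestronglyMeasurable, ?_⟩
    rw [hasFiniteIntegral_iff_ofReal hae, hl]
    exact lt_of_le_of_lt hb ENNReal.ofReal_lt_top
  have heq : ∫ y in ball (0 : EuclideanSpace ℝ (Fin n)) (1 / 2), mixedZ n s (x - y)
      = ∫ p, mixedHeatKernel n s (x - p.1) p.2
        ∂((volume.restrict (ball (0 : EuclideanSpace ℝ (Fin n)) (1 / 2))).prod
        (volume.restrict (Ioi (0 : ℝ)))) := by
    rw [integral_prod _ hi]
    rfl
  refine ⟨hi, ?_, ?_⟩
  · rw [heq]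
    exact integral_nonneg_of_ae hae
  · rw [heq, integral_eq_lintegral_of_nonneg_ae hae hHx.aestronglyMeasurable, hl,
      ← ENNReal.toReal_ofReal']
    exact ENNReal.toReal_mono ENNReal.ofReal_ne_top hb

lemma omega_lower (n : ℕ) {s : ℝ} (hs : s ∈ Ioo (0 : ℝ) 1) (hns : 4 * s < (n : ℝ)) :
    ∃ k : ℝ, 0 < k ∧ ∀ x : EuclideanSpace ℝ (Fin n),
      k * (1 + ‖x‖) ^ (-((n : ℝ) + 2 * s)) ≤
        ∫ y in ball (0 : EuclideanSpace ℝ (Fin n)) (1 / 2), mixedZ n s (x - y) := by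
  obtain ⟨k, hk, hl⟩ := heat_lower n hs
  have hv : 0 < volume.real (ball (0 : EuclideanSpace ℝ (Fin n)) (1 / 2)) :=
    ENNReal.toReal_pos (measure_ball_pos _ _ (by norm_num)).ne' measure_ball_lt_top.ne
  refine ⟨volume.real (ball (0 : EuclideanSpace ℝ (Fin n)) (1 / 2)) * k, by positivity,
    fun x => ?_⟩
  obtain ⟨hi, -, -⟩ := prod_int hs hns x
  have hx1 : 1 ≤ 1 + ‖x‖ := by linarith [norm_nonneg x]
  have hR : (1 + ‖x‖) ^ (-((n : ℝ) + 2 * s)) = ((1 + ‖x‖) ^ 2) ^ (-((n : ℝ) / 2 + s)) := by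
    rw [← Real.rpow_two, ← Real.rpow_mul (by linarith)]
    congr 1; ring
  have hZi : Integrable (fun y => mixedZ n s (x - y))
      (volume.restrict (ball (0 : EuclideanSpace ℝ (Fin n)) (1 / 2))) := hi.integral_prod_left
  have hmono : ∫ y in ball (0 : EuclideanSpace ℝ (Fin n)) (1 / 2),
      k * (1 + ‖x‖) ^ (-((n : ℝ) + 2 * s)) ≤
      ∫ y in ball (0 : EuclideanSpace ℝ (Fin n)) (1 / 2), mixedZ n s (x - y) := by
    refine integral_mono_ae (integrableOn_const measure_ball_lt_top.ne) hZi ?_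
    filter_upwards [hi.prod_right_ae, ae_restrict_mem measurableSet_ball] with y hy hyb
    have hyb : ‖y‖ < 1 / 2 := by simpa using hyb
    have hxy : ‖x - y‖ ≤ 1 + ‖x‖ := (norm_sub_le x y).trans (by linarith)
    have hb : ∀ t ∈ Ioc (1 : ℝ) 2,
        k * (1 + ‖x‖) ^ (-((n : ℝ) + 2 * s)) ≤ mixedHeatKernel n s (x - y) t := fun t ht => by
      rw [hR]
      exact hl _ _ t (one_le_pow₀ hx1) (pow_le_pow_left₀ (norm_nonneg _) hxy 2) ht
    have hsub : Ioc (1 : ℝ) 2 ⊆ Ioi 0 := fun t ht => lt_trans one_pos ht.1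
    have hy' : IntegrableOn (fun t => mixedHeatKernel n s (x - y) t) (Ioi 0) := hy
    calc k * (1 + ‖x‖) ^ (-((n : ℝ) + 2 * s))
        = ∫ t in Ioc (1 : ℝ) 2, k * (1 + ‖x‖) ^ (-((n : ℝ) + 2 * s)) := by
          rw [setIntegral_const, Real.volume_real_Ioc_of_le (by norm_num)]; norm_num
      _ ≤ ∫ t in Ioc (1 : ℝ) 2, mixedHeatKernel n s (x - y) t :=
          setIntegral_mono_on (integrableOn_const (by simp)) (hy'.mono_set hsub)
            measurableSet_Ioc hb
      _ ≤ ∫ t in Ioi (0 : ℝ), mixedHeatKernel n s (x - y) t := by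
          refine setIntegral_mono_set hy' ?_ (Filter.Eventually.of_forall hsub)
          exact (ae_restrict_iff' measurableSet_Ioi).2
            (Filter.Eventually.of_forall fun t ht => heat_nonneg hs ht _)
  refine le_trans (le_of_eq ?_) hmono
  rw [setIntegral_const, smul_eq_mul, mul_assoc]

end helpers

/-- The barrier `ω = 𝓩 * χ_{B_{1/2}}` is positive, vanishes at infinity, and satisfies
`ω(x) ≥ c₁/|x|^{n+2s}` for `|x| > 1` (here `n > 4s`). -/
theorem stmt16 (n : ℕ) (s : ℝ) (hs : s ∈ Ioo (0 : ℝ) 1) (hns : 4 * s < (n : ℝ)) :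
    (∀ x : EuclideanSpace ℝ (Fin n),
      0 < ∫ y in ball (0 : EuclideanSpace ℝ (Fin n)) (1 / 2), mixedZ n s (x - y)) ∧
    Filter.Tendsto
      (fun x : EuclideanSpace ℝ (Fin n) =>
        ∫ y in ball (0 : EuclideanSpace ℝ (Fin n)) (1 / 2), mixedZ n s (x - y))
      (Filter.cocompact (EuclideanSpace ℝ (Fin n))) (nhds 0) ∧
    ∃ c₁ : ℝ, 0 < c₁ ∧
      ∀ x : EuclideanSpace ℝ (Fin n), 1 < ‖x‖ →
        c₁ / ‖x‖ ^ ((n : ℝ) + 2 * s)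
          ≤ ∫ y in ball (0 : EuclideanSpace ℝ (Fin n)) (1 / 2), mixedZ n s (x - y) := by
  obtain ⟨k, hk, hl⟩ := omega_lower n hs hns
  refine ⟨fun x => ?_, ?_, k * (2 : ℝ) ^ (-((n : ℝ) + 2 * s)), by positivity, fun x hx => ?_⟩
  · refine lt_of_lt_of_le ?_ (hl x)
    have : 0 < 1 + ‖x‖ := by linarith [norm_nonneg x]
    positivity
  · have h1 : Filter.Tendsto (fun x : EuclideanSpace ℝ (Fin n) => max (Real.exp 1 * WW n s x) 0)
        (Filter.cocompact (EuclideanSpace ℝ (Fin n))) (nhds 0) := by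
      have := ((WW_tendsto hs hns).const_mul (Real.exp 1)).max
        (tendsto_const_nhds (x := (0 : ℝ)))
      simpa using this
    exact squeeze_zero (fun x => (prod_int hs hns x).2.1) (fun x => (prod_int hs hns x).2.2) h1
  · refine le_trans ?_ (hl x)
    have hx0 : 0 < ‖x‖ := by linarith
    rw [div_eq_mul_inv, ← Real.rpow_neg hx0.le, mul_assoc, ← Real.mul_rpow (by norm_num) hx0.le]
    refine mul_le_mul_of_nonneg_left ?_ hk.le
    refine Real.rpow_le_rpow_of_nonpos (by linarith) (by linarith) ?_
    have := hs.1
    have : (0 : ℝ) ≤ n := Nat.cast_nonneg n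
    linarith
end
end
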